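/- arXiv:1304.3530 — 2 statements merged into one kernel-verified Lean document; each statement's English description precedes it below -/
import Mathlib

section
/- The equation 2^r + 1 = 3^s · y^n has no solution in positive integers r, s, y, n with 3 ∤ y, y > 1 and n > 1. -/
open Polynomial in
theorem coeff_prod_of_natDegree_le_sum {ι R : Type*} [CommRing R] (s : Finset ι) (f : ι → R[X])
    (d : ι → ℕ) (h : ∀ i ∈ s, (f i).natDegree ≤ d i) :
    (∏ i ∈ s, f i).natDegree ≤ ∑ i ∈ s, d i ∧
      (∏ i ∈ s, f i).coeff (∑ i ∈ s, d i) = ∏ i ∈ s, (f i).coeff (d i) := by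
  classical
  induction s using Finset.induction_on with
  | empty => simp
  | insert a s ha ih =>
    obtain ⟨h1, h2⟩ := ih fun i hi => h i (Finset.mem_insert_of_mem hi)
    have h3 := h a (Finset.mem_insert_self a s)
    rw [Finset.prod_insert ha, Finset.sum_insert ha, Finset.prod_insert ha, ← h2]
    exact ⟨natDegree_mul_le_of_le h3 h1, coeff_mul_add_eq_of_natDegree_le h3 h1⟩

open Polynomial in
/-- Zero estimate for the points `(x, w)` with `x` running through translates. -/
theorem eq_zero_of_vanishing {J m : ℕ} (P : Fin J → ℚ[X]) (hP : ∀ j, (P j).natDegree ≤ m)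
    (β δ : ℚ) (hβ : Function.Injective fun j : Fin J => β ^ (j : ℕ)) (S : Finset ℚ)
    (hS : J * m < S.card)
    (hV : ∀ x ∈ S, ∃ w : ℚ, w ≠ 0 ∧ ∀ s : ℕ, s < J →
      ∑ j, (P j).eval (x + δ * s) * (w * β ^ s) ^ (j : ℕ) = 0) (j : Fin J) : P j = 0 := by
  classical
  by_contra hj
  set N := {j : Fin J // P j ≠ 0}
  set n := Fintype.card N
  have hnJ : n ≤ J := (Fintype.card_subtype_le _).trans_eq (Fintype.card_fin J)
  let φ : Fin n ≃ N := (Fintype.equivFin N).symm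
  let Mx : Matrix (Fin n) (Fin n) ℚ[X] := fun s j =>
    (P (φ j).1).comp (X + C (δ * (s : ℕ))) * C (β ^ ((s : ℕ) * ((φ j).1 : ℕ)))
  have hdeg : ∀ s j, (Mx s j).natDegree ≤ (P (φ j).1).natDegree := by
    intro s j
    refine (natDegree_mul_C_le _ _).trans ?_
    rw [natDegree_comp, natDegree_X_add_C, mul_one]
  have hcoeff : ∀ s j, (Mx s j).coeff (P (φ j).1).natDegree =
      (P (φ j).1).leadingCoeff * (β ^ ((φ j).1 : ℕ)) ^ (s : ℕ) := by
    intro s j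
    simp only [Mx, coeff_mul_C]
    have h1 : ((P (φ j).1).comp (X + C (δ * (s : ℕ)))).natDegree = (P (φ j).1).natDegree := by
      rw [natDegree_comp, natDegree_X_add_C, mul_one]
    have h2 := leadingCoeff_comp (p := P (φ j).1) (q := X + C (δ * (s : ℕ)))
      (by rw [natDegree_X_add_C]; exact one_ne_zero)
    rw [leadingCoeff, h1] at h2
    rw [h2, leadingCoeff_X_add_C, one_pow, mul_one, mul_comm (s : ℕ), pow_mul]
  set D := ∑ j, (P (φ j).1).natDegree
  have hprod := fun σ : Equiv.Perm (Fin n) => coeff_prod_of_natDegree_le_sum Finset.univ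
    (fun j => Mx (σ j) j) (fun j => (P (φ j).1).natDegree) (fun j _ => hdeg _ j)
  have hdet : Mx.det.coeff D ≠ 0 := by
    have h1 : Mx.det.coeff D = (Matrix.of fun s j : Fin n =>
        (P (φ j).1).leadingCoeff * (β ^ ((φ j).1 : ℕ)) ^ (s : ℕ)).det := by
      rw [Matrix.det_apply, Matrix.det_apply, finsetSum_coeff]
      refine Finset.sum_congr rfl fun σ _ => ?_
      rw [coeff_smul, (hprod σ).2]
      simp [hcoeff]
    have h2 : (Matrix.of fun s j : Fin n =>
        (P (φ j).1).leadingCoeff * (β ^ ((φ j).1 : ℕ)) ^ (s : ℕ)) =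
        Matrix.of fun s j : Fin n => (P (φ j).1).leadingCoeff *
          (Matrix.vandermonde fun j : Fin n => β ^ ((φ j).1 : ℕ)).transpose s j := by
      ext s j; simp [Matrix.vandermonde]
    rw [h1, h2, Matrix.det_mul_row, Matrix.det_transpose]
    refine mul_ne_zero (Finset.prod_ne_zero_iff.2 fun j _ =>
      leadingCoeff_ne_zero.2 (φ j).2) (Matrix.det_vandermonde_ne_zero_iff.2 ?_)
    intro a b hab
    exact φ.injective (Subtype.ext (hβ hab))
  have hD : Mx.det.natDegree ≤ J * m := by
    rw [Matrix.det_apply]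
    refine natDegree_sum_le_of_forall_le _ _ fun σ _ => ?_
    refine (natDegree_smul_le _ _).trans ((hprod σ).1.trans ?_)
    calc ∑ j, (P (φ j).1).natDegree ≤ ∑ _j : Fin n, m := Finset.sum_le_sum fun j _ => hP _
      _ = n * m := by simp
      _ ≤ J * m := Nat.mul_le_mul_right _ hnJ
  have hne : Mx.det ≠ 0 := fun h => hdet (by simp [h])
  refine absurd (card_le_degree_of_subset_roots (p := Mx.det) (Z := S) ?_) (by omega)
  intro x hx
  rw [Finset.mem_val] at hx
  rw [mem_roots hne, IsRoot, ← coe_evalRingHom, RingHom.map_det]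
  obtain ⟨w, hw, hV⟩ := hV x hx
  refine Matrix.exists_mulVec_eq_zero_iff.1 ⟨fun j => w ^ ((φ j).1 : ℕ), ?_, ?_⟩
  · intro h
    have := congrFun h (φ.symm ⟨j, hj⟩)
    simp at this
    exact hw this.1
  · ext s
    have h1 := hV s (s.2.trans_le hnJ)
    have h2 : ∑ j, (P j).eval (x + δ * (s : ℕ)) * (w * β ^ (s : ℕ)) ^ (j : ℕ) =
        ∑ j : N, (P j.1).eval (x + δ * (s : ℕ)) * (w * β ^ (s : ℕ)) ^ (j.1 : ℕ) := by
      rw [← Finset.sum_filter_of_ne (p := fun j => P j ≠ 0)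
        (fun j _ hne h0 => hne (by rw [h0, eval_zero, zero_mul]))]
      exact Finset.sum_subtype _ (by simp) _
    rw [h2, ← φ.sum_comp] at h1
    simp only [Matrix.mulVec, dotProduct, Pi.zero_apply]
    rw [← h1]
    refine Finset.sum_congr rfl fun j _ => ?_
    change eval x (Mx s j) * w ^ ((φ j).1 : ℕ) = _
    simp only [Mx, eval_mul, eval_comp, eval_C, eval_add, eval_X]
    ring

theorem sum_choose_mul_choose_mul_pow (l : ℤ) (z i : ℕ) :
    ∑ k ∈ Finset.range (z + 1), (z.choose k : ℤ) * ((k.choose i : ℤ) * (l - 1) ^ (k - i) * l ^ i) =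
      (z.choose i : ℤ) * l ^ z := by
  rcases lt_or_ge z i with hz | hz
  · rw [Nat.choose_eq_zero_of_lt hz]
    simp only [Nat.cast_zero, zero_mul]
    refine Finset.sum_eq_zero fun k hk => ?_
    rw [Nat.choose_eq_zero_of_lt (show k < i by have := Finset.mem_range.1 hk; omega)]
    simp
  · obtain ⟨t, rfl⟩ := Nat.exists_eq_add_of_le hz
    rw [show i + t + 1 = i + (t + 1) by ring, Finset.sum_range_add]
    have h1 : ∑ k ∈ Finset.range i, ((i + t).choose k : ℤ) *
        ((k.choose i : ℤ) * (l - 1) ^ (k - i) * l ^ i) = 0 :=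
      Finset.sum_eq_zero fun k hk => by
        rw [Nat.choose_eq_zero_of_lt (Finset.mem_range.1 hk)]; simp
    have h2 : l ^ t = ∑ k ∈ Finset.range (t + 1), (l - 1) ^ k * (t.choose k : ℤ) := by
      simpa using add_pow (l - 1) 1 t
    rw [h1, zero_add, pow_add, h2, Finset.mul_sum, Finset.mul_sum]
    refine Finset.sum_congr rfl fun k hk => ?_
    have h3 : (i + t).choose (i + k) * (i + k).choose i = (i + t).choose i * t.choose k := by
      have := Nat.choose_mul (n := i + t) (k := i + k) (s := i) (by omega)
      simpa using this
    have h3' : ((i + t).choose (i + k) : ℤ) * (i + k).choose i = (i + t).choose i * t.choose k := by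
      exact_mod_cast h3
    rw [show i + k - i = k by omega]
    linear_combination (l - 1) ^ k * l ^ i * h3'

theorem exists_small_solution {κ : Type*} [Fintype κ] (N : κ → ℕ) (K : ℕ) (d : ℕ → ℕ)
    (L : ℕ → κ → ℤ) (h : ∏ t ∈ Finset.range K, 2 ^ d t < ∏ k, N k) :
    ∃ c : κ → ℤ, c ≠ 0 ∧ (∀ k, |c k| < N k) ∧ ∀ t < K, (2 ^ d t : ℤ) ∣ ∑ k, c k * L t k := by
  classical
  have : ∀ t : Fin K, NeZero (2 ^ d t) := fun t => ⟨by positivity⟩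
  let f : (∀ k, Fin (N k)) → ∀ t : Fin K, ZMod (2 ^ d t) := fun x t =>
    ((∑ k, ((x k : ℕ) : ℤ) * L t k : ℤ) : ZMod (2 ^ d t))
  obtain ⟨x, x', hne, hxx⟩ := Fintype.exists_ne_map_eq_of_card_lt f (by
    simp only [Fintype.card_pi, Fintype.card_fin, ZMod.card]
    rwa [Fin.prod_univ_eq_prod_range (fun t => 2 ^ d t) K])
  refine ⟨fun k => ((x k : ℕ) : ℤ) - ((x' k : ℕ) : ℤ), ?_, ?_, ?_⟩
  · intro h0
    refine hne (funext fun k => Fin.ext ?_)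
    have := congrFun h0 k
    simp only [Pi.zero_apply] at this
    omega
  · intro k
    have h1 := (x k).2
    have h2 := (x' k).2
    change |((x k : ℕ) : ℤ) - ((x' k : ℕ) : ℤ)| < N k
    rw [abs_lt]
    constructor <;> omega
  · intro t ht
    have := congrFun hxx ⟨t, ht⟩
    simp only [f] at this
    rw [ZMod.intCast_eq_intCast_iff_dvd_sub] at this
    simp only [sub_mul, Finset.sum_sub_distrib]
    rw [← dvd_neg, neg_sub]
    exact_mod_cast this

theorem choose_le_two_pow {X e n i : ℕ} (hX : X ≤ 20 * n * 2 ^ e) :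
    X.choose i ≤ 2 ^ (e * i + 32 * n) := by
  have h1 : (X.choose i : ℝ) ≤ (X : ℝ) ^ i / (i.factorial : ℝ) := Nat.choose_le_pow_div i X
  have h2 : ((20 * n : ℕ) : ℝ) ^ i / (i.factorial : ℝ) ≤ Real.exp ((20 * n : ℕ) : ℝ) :=
    Real.pow_div_factorial_le_exp _ (by positivity) i
  have h3 : Real.exp ((20 * n : ℕ) : ℝ) ≤ 2 ^ (32 * n) := by
    rw [← mul_one ((20 * n : ℕ) : ℝ), Real.exp_nat_mul, pow_mul, pow_mul]
    refine pow_le_pow_left₀ (by positivity) ?_ n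
    calc Real.exp 1 ^ 20 ≤ 3 ^ 20 :=
          pow_le_pow_left₀ (by positivity) (Real.exp_one_lt_three.le) 20
      _ ≤ 2 ^ 32 := by norm_num
  have h4 : (X : ℝ) ^ i ≤ ((20 * n : ℕ) : ℝ) ^ i * 2 ^ (e * i) := by
    rw [pow_mul, ← mul_pow]
    refine pow_le_pow_left₀ (by positivity) ?_ i
    exact_mod_cast hX
  have h5 : (X.choose i : ℝ) ≤ 2 ^ (e * i + 32 * n) := by
    calc (X.choose i : ℝ) ≤ (X : ℝ) ^ i / (i.factorial : ℝ) := h1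
      _ ≤ ((20 * n : ℕ) : ℝ) ^ i * 2 ^ (e * i) / (i.factorial : ℝ) := by gcongr
      _ = 2 ^ (e * i) * (((20 * n : ℕ) : ℝ) ^ i / (i.factorial : ℝ)) := by ring
      _ ≤ 2 ^ (e * i) * 2 ^ (32 * n) := by gcongr; exact h2.trans h3
      _ = _ := by rw [pow_add]
  exact_mod_cast h5

open Polynomial in
theorem eval_sum_choose {I : ℕ} (c : Fin I → ℤ) (z : ℕ) :
    eval (z : ℚ) (∑ i, C ((c i : ℚ) / ((i : ℕ).factorial : ℚ)) * descPochhammer ℚ i) =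
      ((∑ i, c i * (z.choose i : ℤ) : ℤ) : ℚ) := by
  rw [eval_finsetSum]
  simp only [eval_mul, eval_C, descPochhammer_eval_eq_descFactorial,
    Nat.descFactorial_eq_factorial_mul_choose]
  push_cast
  refine Finset.sum_congr rfl fun i _ => ?_
  have : ((i : ℕ).factorial : ℚ) ≠ 0 := by positivity
  field_simp

open Polynomial in
theorem eq_zero_of_sum_choose_poly {I : ℕ} (c : Fin I → ℤ)
    (h : ∑ i, C ((c i : ℚ) / ((i : ℕ).factorial : ℚ)) * descPochhammer ℚ i = 0) (i : Fin I) :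
    c i = 0 := by
  have hz : ∀ z : ℕ, ∑ i, c i * (z.choose i : ℤ) = 0 := by
    intro z
    have := congrArg (eval (z : ℚ)) h
    rw [eval_sum_choose, eval_zero] at this
    exact_mod_cast this
  obtain ⟨i, hi⟩ := i
  induction i using Nat.strong_induction_on with
  | _ i ih =>
    have := hz i
    rw [Finset.sum_eq_single (⟨i, hi⟩ : Fin I)] at this
    · simpa using this
    · intro b _ hb
      rcases lt_or_gt_of_ne (fun h => hb (Fin.ext h) : (b : ℕ) ≠ i) with h1 | h1
      · rw [show b = ⟨b, b.2⟩ from rfl, ih b h1 b.2, zero_mul]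
      · rw [Nat.choose_eq_zero_of_lt h1]; simp
    · simp

theorem sum_fin_id_mul_two (N : ℕ) : (∑ i : Fin N, ((i : ℕ) : ℤ)) * 2 = N * (N - 1) := by
  rw [Fin.sum_univ_eq_sum_range (fun i => (i : ℤ))]
  induction N with
  | zero => simp
  | succ N ih => rw [Finset.sum_range_succ, add_mul, ih]; push_cast; ring

/-- A nontrivial small combination of the functions `z ↦ α ^ (j z) * choose z i` all of whose values
are highly divisible by `2`. -/
theorem exists_auxiliary_function {n J e : ℕ} (α v : ℤ) (hα : 4 ∣ α - 1) (hJ : J = e + 7)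
    (hn : 3 * J ≤ 2 * n) :
    ∃ c : Fin (20 * n) × Fin J → ℤ, c ≠ 0 ∧
      (∀ k, |c k| < 2 ^ (30 * n * J - 33 * n - e * k.1 - (16 * n + 2 * J) * k.2)) ∧
      ∀ z : ℕ, (2 ^ (30 * n * J) : ℤ) ∣
        ∑ k, c k * (v ^ (k.2 : ℕ) * (α ^ (k.2 : ℕ)) ^ z * (z.choose k.1 : ℤ)) := by
  have hμ : ∀ j : ℕ, ∃ μ, α ^ j - 1 = 4 * μ := fun j => by
    have := hα.trans (sub_dvd_pow_sub_pow α 1 j)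
    rwa [one_pow] at this
  choose μ hμ using hμ
  let d : ℕ → ℕ := fun t => 30 * n * J - 2 * (t + 1 - 20 * n)
  let L : ℕ → Fin (20 * n) × Fin J → ℤ := fun t k =>
    v ^ (k.2 : ℕ) * ((t.choose k.1 : ℤ) * (4 ^ ((t - k.1) - (t + 1 - 20 * n)) *
      μ k.2 ^ (t - k.1)) * (α ^ (k.2 : ℕ)) ^ (k.1 : ℕ))
  obtain ⟨c, hc0, hc, hcL⟩ := exists_small_solution
    (fun k : Fin (20 * n) × Fin J =>
      2 ^ (30 * n * J - 33 * n - e * k.1 - (16 * n + 2 * J) * k.2))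
    (20 * n - 1 + 15 * n * J) d L (by
      rw [Finset.prod_pow_eq_pow_sum, Finset.prod_pow_eq_pow_sum]
      refine Nat.pow_lt_pow_right (by norm_num) ?_
      have h1 : ∑ t ∈ Finset.range (20 * n - 1 + 15 * n * J), ((d t : ℕ) : ℤ) =
          (20 * n - 1) * (30 * n * J) + (15 * n * J) * (15 * n * J + 1) := by
        have ha : ∀ t ∈ Finset.range (20 * n - 1), ((d t : ℕ) : ℤ) = 30 * n * J := by
          intro t ht
          have := Finset.mem_range.1 ht
          simp only [d, show t + 1 - 20 * n = 0 by omega, mul_zero, Nat.sub_zero]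
          push_cast; ring
        have hb : ∀ t ∈ Finset.range (15 * n * J),
            ((d (20 * n - 1 + t) : ℕ) : ℤ) = 30 * n * J - 2 * t := by
          intro t ht
          have := Finset.mem_range.1 ht
          simp only [d, show 20 * n - 1 + t + 1 - 20 * n = t by omega]
          rw [Nat.cast_sub (by linarith)]
          push_cast; ring
        rw [Finset.sum_range_add, Finset.sum_congr rfl ha, Finset.sum_congr rfl hb,
          Finset.sum_sub_distrib, ← Finset.mul_sum]
        have := sum_fin_id_mul_two (15 * n * J)
        rw [Fin.sum_univ_eq_sum_range (fun i => (i : ℤ))] at this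
        simp only [Finset.sum_const, Finset.card_range, nsmul_eq_mul, ← Finset.mul_sum]
        rw [Nat.cast_sub (by omega)]
        push_cast at this ⊢
        linarith
      have h2 : ∑ k : Fin (20 * n) × Fin J, ((30 * n * J - 33 * n : ℤ) - e * (k.1 : ℕ) -
            (16 * n + 2 * J) * (k.2 : ℕ)) ≤
          ∑ k : Fin (20 * n) × Fin J,
          ((30 * n * J - 33 * n - e * k.1 - (16 * n + 2 * J) * k.2 : ℕ) : ℤ) := by
        refine Finset.sum_le_sum fun k _ => ?_
        have h4 : ((30 * n * J : ℕ) : ℤ) = 30 * n * J := by push_cast; ring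
        have h5 : ((e * k.1 : ℕ) : ℤ) = e * (k.1 : ℕ) := by push_cast; ring
        have h6 : (((16 * n + 2 * J) * k.2 : ℕ) : ℤ) = (16 * n + 2 * J) * (k.2 : ℕ) := by
          push_cast; ring
        rw [← h4, ← h5, ← h6]
        omega
      have h3 : (∑ k : Fin (20 * n) × Fin J, ((30 * n * J - 33 * n : ℤ) - e * (k.1 : ℕ) -
            (16 * n + 2 * J) * (k.2 : ℕ))) * 2 = 2 * (20 * n) * J * (30 * n * J - 33 * n) -
          e * J * (20 * n) * (20 * n - 1) - (16 * n + 2 * J) * (20 * n) * (J * (J - 1)) := by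
        have ha := sum_fin_id_mul_two (20 * n)
        have hb := sum_fin_id_mul_two J
        rw [Fintype.sum_prod_type]
        simp only [Finset.sum_sub_distrib, Finset.sum_const, Finset.card_univ, Fintype.card_fin,
          nsmul_eq_mul, ← Finset.mul_sum]
        push_cast at ha ⊢
        linear_combination (-e * J : ℤ) * ha - (16 * n + 2 * J) * (20 * n) * hb
      have h4 : (0 : ℤ) < n * J *
          (430 * n * J - 2200 * n - 400 * e * n + 20 * e - 40 * J ^ 2 + 40 * J + 30) := by
        have hn' : (3 * J : ℤ) ≤ 2 * n := by exact_mod_cast hn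
        have hJ' : (J : ℤ) = e + 7 := by exact_mod_cast hJ
        have he : (0 : ℤ) ≤ e := by positivity
        have hJ0 : (0 : ℤ) < J := by omega
        have hn0 : (0 : ℤ) < n := by omega
        refine mul_pos (mul_pos hn0 hJ0) ?_
        have h5 := mul_le_mul_of_nonneg_right hn' hJ0.le
        rw [hJ'] at h5 ⊢
        nlinarith [mul_nonneg hn0.le he]
      rw [← Nat.cast_lt (α := ℤ), Nat.cast_sum, Nat.cast_sum, h1]
      linarith)
  refine ⟨c, hc0, by exact_mod_cast hc, fun z => ?_⟩
  have h1 : ∑ k, c k * (v ^ (k.2 : ℕ) * (α ^ (k.2 : ℕ)) ^ z * (z.choose k.1 : ℤ)) =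
      ∑ t ∈ Finset.range (z + 1), (z.choose t : ℤ) * (4 ^ (t + 1 - 20 * n) * ∑ k, c k * L t k) := by
    simp only [Finset.mul_sum]
    rw [Finset.sum_comm]
    refine Finset.sum_congr rfl fun k _ => ?_
    have := sum_choose_mul_choose_mul_pow (α ^ (k.2 : ℕ)) z k.1
    rw [show c k * (v ^ (k.2 : ℕ) * (α ^ (k.2 : ℕ)) ^ z * (z.choose k.1 : ℤ)) =
      c k * v ^ (k.2 : ℕ) * ((z.choose k.1 : ℤ) * (α ^ (k.2 : ℕ)) ^ z) by ring, ← this,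
      Finset.mul_sum]
    refine Finset.sum_congr rfl fun t _ => ?_
    rcases lt_or_ge t k.1 with ht | ht
    · simp [L, Nat.choose_eq_zero_of_lt ht]
    · have : (4 : ℤ) ^ (t - k.1) = 4 ^ (t + 1 - 20 * n) * 4 ^ ((t - k.1) - (t + 1 - 20 * n)) := by
        rw [← pow_add]
        congr 1
        have := k.1.2
        omega
      rw [hμ, mul_pow, this]
      simp only [L]
      ring
  rw [h1]
  refine Finset.dvd_sum fun t _ => Dvd.dvd.mul_left ?_ _
  rw [show (4 : ℤ) = 2 ^ 2 by norm_num, ← pow_mul]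
  rcases lt_or_ge t (20 * n - 1 + 15 * n * J) with ht | ht
  · have := hcL t ht
    refine (pow_dvd_pow 2 ?_).trans (pow_add (2 : ℤ) _ _ ▸ mul_dvd_mul_left _ this)
    simp only [d]
    omega
  · refine Dvd.dvd.mul_right (pow_dvd_pow 2 ?_) _
    have : 30 * n * J = 2 * (15 * n * J) := by ring
    omega

theorem fourteen_mul_sq_le_two_pow {n : ℕ} (hn : 11 ≤ n) : 14 * n ^ 2 ≤ 2 ^ n := by
  induction n, hn using Nat.le_induction with
  | base => norm_num
  | succ n hn ih => rw [pow_succ 2]; nlinarith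

set_option maxHeartbeats 1000000 in
open Polynomial in
theorem false_of_large_exponent {p q y e : ℕ} (hp : Odd p) (hpe : 2 * p ≤ 7 * 2 ^ e) (he : 4 ≤ e)
    (hep : 15 * (e + 7) ^ 2 + 10 * (e + 7) ≤ p) (hqp : 3 * p ≤ q) (h : 2 ^ q + 1 = 3 * y ^ p) :
    False := by
  obtain ⟨J, hJ⟩ : ∃ J, J = e + 7 := ⟨_, rfl⟩
  rw [← hJ] at hep
  have hp0 : 0 < p := hp.pos
  obtain ⟨n, hn1, hn2⟩ : ∃ n, J * q < 2 * p * n ∧ 2 * p * n ≤ J * q + 2 * p := by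
    refine ⟨J * q / (2 * p) + 1, ?_, ?_⟩
    · exact Nat.lt_mul_div_succ _ (by omega)
    · rw [mul_add, mul_one]
      exact Nat.add_le_add_right (Nat.mul_div_le _ _) _
  have hnJ : 3 * J < 2 * n := by
    refine lt_of_mul_lt_mul_left (a := p) ?_ (by omega)
    nlinarith
  have hTq : 30 * n * J ≤ q := by
    refine le_of_mul_le_mul_left (a := p) ?_ hp0
    nlinarith
  have hy : y % 4 = 3 := by
    have h4 : 2 ^ q % 4 = 0 := Nat.mod_eq_zero_of_dvd (pow_dvd_pow 2 (show 2 ≤ q by omega))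
    obtain ⟨k, rfl⟩ := hp
    have h5 : (3 * y ^ (2 * k + 1)) % 4 = 1 := by omega
    rw [pow_succ, pow_mul, Nat.mul_mod, Nat.mul_mod (_ ^ k), Nat.pow_mod, Nat.pow_mod y] at h5
    have hk : k ≠ 0 := by rintro rfl; nlinarith
    have : y % 4 < 4 := Nat.mod_lt _ (by norm_num)
    interval_cases h6 : y % 4 <;> simp_all [zero_pow hk]
  have hy0 : 0 < y := by omega
  set α : ℤ := -y with hα
  set B : ℕ := 5 * n + J with hB
  obtain ⟨c, hc0, hc, hcz⟩ := exists_auxiliary_function (n := n) (J := J) (e := e) α ((-3) ^ B)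
    (by rw [hα]; omega) hJ hnJ.le
  have hαβ : (2 ^ q : ℤ) ∣ α ^ p * (-3) - 1 := by
    rw [hα, hp.neg_pow]
    refine ⟨1, ?_⟩
    have : (2 ^ q + 1 : ℤ) = 3 * y ^ p := by exact_mod_cast h
    linarith
  -- the auxiliary function vanishes on a box
  have hV : ∀ a b : ℕ, a ≤ 4 * J → b ≤ B →
      ∑ k, c k * ((a + p * (B - b)).choose k.1 : ℤ) * (α ^ a * (-3) ^ b) ^ (k.2 : ℕ) = 0 := by
    intro a b ha hb
    set Z := a + p * (B - b)
    have hdvd : (2 ^ (30 * n * J) : ℤ) ∣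
        ∑ k, c k * (Z.choose k.1 : ℤ) * (α ^ a * (-3) ^ b) ^ (k.2 : ℕ) := by
      rw [← dvd_sub_right (hcz Z), ← Finset.sum_sub_distrib]
      refine Finset.dvd_sum fun k _ => ?_
      have h1 : (2 ^ q : ℤ) ∣ α ^ Z * (-3) ^ B - α ^ a * (-3) ^ b := by
        have : α ^ Z * (-3) ^ B - α ^ a * (-3) ^ b =
            α ^ a * (-3) ^ b * ((α ^ p * (-3)) ^ (B - b) - 1 ^ (B - b)) := by
          have hBb : (-3 : ℤ) ^ B = (-3) ^ b * (-3) ^ (B - b) := by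
            rw [← pow_add, Nat.add_sub_cancel' hb]
          rw [hBb]
          simp only [Z, pow_add, pow_mul, mul_pow, one_pow]
          ring
        rw [this]
        exact (hαβ.trans (sub_dvd_pow_sub_pow _ _ _)).mul_left _
      have h2 : (2 ^ q : ℤ) ∣ (α ^ Z * (-3) ^ B) ^ (k.2 : ℕ) - (α ^ a * (-3) ^ b) ^ (k.2 : ℕ) :=
        h1.trans (sub_dvd_pow_sub_pow _ _ _)
      have h3 : c k * (((-3) ^ B) ^ (k.2 : ℕ) * (α ^ (k.2 : ℕ)) ^ Z * (Z.choose k.1 : ℤ)) -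
          c k * (Z.choose k.1 : ℤ) * (α ^ a * (-3) ^ b) ^ (k.2 : ℕ) = c k * (Z.choose k.1 : ℤ) *
          ((α ^ Z * (-3) ^ B) ^ (k.2 : ℕ) - (α ^ a * (-3) ^ b) ^ (k.2 : ℕ)) := by
        rw [mul_pow (α ^ Z), pow_right_comm α]
        ring
      rw [h3]
      exact ((pow_dvd_pow 2 hTq).trans h2).mul_left _
    refine Int.eq_zero_of_abs_lt_dvd hdvd ?_
    have hZ : Z ≤ 20 * n * 2 ^ e := by
      have h16 : 16 ≤ 2 ^ e := by
        calc 16 = 2 ^ 4 := by norm_num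
          _ ≤ 2 ^ e := Nat.pow_le_pow_right (by norm_num) he
      have h1 : p * (B - b) ≤ p * (5 * n + J) := Nat.mul_le_mul_left _ (by omega)
      have h2 : 2 * p * (5 * n + J) ≤ 7 * 2 ^ e * (5 * n + J) := Nat.mul_le_mul_right _ hpe
      simp only [Z]
      nlinarith [Nat.mul_le_mul_left (2 ^ e) hnJ.le, Nat.mul_le_mul_right n h16]
    have hya : y ^ a ≤ 2 ^ (8 * n) := by
      refine (Nat.pow_le_pow_iff_left hp0.ne').1 ?_
      have h1 : 0 < y ^ p := by positivity
      calc (y ^ a) ^ p = (y ^ p) ^ a := pow_right_comm _ _ _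
        _ ≤ (2 ^ q) ^ a := Nat.pow_le_pow_left (by omega) _
        _ = 2 ^ (q * a) := by rw [pow_mul]
        _ ≤ 2 ^ (8 * n * p) := Nat.pow_le_pow_right (by norm_num) (by
          have := Nat.mul_le_mul_left q ha
          nlinarith)
        _ = _ := by rw [pow_mul]
    have h3b : 3 ^ b ≤ 2 ^ (8 * n + 2 * J) := by
      calc 3 ^ b ≤ 3 ^ (5 * n + J) := Nat.pow_le_pow_right (by norm_num) hb
        _ = (3 ^ 5) ^ n * 3 ^ J := by rw [pow_add, pow_mul]
        _ ≤ (2 ^ 8) ^ n * (2 ^ 2) ^ J :=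
          Nat.mul_le_mul (Nat.pow_le_pow_left (by norm_num) _) (Nat.pow_le_pow_left (by norm_num) _)
        _ = _ := by rw [← pow_mul, ← pow_mul, ← pow_add]
    have hW : |α ^ a * (-3) ^ b| ≤ 2 ^ (16 * n + 2 * J) := by
      rw [abs_mul, abs_pow, abs_pow, hα, abs_neg, abs_neg, Nat.abs_cast]
      calc (y : ℤ) ^ a * |3| ^ b = ((y ^ a * 3 ^ b : ℕ) : ℤ) := by push_cast; simp
        _ ≤ ((2 ^ (8 * n) * 2 ^ (8 * n + 2 * J) : ℕ) : ℤ) := by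
          exact_mod_cast Nat.mul_le_mul hya h3b
        _ = _ := by rw [← pow_add]; push_cast; ring_nf
    have hterm : ∀ k, |c k * (Z.choose k.1 : ℤ) * (α ^ a * (-3) ^ b) ^ (k.2 : ℕ)| <
        2 ^ (30 * n * J - n) := by
      intro k
      rcases eq_or_ne (c k) 0 with h0 | h0
      · rw [h0]; simp
      have hk := hc k
      have hm : 30 * n * J - 33 * n - e * k.1 - (16 * n + 2 * J) * k.2 ≠ 0 := by
        intro hm
        rw [hm] at hk
        have := Int.one_le_abs h0
        omega
      rw [abs_mul, abs_mul, abs_pow, Nat.abs_cast]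
      have hch : ((Z.choose k.1 : ℕ) : ℤ) ≤ 2 ^ (e * (k.1 : ℕ) + 32 * n) := by
        exact_mod_cast choose_le_two_pow hZ
      calc |c k| * ((Z.choose k.1 : ℕ) : ℤ) * |α ^ a * (-3) ^ b| ^ (k.2 : ℕ)
          ≤ |c k| * (2 ^ (e * (k.1 : ℕ) + 32 * n) * (2 ^ (16 * n + 2 * J)) ^ (k.2 : ℕ)) := by
            rw [mul_assoc]
            gcongr
        _ < 2 ^ (30 * n * J - 33 * n - e * k.1 - (16 * n + 2 * J) * k.2) *
            (2 ^ (e * (k.1 : ℕ) + 32 * n) * (2 ^ (16 * n + 2 * J)) ^ (k.2 : ℕ)) := by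
            gcongr
        _ = 2 ^ (30 * n * J - n) := by
            rw [← pow_mul, ← pow_add, ← pow_add]
            congr 1
            omega
    calc |∑ k, c k * (Z.choose k.1 : ℤ) * (α ^ a * (-3) ^ b) ^ (k.2 : ℕ)|
        ≤ ∑ k, |c k * (Z.choose k.1 : ℤ) * (α ^ a * (-3) ^ b) ^ (k.2 : ℕ)| :=
          Finset.abs_sum_le_sum_abs _ _
      _ < ∑ _k : Fin (20 * n) × Fin J, 2 ^ (30 * n * J - n) := by
          refine Finset.sum_lt_sum_of_nonempty ?_ fun k _ => hterm k
          exact ⟨(⟨0, by omega⟩, ⟨0, by omega⟩), Finset.mem_univ _⟩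
      _ = (20 * n * J) * 2 ^ (30 * n * J - n) := by simp
      _ ≤ 2 ^ n * 2 ^ (30 * n * J - n) := by
          refine mul_le_mul_of_nonneg_right ?_ (by positivity)
          have := fourteen_mul_sq_le_two_pow (n := n) (by omega)
          exact_mod_cast (show 20 * n * J ≤ 2 ^ n by nlinarith)
      _ = 2 ^ (30 * n * J) := by
          rw [← pow_add]
          congr 1
          have : n ≤ 30 * n * J := by nlinarith
          omega
  -- so all its coefficients vanish
  refine hc0 (funext fun k => ?_)
  obtain ⟨i, j⟩ := k
  refine eq_zero_of_sum_choose_poly (fun i => c (i, j)) ?_ i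
  refine eq_zero_of_vanishing (m := 20 * n - 1) (fun j : Fin J => ∑ i : Fin (20 * n),
    C ((c (i, j) : ℚ) / ((i : ℕ).factorial : ℚ)) * descPochhammer ℚ i) ?_ (-3) (-p) ?_
    ((Finset.range (4 * J) ×ˢ Finset.range (5 * n)).image
      fun ab => ((ab.1 + p * (B - ab.2) : ℕ) : ℚ)) ?_ ?_ j
  · intro j
    refine natDegree_sum_le_of_forall_le _ _ fun i _ => ?_
    refine (natDegree_C_mul_le _ _).trans ?_
    rw [descPochhammer_natDegree]
    omega
  · intro i j hij
    have := congrArg abs hij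
    simp only [abs_pow, abs_neg] at this
    exact Fin.ext (Nat.pow_right_injective (le_refl 3 |>.trans' (by norm_num)) (by
      simp at this ⊢; exact_mod_cast this))
  · rw [Finset.card_image_of_injOn]
    · rw [Finset.card_product, Finset.card_range, Finset.card_range]
      have : J * (20 * n - 1) < J * (20 * n) := Nat.mul_lt_mul_of_pos_left (by omega) (by omega)
      linarith
    · rintro ⟨a, b⟩ hab ⟨a', b'⟩ hab' heq
      simp only [Finset.coe_product, Set.mem_prod, Finset.coe_range, Set.mem_Iio] at hab hab'
      have heq : a + p * (B - b) = a' + p * (B - b') := by exact_mod_cast (show ((a + p * (B - b) : ℕ) : ℚ) = ((a' + p * (B - b') : ℕ) : ℚ) from heq)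
      have hJp : 4 * J ≤ p := by nlinarith
      have h1 := congrArg (· % p) heq
      simp only [Nat.add_mul_mod_self_left] at h1
      rw [Nat.mod_eq_of_lt (by omega), Nat.mod_eq_of_lt (by omega)] at h1
      subst h1
      have := Nat.eq_of_mul_eq_mul_left hp0 (Nat.add_left_cancel heq)
      rw [show b = b' by omega]
  · intro x hx
    obtain ⟨⟨a, b⟩, hab, rfl⟩ := Finset.mem_image.1 hx
    simp only [Finset.mem_product, Finset.mem_range] at hab
    refine ⟨(α : ℚ) ^ a * (-3) ^ b, ?_, fun s hs => ?_⟩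
    · have : (α : ℚ) ≠ 0 := by rw [hα]; push_cast; simp; omega
      positivity
    · have := hV a (b + s) (by omega) (by omega)
      rw [Fintype.sum_prod_type_right] at this
      have hx' : ((a + p * (B - b) : ℕ) : ℚ) + -(p : ℚ) * (s : ℚ) =
          ((a + p * (B - (b + s)) : ℕ) : ℚ) := by
        rw [show B - b = B - (b + s) + s by omega]
        push_cast
        ring
      rw [hx']
      simp only [eval_sum_choose]
      rw [← Int.cast_zero, ← this, Int.cast_sum]
      refine Finset.sum_congr rfl fun j _ => ?_
      push_cast
      rw [Finset.sum_mul]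
      refine Finset.sum_congr rfl fun i _ => ?_
      rw [pow_add]
      ring

/-- The equation `2 ^ q + 1 = 3 * y ^ p` has no solution with `p` large and `q` not too small. -/
theorem two_pow_add_one_ne_three_mul_pow_of_large {p q y : ℕ} (hp : Odd p) (hp' : 5040 ≤ p)
    (hqp : 3 * p ≤ q) : 2 ^ q + 1 ≠ 3 * y ^ p := by
  intro h
  have hex : ∃ e, 2 * p ≤ 7 * 2 ^ e :=
    ⟨p, by have := (Nat.lt_two_pow_self (n := p)).le; omega⟩
  classical
  have h1 := Nat.find_spec hex
  have h2 := fun m (hm : m < Nat.find hex) => Nat.find_min hex hm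
  generalize Nat.find hex = e at h1 h2
  have he : 11 ≤ e := by
    by_contra! hc
    have : 2 ^ e ≤ 2 ^ 10 := Nat.pow_le_pow_right (by norm_num) (by omega)
    omega
  refine false_of_large_exponent hp h1 (by omega) ?_ hqp h
  rcases he.eq_or_lt with rfl | he
  · omega
  obtain ⟨f, rfl⟩ := Nat.exists_eq_add_of_le' (show 12 ≤ e by omega)
  have h3 := h2 (f + 11) (by omega)
  have h4 : ∀ f : ℕ, 15 * (f + 12 + 7) ^ 2 + 10 * (f + 12 + 7) ≤ 7 * 2 ^ (f + 10) := by
    intro f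
    induction f with
    | zero => norm_num
    | succ f ih => rw [show f + 1 + 10 = f + 10 + 1 by ring, pow_succ 2]; nlinarith
  have := h4 f
  rw [show f + 11 = f + 10 + 1 by ring, pow_succ] at h3
  omega

theorem odd_of_three_dvd_two_pow_add_one {r : ℕ} (h : 3 ∣ 2 ^ r + 1) : Odd r := by
  rcases Nat.even_or_odd r with ⟨k, rfl⟩ | h'
  · exfalso
    have h4 : 4 ^ k % 3 = 1 := by simp [Nat.pow_mod]
    have : 2 ^ (k + k) = 4 ^ k := by rw [← two_mul, pow_mul]; norm_num
    omega
  · exact h'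

theorem eq_three_of_sq_eq_two_pow_add_one {r t : ℕ} (h : 2 ^ r + 1 = t ^ 2) : t = 3 := by
  have ht : 1 < t := by
    by_contra! hc
    have := Nat.one_le_two_pow (n := r)
    interval_cases t <;> omega
  obtain ⟨u, rfl⟩ : ∃ u, t = u + 1 := ⟨t - 1, by omega⟩
  have hu : u * (u + 2) = 2 ^ r := by nlinarith
  obtain ⟨a, -, ha⟩ := (Nat.dvd_prime_pow Nat.prime_two).1 (Dvd.intro _ hu)
  obtain ⟨b, -, hb⟩ := (Nat.dvd_prime_pow Nat.prime_two).1 (Dvd.intro_left _ hu)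
  have ha2 : a < 2 := by
    by_contra! hc
    have h1 : 4 ∣ 2 ^ a := pow_dvd_pow 2 hc
    have hb1 : b < 2 := by
      by_contra! hc'
      have h2 : 4 ∣ 2 ^ b := pow_dvd_pow 2 hc'
      omega
    interval_cases b <;> omega
  interval_cases a
  · obtain rfl : u = 1 := by simpa using ha
    rcases b with _ | b
    · omega
    · rw [pow_succ] at hb; omega
  · omega

/-- The exponent `n` cannot be even. -/
theorem two_pow_add_one_ne_three_pow_mul_sq {r s y : ℕ} (hs : 0 < s) (hy : 1 < y) : 2 ^ r + 1 ≠ 3 ^ s * y ^ 2 := by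
  intro h
  have hr : Odd r := odd_of_three_dvd_two_pow_add_one (h ▸ (dvd_pow_self 3 hs.ne').mul_right _)
  obtain ⟨k, rfl⟩ := hr
  rcases Nat.even_or_odd s with ⟨m, rfl⟩ | ⟨m, rfl⟩
  · have h3 : 3 ^ m * y = 3 :=
      eq_three_of_sq_eq_two_pow_add_one (r := 2 * k + 1) (by rw [h]; ring)
    rcases m with _ | m
    · omega
    · have : 0 < 3 ^ m := by positivity
      rw [pow_succ] at h3
      nlinarith
  · rcases k with _ | k
    · have h1 : 0 < 3 ^ (2 * m) := by positivity
      have h2 : 2 ^ 2 ≤ y ^ 2 := Nat.pow_le_pow_left hy 2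
      rw [pow_succ 3] at h
      norm_num at h
      nlinarith
    · have h8 : 2 ^ (2 * (k + 1) + 1) = 8 * 4 ^ k := by
        rw [show 2 * (k + 1) + 1 = 3 + 2 * k by ring, pow_add, pow_mul]; norm_num
      have h9 : 3 ^ (2 * m + 1) % 8 = 3 := by
        rw [pow_succ, pow_mul, Nat.mul_mod, Nat.pow_mod]; norm_num
      have hm : (3 ^ (2 * m + 1) * y ^ 2) % 8 = 1 := by
        rw [h8] at h; omega
      rw [Nat.mul_mod, h9, Nat.pow_mod] at hm
      have : y % 8 < 8 := Nat.mod_lt _ (by norm_num)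
      interval_cases y % 8 <;> omega

theorem two_pow_add_one_eq_three_pow {t n : ℕ} (h : 2 ^ t + 1 = 3 ^ n) : t = 1 ∨ t = 3 := by
  rcases Nat.even_or_odd n with ⟨m, rfl⟩ | ⟨m, rfl⟩
  · have h3 : 3 ^ m = 3 := eq_three_of_sq_eq_two_pow_add_one (r := t) (by rw [h]; ring)
    right
    rw [pow_add, h3] at h
    exact Nat.pow_right_injective (le_refl 2) (by simp only; omega)
  · left
    have h9 : 3 ^ (2 * m + 1) % 8 = 3 := by
      rw [pow_succ, pow_mul, Nat.mul_mod, Nat.pow_mod]; norm_num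
    have h3 : 3 ∣ 3 ^ (2 * m + 1) := dvd_pow_self 3 (by omega)
    rw [← h] at h3
    rcases t with _ | _ | _ | t
    · norm_num at h3
    · rfl
    · norm_num at h3
    · rw [← h, show t + 1 + 1 + 1 = t + 3 by ring, pow_add] at h9; omega

theorem le_one_of_two_pow_add_one_eq {p : ℕ} (hp : p.Prime)
    (main : ∀ q y : ℕ, 1 < y → ¬ 3 ∣ q → Odd q → 2 ^ q + 1 ≠ 3 * y ^ p) (r : ℕ) :
    ∀ s z : ℕ, 0 < s → ¬ 3 ∣ z → 2 ^ r + 1 = 3 ^ s * z ^ p → z ≤ 1 := by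
  induction r using Nat.strong_induction_on with
  | _ r ih =>
  intro s z hs hz h
  have hr : Odd r := odd_of_three_dvd_two_pow_add_one (h ▸ (dvd_pow_self 3 hs.ne').mul_right _)
  have hz3 : ¬ 3 ∣ z ^ p := fun hd => hz (Nat.prime_three.dvd_of_dvd_pow hd)
  by_contra! hz1
  by_cases h3 : 3 ∣ r
  · obtain ⟨t, rfl⟩ := h3
    have ht : Odd t := (Nat.odd_mul.1 hr).2
    have ht0 : 0 < t := ht.pos
    obtain ⟨c, hc⟩ : ∃ c, 2 ^ t = 3 * c + 2 := by
      obtain ⟨k, rfl⟩ := ht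
      have : 2 ^ (2 * k + 1) % 3 = 2 := by
        rw [pow_succ, pow_mul, Nat.mul_mod, Nat.pow_mod]; norm_num
      exact ⟨2 ^ (2 * k + 1) / 3, by
        have h0 := Nat.div_add_mod (2 ^ (2 * k + 1)) 3
        rw [this] at h0; exact h0.symm⟩
    have hf : 9 * ((c + 1) * (3 * c * (c + 1) + 1)) = 3 ^ s * z ^ p := by
      rw [← h, mul_comm 3 t, pow_mul, hc]; ring
    obtain ⟨j, d, hd3, hd⟩ := Nat.exists_eq_pow_mul_and_not_dvd (Nat.succ_ne_zero c) 3 (by norm_num)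
    have hd' : c + 1 = 3 ^ j * d := hd
    have hcop : Nat.Coprime (c + 1) (3 * c * (c + 1) + 1) := by
      simp
    have hE : ¬ 3 ∣ d * (3 * c * (c + 1) + 1) := by
      intro hE
      rcases (Nat.prime_three.dvd_mul).1 hE with hE | hE
      · exact hd3 hE
      · rw [mul_assoc] at hE; omega
    have hf2 : 3 ^ (j + 2) * (d * (3 * c * (c + 1) + 1)) = 3 ^ s * z ^ p := by
      calc 3 ^ (j + 2) * (d * (3 * c * (c + 1) + 1))
          = 9 * ((3 ^ j * d) * (3 * c * (c + 1) + 1)) := by ring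
        _ = _ := by rw [← hd', hf]
    have hjs : j + 2 = s := by
      rcases lt_trichotomy (j + 2) s with hlt | heq | hgt
      · exfalso
        obtain ⟨e, rfl⟩ := Nat.exists_eq_add_of_lt hlt
        apply hE
        rw [show j + 2 + e + 1 = (j + 2) + (e + 1) by ring, pow_add 3 (j + 2) (e + 1),
          mul_assoc (3 ^ (j + 2))] at hf2
        have := Nat.eq_of_mul_eq_mul_left (pow_pos three_pos (j + 2)) hf2
        rw [this, pow_succ]
        exact ⟨3 ^ e * z ^ p, by ring⟩
      · exact heq
      · exfalso
        obtain ⟨e, he⟩ := Nat.exists_eq_add_of_lt hgt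
        apply hz3
        rw [he, show s + e + 1 = s + (e + 1) by ring, pow_add 3 s (e + 1),
          mul_assoc (3 ^ s)] at hf2
        have := Nat.eq_of_mul_eq_mul_left (pow_pos three_pos s) hf2
        rw [← this, pow_succ]
        exact ⟨3 ^ e * (d * (3 * c * (c + 1) + 1)), by ring⟩
    rw [hjs] at hf2
    have hdz := Nat.eq_of_mul_eq_mul_left (by positivity) hf2
    have hcop' : Nat.Coprime d (3 * c * (c + 1) + 1) :=
      Nat.Coprime.coprime_dvd_left (hd' ▸ Dvd.intro_left _ rfl) hcop
    obtain ⟨v, hv⟩ := exists_eq_pow_of_mul_eq_pow (Nat.isUnit_iff.2 hcop') hdz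
    have hlt : t < 3 * t := by omega
    have hv3 : ¬ 3 ∣ v := fun hh => hd3 (hv ▸ dvd_pow hh hp.ne_zero)
    have heq : 2 ^ t + 1 = 3 ^ (j + 1) * v ^ p := by
      rw [← hv, hc, pow_succ]; linarith
    have hv1 := ih t hlt (j + 1) v (by omega) hv3 heq
    have hv2 : v = 1 := by
      rcases v with _ | v
      · simp at hv3
      · omega
    rw [hv2, one_pow, mul_one] at heq
    rcases two_pow_add_one_eq_three_pow heq with rfl | rfl
    · obtain rfl : c = 0 := by omega
      have : z ^ p = 1 := by rw [← hdz, hv, hv2]; simp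
      have := Nat.one_lt_pow hp.ne_zero hz1
      omega
    · obtain rfl : c = 2 := by omega
      have h19 : z ^ p = 19 := by rw [← hdz, hv, hv2]; simp
      have h2 : z ^ 2 ∣ 19 := h19 ▸ pow_dvd_pow z hp.two_le
      have hz4 : z < 5 := by
        have := Nat.le_of_dvd (by norm_num) h2
        nlinarith
      interval_cases z <;> revert h2 <;> decide
  · have hs1 : s = 1 := by
      by_contra hs1
      have h9 : 9 ∣ 2 ^ r + 1 := by
        rw [h]
        exact Dvd.dvd.mul_right (pow_dvd_pow 3 (show 2 ≤ s by omega)) _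
      obtain ⟨k, hk⟩ : ∃ k, r = 6 * k + 1 ∨ r = 6 * k + 5 := by
        obtain ⟨m, rfl⟩ := hr
        exact ⟨(2 * m + 1) / 6, by omega⟩
      rcases hk with rfl | rfl <;>
      · rw [pow_add, pow_mul] at h9
        have := Nat.mod_eq_zero_of_dvd h9
        rw [Nat.add_mod, Nat.mul_mod, Nat.pow_mod] at this
        norm_num at this
    subst hs1
    exact main r z hz1 h3 hr (by simpa using h)

theorem jacobiSym_congr {b : ℕ} {x z : ℤ} (hd : (b : ℤ) ∣ x - z) :
    jacobiSym x b = jacobiSym z b :=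
  jacobiSym.mod_left' (Int.ModEq.symm ((Int.modEq_iff_dvd).2 hd))

theorem jacobiSym_mul_congr {b : ℕ} {x a z c : ℤ} (hd : (b : ℤ) ∣ x * a - z * c) :
    jacobiSym x b * jacobiSym a b = jacobiSym z b * jacobiSym c b := by
  rw [← jacobiSym.mul_left, ← jacobiSym.mul_left, jacobiSym_congr hd]

theorem jacobiSym_neg_one {b : ℕ} :
    (b % 4 = 1 → jacobiSym (-1) b = 1) ∧ (b % 4 = 3 → jacobiSym (-1) b = -1) := by
  refine ⟨fun h => ?_, fun h => ?_⟩
  · rw [jacobiSym.at_neg_one (Nat.odd_iff.2 (by omega)), ZMod.χ₄_nat_one_mod_four h]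
  · rw [jacobiSym.at_neg_one (Nat.odd_iff.2 (by omega)), ZMod.χ₄_nat_three_mod_four h]

theorem jacobiSym_two {b : ℕ} :
    (b % 8 = 1 ∨ b % 8 = 7 → jacobiSym 2 b = 1) ∧
      (b % 8 = 3 ∨ b % 8 = 5 → jacobiSym 2 b = -1) := by
  refine ⟨fun h => ?_, fun h => ?_⟩ <;>
  · rw [jacobiSym.at_two (Nat.odd_iff.2 (by omega)), ZMod.χ₈_nat_eq_if_mod_eight]
    rcases h with h | h <;> simp [h] <;> omega

theorem jacobiSym_sq_eq_one {a : ℤ} {b : ℕ} (h : IsCoprime a b) :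
    jacobiSym (a ^ 2) b = 1 := by
  rw [jacobiSym.pow_left]
  exact jacobiSym.sq_one (Int.isCoprime_iff_gcd_eq_one.1 h)

theorem jacobiSym_two_pow {b q : ℕ} (hq : Odd q) (hb : Odd b) :
    jacobiSym (2 ^ q) b = jacobiSym 2 b := by
  obtain ⟨k, rfl⟩ := hq
  rw [jacobiSym.pow_left, pow_succ, pow_mul, jacobiSym.sq_one, one_pow, one_mul]
  exact_mod_cast hb.coprime_two_left

theorem pow_eq_self_mod_eight {y p : ℕ} (hy : Odd y) (hp : Odd p) : y ^ p % 8 = y % 8 := by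
  obtain ⟨k, rfl⟩ := hp
  have h : y ^ 2 % 8 = 1 := by
    have := Nat.odd_iff.1 hy
    have h8 : y % 8 < 8 := Nat.mod_lt _ (by norm_num)
    have h2 : y % 8 % 2 = 1 := by omega
    rw [Nat.pow_mod]
    interval_cases y % 8 <;> simp_all
  rw [pow_succ, pow_mul, Nat.mul_mod, Nat.pow_mod, h]
  simp

theorem five_le_of_eq {p q y : ℕ} (hp : p ≠ 0) (hq : Odd q) (hq3 : ¬ 3 ∣ q) (hy : 1 < y)
    (h : 2 ^ q + 1 = 3 * y ^ p) : 5 ≤ q := by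
  by_contra! hlt
  have hy1 := Nat.one_lt_pow hp hy
  obtain ⟨k, rfl⟩ := hq
  obtain rfl : k = 0 := by omega
  norm_num at h
  omega

theorem mod_eight_of_eq {p q y : ℕ} (hp : Odd p) (hq : 5 ≤ q)
    (h : 2 ^ q + 1 = 3 * y ^ p) : y % 8 = 3 := by
  have h8 : 8 ∣ 2 ^ q := pow_dvd_pow 2 (show 3 ≤ q by omega)
  have hy : Odd y := by
    by_contra hc
    rw [Nat.not_odd_iff_even] at hc
    have := (hc.pow_of_ne_zero hp.pos.ne').two_dvd
    omega
  rw [← pow_eq_self_mod_eight hy hp]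
  omega

theorem mod_thirtytwo_of_eq {p q y : ℕ} (hp : Odd p) (hq : 5 ≤ q)
    (h : 2 ^ q + 1 = 3 * y ^ p) :
    (p % 8 = 7 → y % 32 = 3) ∧ (p % 8 = 1 → y % 32 = 11) := by
  have h8 := mod_eight_of_eq hp hq h
  have h32 : 32 ∣ 2 ^ q := pow_dvd_pow 2 hq
  have h11 : y ^ p % 32 = 11 := by omega
  have hlt : y % 32 < 32 := Nat.mod_lt _ (by norm_num)
  have h83 : y % 32 % 8 = 3 := by omega
  have hpe := Nat.div_add_mod p 8
  refine ⟨fun h7 => ?_, fun h7 => ?_⟩ <;>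
  · rw [h7] at hpe
    rw [← hpe, pow_add, pow_mul, Nat.mul_mod, Nat.pow_mod (y ^ 8), Nat.pow_mod y,
      Nat.pow_mod y] at h11
    interval_cases y % 32 <;> simp_all

theorem three_mul_le_of_eq {p q y : ℕ} (hp : Odd p) (hq : Odd q) (hq3 : ¬ 3 ∣ q) (hy : 1 < y)
    (h : 2 ^ q + 1 = 3 * y ^ p) : 3 * p ≤ q := by
  have hq5 := five_le_of_eq hp.pos.ne' hq hq3 hy h
  have h8 := mod_eight_of_eq hp hq5 h
  have hy8 : 8 ≤ y := by
    by_contra! hlt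
    obtain rfl : y = 3 := by omega
    rw [← pow_succ'] at h
    rcases two_pow_add_one_eq_three_pow h with rfl | rfl <;> omega
  have h1 : 8 ^ p ≤ y ^ p := Nat.pow_le_pow_left hy8 p
  have h2 : 0 < 8 ^ p := by positivity
  have h3 : 2 ^ (3 * p) ≤ 2 ^ q := by
    rw [pow_mul]; norm_num; omega
  exact (Nat.pow_le_pow_iff_right (by norm_num)).1 h3

theorem eight_dvd_sum_neg_pow_sub {y : ℤ} (hy : y % 8 = 3) (n : ℕ) :
    8 ∣ ∑ i ∈ Finset.range n, (-y) ^ i - (2 * (n : ℤ) ^ 2 - n) := by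
  obtain ⟨t, rfl⟩ : ∃ t, y = 8 * t + 3 := ⟨y / 8, by omega⟩
  induction n with
  | zero => simp
  | succ n ih =>
    obtain ⟨c, hc⟩ := ih
    have hstep : ∑ i ∈ Finset.range (n + 1), (-(8 * t + 3)) ^ i
        = 1 - (8 * t + 3) * ∑ i ∈ Finset.range n, (-(8 * t + 3)) ^ i := by
      rw [Finset.sum_range_succ', Finset.mul_sum, pow_zero, add_comm, sub_eq_add_neg,
        ← Finset.sum_neg_distrib]
      exact congrArg (1 + ·) (Finset.sum_congr rfl fun i _ => by ring)
    rw [hstep]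
    generalize ∑ i ∈ Finset.range n, (-(8 * t + 3)) ^ i = S at hc
    refine ⟨-(t + 1) * S + 5 * c + (n : ℤ) ^ 2 - n, ?_⟩
    push_cast
    linear_combination 5 * hc

theorem mod_eight_ne_of_eq {p q y : ℕ} (hp : p % 8 = 3 ∨ p % 8 = 5) (hq : Odd q)
    (hq5 : 5 ≤ q) : 2 ^ q + 1 ≠ 3 * y ^ p := by
  intro h
  have hpo : Odd p := Nat.odd_iff.2 (by omega)
  have h8 := mod_eight_of_eq hpo hq5 h
  have hS := eight_dvd_sum_neg_pow_sub (y := y) (by omega) p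
  have hU : ((y : ℤ) + 1) * ∑ i ∈ Finset.range p, (-(y : ℤ)) ^ i = (y : ℤ) ^ p + 1 := by
    have := mul_neg_geom_sum (-(y : ℤ)) p
    rw [hpo.neg_pow] at this
    linarith
  have hU8 : (∑ i ∈ Finset.range p, (-(y : ℤ)) ^ i) % 8 = 7 ∨
      (∑ i ∈ Finset.range p, (-(y : ℤ)) ^ i) % 8 = 5 := by
    obtain ⟨c, hc⟩ := hS
    rw [sub_eq_iff_eq_add] at hc
    rw [hc]
    rcases hp with hp | hp
    · left
      obtain ⟨k, hk⟩ : ∃ k : ℤ, (p : ℤ) = 8 * k + 3 := ⟨p / 8, by omega⟩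
      rw [hk, show 8 * c + (2 * (8 * k + 3) ^ 2 - (8 * k + 3))
        = 8 * (c + 16 * k ^ 2 + 11 * k + 1) + 7 by ring]
      omega
    · right
      obtain ⟨k, hk⟩ : ∃ k : ℤ, (p : ℤ) = 8 * k + 5 := ⟨p / 8, by omega⟩
      rw [hk, show 8 * c + (2 * (8 * k + 5) ^ 2 - (8 * k + 5))
        = 8 * (c + 16 * k ^ 2 + 19 * k + 5) + 5 by ring]
      omega
  clear hS
  generalize (∑ i ∈ Finset.range p, (-(y : ℤ)) ^ i) = U at hU hU8
  have hpos : 0 ≤ U := by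
    have : (0 : ℤ) < (y : ℤ) ^ p + 1 := by positivity
    by_contra! hc
    nlinarith
  obtain ⟨u, rfl⟩ := Int.eq_ofNat_of_zero_le hpos
  obtain ⟨k, rfl⟩ : ∃ k, q = 2 * k + 3 := by
    obtain ⟨k, rfl⟩ := hq
    exact ⟨k - 1, by omega⟩
  have hodd : Odd u := Nat.odd_iff.2 (by omega)
  have hc2 : IsCoprime (2 : ℤ) u := by
    exact_mod_cast Nat.isCoprime_iff_coprime.2 hodd.coprime_two_left
  have hd : (u : ℤ) ∣ 2 ^ 2 * ((2 ^ (k + 1)) ^ 2 - (-1) * 2) := by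
    have hz : (2 : ℤ) ^ (2 * k + 3) + 1 = 3 * (y : ℤ) ^ p := by exact_mod_cast h
    refine ⟨2 * 3 * (y + 1), ?_⟩
    have : (2 : ℤ) ^ 2 * ((2 ^ (k + 1)) ^ 2 - (-1) * 2) = 2 * (2 ^ (2 * k + 3) + 4) := by ring
    rw [this]
    linear_combination 2 * hz - 6 * hU
  have hd' := (hc2.pow_left (m := 2)).symm.dvd_of_dvd_mul_left hd
  have hJ := jacobiSym_congr hd'
  rw [jacobiSym_sq_eq_one hc2.pow_left, jacobiSym.mul_left] at hJ
  rcases hU8 with h7 | h5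
  · rw [jacobiSym_neg_one.2 (by omega), jacobiSym_two.1 (by omega)] at hJ
    omega
  · rw [jacobiSym_neg_one.1 (by omega), jacobiSym_two.2 (by omega)] at hJ
    omega

theorem mod_eq_one_of_pow_mod_eq_one {l p y : ℕ} (hl : l.Prime) (hp0 : p ≠ 0) (hp : p.Coprime (l - 1))
    (h : y ^ p % l = 1) : y % l = 1 := by
  have : Fact l.Prime := ⟨hl⟩
  have hy : (y : ZMod l) ^ p = 1 := by
    rw [← Nat.cast_pow, ← Nat.cast_one, ZMod.natCast_eq_natCast_iff', h,
      Nat.mod_eq_of_lt hl.one_lt]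
  have hy0 : (y : ZMod l) ≠ 0 := by
    rintro h0
    rw [h0] at hy
    simp [hp0] at hy
  have := pow_gcd_eq_one.2 ⟨hy, ZMod.pow_card_sub_one_eq_one hy0⟩
  rw [hp.gcd_eq_one, pow_one, ← Nat.cast_one, ZMod.natCast_eq_natCast_iff',
    Nat.mod_eq_of_lt hl.one_lt] at this
  exact this

theorem mod_four_of_eq {p q y : ℕ} (hp : p % 8 = 7) (hq : Odd q) (hq5 : 5 ≤ q)
    (h : 2 ^ q + 1 = 3 * y ^ p) : q % 4 = 3 := by
  by_contra hq3
  have hq1 : q % 4 = 1 := by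
    have := Nat.odd_iff.1 hq
    omega
  have hpo : Odd p := Nat.odd_iff.2 (by omega)
  have h32 := (mod_thirtytwo_of_eq hpo hq5 h).1 hp
  have hz : (2 : ℤ) ^ q + 1 = 3 * (y : ℤ) ^ p := by exact_mod_cast h
  obtain ⟨t, rfl⟩ : ∃ t, y = 32 * t + 3 := ⟨y / 32, by omega⟩
  obtain ⟨g, hg⟩ : ∃ g, g = 512 * t ^ 2 + 96 * t + 5 := ⟨_, rfl⟩
  obtain ⟨u, hu⟩ : ∃ u, u = 48 * t + 5 := ⟨_, rfl⟩
  have hg8 : g % 8 = 5 := by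
    rw [hg, show 512 * t ^ 2 + 96 * t + 5 = 8 * (64 * t ^ 2 + 12 * t) + 5 by ring]
    omega
  have hgo : Odd g := Nat.odd_iff.2 (by omega)
  have huo : Odd u := Nat.odd_iff.2 (by omega)
  have hgy : 2 * (g : ℤ) = ((32 * t + 3 : ℕ) : ℤ) ^ 2 + 1 := by
    rw [hg]; push_cast; ring
  have hpd : (g : ℤ) ∣ ((32 * t + 3 : ℕ) : ℤ) ^ p + ((32 * t + 3 : ℕ) : ℤ) := by
    obtain ⟨k, rfl⟩ : ∃ k, p = 2 * (2 * k + 1) + 1 := ⟨p / 4, by omega⟩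
    have := Odd.add_dvd_pow_add_pow (((32 * t + 3 : ℕ) : ℤ) ^ 2) 1 (⟨k, rfl⟩ : Odd (2 * k + 1))
    rw [← hgy, one_pow, ← pow_mul] at this
    rw [pow_succ, ← add_one_mul]
    exact ((Dvd.intro_left _ rfl).trans this).mul_right _
  have hJ1 : jacobiSym 2 g = jacobiSym (-1 * 2 * u) g := by
    rw [← jacobiSym_two_pow hq hgo]
    apply jacobiSym_congr
    obtain ⟨c, hc⟩ := hpd
    refine ⟨3 * c, ?_⟩
    rw [hu]
    push_cast at hc hz ⊢
    linear_combination 3 * hc + hz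
  rw [jacobiSym.mul_left, jacobiSym.mul_left, jacobiSym_neg_one.1 (by omega),
    jacobiSym_two.2 (by omega), 
    jacobiSym.quadratic_reciprocity_one_mod_four' huo (by omega)] at hJ1
  have hJ2 := jacobiSym_mul_congr (b := u) (x := 3 ^ 2) (a := g) (z := 5) (c := 1)
    ⟨96 * t + 8, by rw [hu, hg]; push_cast; ring⟩
  have hc3 : IsCoprime (3 : ℤ) u := by
    rw [hu]
    exact ⟨-(32 * t + 3), 2, by push_cast; ring⟩
  rw [jacobiSym_sq_eq_one hc3, jacobiSym.one_left, one_mul, mul_one] at hJ2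
  have h5 : (jacobiSym 5 u : ℤ) = jacobiSym u 5 := by
    exact_mod_cast jacobiSym.quadratic_reciprocity_one_mod_four (a := 5) (by norm_num) huo
  have hy5 : (32 * t + 3) % 5 = 1 := by
    have hq' : 2 ^ q % 5 = 2 := by
      obtain ⟨k, rfl⟩ : ∃ k, q = 4 * k + 1 := ⟨q / 4, by omega⟩
      rw [pow_succ, pow_mul, Nat.mul_mod, Nat.pow_mod]; norm_num
    have hp' : (32 * t + 3) ^ p % 5 = 1 := by omega
    refine mod_eq_one_of_pow_mod_eq_one (by norm_num) hpo.pos.ne' ?_ hp'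
    exact Nat.Coprime.pow_right 2 (Nat.coprime_two_right.2 hpo)
  have hu5 : jacobiSym u 5 = -1 := by
    rw [jacobiSym_congr (z := 2) (by omega)]; norm_num
  rw [hJ2, h5, hu5] at hJ1
  omega

theorem mod_three_of_eq {p q y : ℕ} (hp : p % 24 = 17) (hq : Odd q) (hq3 : ¬ 3 ∣ q) (hq5 : 5 ≤ q)
    (h : 2 ^ q + 1 = 3 * y ^ p) : q % 3 = 2 := by
  by_contra hq2
  have hpo : Odd p := Nat.odd_iff.2 (by omega)
  have h32 := (mod_thirtytwo_of_eq hpo hq5 h).2 (by omega)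
  have hz : (2 : ℤ) ^ q + 1 = 3 * (y : ℤ) ^ p := by exact_mod_cast h
  obtain ⟨t, rfl⟩ : ∃ t, y = 32 * t + 11 := ⟨y / 32, by omega⟩
  obtain ⟨g, hg⟩ : ∃ g, g = 1024 * t ^ 2 + 672 * t + 111 := ⟨_, rfl⟩
  obtain ⟨v, hv⟩ : ∃ v, v = 96 * t + 31 := ⟨_, rfl⟩
  have hg8 : g % 8 = 7 := by
    rw [hg, show 1024 * t ^ 2 + 672 * t + 111 = 8 * (128 * t ^ 2 + 84 * t + 13) + 7 by ring]
    omega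
  have hgo : Odd g := Nat.odd_iff.2 (by omega)
  have hvo : Odd v := Nat.odd_iff.2 (by omega)
  have hgy : (g : ℤ) = ((32 * t + 11 : ℕ) : ℤ) ^ 2 - ((32 * t + 11 : ℕ) : ℤ) + 1 := by
    rw [hg]; push_cast; ring
  have hpd : (g : ℤ) ∣ ((32 * t + 11 : ℕ) : ℤ) ^ p - (1 - ((32 * t + 11 : ℕ) : ℤ)) := by
    obtain ⟨k, rfl⟩ : ∃ k, p = 3 * (2 * k + 1) + 2 := ⟨p / 6, by omega⟩
    have := Odd.add_dvd_pow_add_pow (((32 * t + 11 : ℕ) : ℤ) ^ 3) 1 (⟨k, rfl⟩ : Odd (2 * k + 1))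
    rw [one_pow, ← pow_mul] at this
    have h3 : (g : ℤ) ∣ ((32 * t + 11 : ℕ) : ℤ) ^ 3 + 1 :=
      ⟨((32 * t + 11 : ℕ) : ℤ) + 1, by rw [hgy]; ring⟩
    obtain ⟨c, hc⟩ := h3.trans this
    refine ⟨c * ((32 * t + 11 : ℕ) : ℤ) ^ 2 - 1, ?_⟩
    rw [pow_add]
    linear_combination ((32 * t + 11 : ℕ) : ℤ) ^ 2 * hc + hgy
  have hJ1 : jacobiSym 2 g = jacobiSym (-1 * v) g := by
    rw [← jacobiSym_two_pow hq hgo]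
    apply jacobiSym_congr
    obtain ⟨c, hc⟩ := hpd
    refine ⟨3 * c, ?_⟩
    rw [hv]
    push_cast at hc hz ⊢
    linear_combination 3 * hc + hz
  rw [jacobiSym.mul_left, jacobiSym_neg_one.2 (by omega), jacobiSym_two.1 (by omega),
    jacobiSym.quadratic_reciprocity_three_mod_four (by omega) (by omega)] at hJ1
  have hJ2 := jacobiSym_mul_congr (b := v) (x := 3 ^ 2) (a := g) (z := 7) (c := 1)
    ⟨96 * t + 32, by rw [hv, hg]; push_cast; ring⟩
  have hc3 : IsCoprime (3 : ℤ) v := by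
    rw [hv]
    exact ⟨-(32 * t + 10), 1, by push_cast; ring⟩
  have h7 : (jacobiSym 7 v : ℤ) = -jacobiSym v 7 := by
    exact_mod_cast jacobiSym.quadratic_reciprocity_three_mod_four (a := 7) (by norm_num) (by omega)
  have hy7 : (32 * t + 11) % 7 = 1 := by
    have hq' : 2 ^ q % 7 = 2 := by
      obtain ⟨k, rfl⟩ : ∃ k, q = 3 * k + 1 := ⟨q / 3, by omega⟩
      rw [pow_succ, pow_mul, Nat.mul_mod, Nat.pow_mod]; norm_num
    have hp' : (32 * t + 11) ^ p % 7 = 1 := by omega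
    refine mod_eq_one_of_pow_mod_eq_one (by norm_num) hpo.pos.ne' ?_ hp'
    exact Nat.Coprime.mul_right (Nat.coprime_two_right.2 hpo)
      ((Nat.prime_three.coprime_iff_not_dvd.2 (by omega)).symm)
  have hv7 : jacobiSym v 7 = 1 := by
    rw [jacobiSym_congr (z := 1) (by omega)]; norm_num
  rw [jacobiSym_sq_eq_one hc3, jacobiSym.one_left, one_mul, mul_one, h7, hv7] at hJ2
  rw [hJ2] at hJ1
  omega

theorem mod_eq_mod_of_dvd {a n d r : ℕ} (h : a % n = r) (hd : d ∣ n) : a % d = r % d := by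
  rw [← h, Nat.mod_mod_of_dvd _ hd]

theorem jacobiSym_three {b : ℕ} :
    (b % 12 = 1 ∨ b % 12 = 11 → jacobiSym 3 b = 1) ∧
      (b % 12 = 5 ∨ b % 12 = 7 → jacobiSym 3 b = -1) := by
  have h1 : jacobiSym 1 3 = 1 := by norm_num
  have h2 : jacobiSym 2 3 = -1 := by norm_num
  have r1 (h : b % 4 = 1) : jacobiSym 3 b = jacobiSym b 3 := by
    exact_mod_cast jacobiSym.quadratic_reciprocity_one_mod_four' (a := 3) (by decide) h
  have r2 (h : b % 4 = 3) : jacobiSym 3 b = -jacobiSym b 3 := by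
    exact_mod_cast jacobiSym.quadratic_reciprocity_three_mod_four (a := 3) (by norm_num) h
  have b1 (h : b % 3 = 1) : jacobiSym b 3 = 1 := by
    rw [jacobiSym_congr (z := 1) (by omega), h1]
  have b2 (h : b % 3 = 2) : jacobiSym b 3 = -1 := by
    rw [jacobiSym_congr (z := 2) (by omega), h2]
  refine ⟨?_, ?_⟩ <;> rintro (h | h)
  · rw [r1 (by omega), b1 (by omega)]
  · rw [r2 (by omega), b2 (by omega)]; rfl
  · rw [r1 (by omega), b2 (by omega)]
  · rw [r2 (by omega), b1 (by omega)]

theorem false_of_jacobiSym_five_two {y g0 g1 : ℕ} (hy : y % 96 = 43) (hN : y % 61 = 1)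
    (e0 : 4 * g0 = y ^ 5 + 1) (e1 : 4 * g1 = 3 * y ^ 2 + 1)
    (hJ : jacobiSym 2 g0 = jacobiSym (-1) g0 * jacobiSym g1 g0) : False := by
  obtain ⟨c, hc⟩ : ∃ c, y = 61 * c + 1 := ⟨y / 61, by omega⟩
  have r2 : y ^ 2 % 96 = 25 := by norm_num [Nat.pow_mod, hy]
  have r5 : y ^ 5 % 96 = 91 := by norm_num [Nat.pow_mod, hy]
  obtain ⟨g2, e2⟩ : ∃ g2, 4 * g2 = y + 9 :=
    ⟨(y + 9) / 4, by omega⟩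
  have m0 : g0 % 24 = 23 := by clear * - e0 r5; omega
  have m1 : g1 % 24 = 19 := by clear * - e1 r2; omega
  have m2 : g2 % 24 = 13 := by clear * - e2 hy; omega
  have z0 : 4 * (g0 : ℤ) = (y : ℤ) ^ 5 + 1 := by exact_mod_cast e0
  have z1 : 4 * (g1 : ℤ) = 3 * (y : ℤ) ^ 2 + 1 := by exact_mod_cast e1
  have z2 : 4 * (g2 : ℤ) = (y : ℤ) + 9 := by exact_mod_cast e2
  rw [jacobiSym_two.1 (Or.inr (mod_eq_mod_of_dvd m0 (by norm_num))), jacobiSym_neg_one.2 (mod_eq_mod_of_dvd m0 (by norm_num))] at hJ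
  have f1 := jacobiSym.quadratic_reciprocity_three_mod_four (a := g1) (b := g0)
    (mod_eq_mod_of_dvd m1 (by norm_num)) (mod_eq_mod_of_dvd m0 (by norm_num))
  have s1 := jacobiSym_mul_congr (b := g1) (x := 3 ^ 2 * 2 ^ 2) (a := g0)
    (z := 1 * 3 ^ 0 * 2 ^ 2) (c := g2) ⟨4 * (3 * (y : ℤ) ^ 3 - 1 * (y : ℤ)), by
      push_cast
      linear_combination 9 * z0 - (3 * (y : ℤ) ^ 3 - 1 * (y : ℤ)) * z1 - (1) * z2⟩
  simp only [jacobiSym.mul_left, jacobiSym.pow_left, jacobiSym.one_left] at s1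
  rw [jacobiSym_three.2 (Or.inr (mod_eq_mod_of_dvd m1 (by norm_num))), jacobiSym_two.2 (Or.inl (mod_eq_mod_of_dvd m1 (by norm_num)))] at s1
  norm_num at s1
  have f2 := jacobiSym.quadratic_reciprocity_one_mod_four (a := g2) (b := g1)
    (mod_eq_mod_of_dvd m2 (by norm_num)) (Nat.odd_iff.2 (mod_eq_mod_of_dvd m1 (by norm_num)))
  have s2 := jacobiSym_mul_congr (b := g2) (x := 3 ^ 0 * 2 ^ 2) (a := g1)
    (z := 1 * 3 ^ 0 * 2 ^ 2) (c := (61 : ℕ)) ⟨4 * (3 * (y : ℤ) - 27), by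
      push_cast
      linear_combination 1 * z1 - (3 * (y : ℤ) - 27) * z2⟩
  simp only [jacobiSym.mul_left, jacobiSym.pow_left, jacobiSym.one_left] at s2
  rw [jacobiSym_two.2 (Or.inr (mod_eq_mod_of_dvd m2 (by norm_num)))] at s2
  norm_num at s2
  have f3 := jacobiSym.quadratic_reciprocity_one_mod_four (a := 61) (b := g2) (by norm_num)
    (Nat.odd_iff.2 (mod_eq_mod_of_dvd m2 (by norm_num)))
  have s3 := jacobiSym_mul_congr (b := 61) (x := 4) (a := g2) (z := 10) (c := 1)
    ⟨1 * c, by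
      have hcz : (y : ℤ) = 61 * c + 1 := by exact_mod_cast hc
      push_cast
      linear_combination z2 + 1 * hcz⟩
  rw [show jacobiSym 4 61 = 1 by norm_num, show jacobiSym (10) 61 = -1 by norm_num,
    jacobiSym.one_left] at s3
  push_cast at f1 f2 f3
  clear * - hJ f1 s1 f2 s2 f3 s3
  omega

theorem false_of_jacobiSym_five_three {y g0 g1 : ℕ} (hy : y % 96 = 43) (hN : y % 61 = 1)
    (e0 : 4 * g0 = y ^ 5 + 1) (e1 : 4 * g1 = y ^ 2 + 3)
    (hJ : jacobiSym 2 g0 = jacobiSym (-1) g0 * jacobiSym g1 g0) : False := by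
  obtain ⟨c, hc⟩ : ∃ c, y = 61 * c + 1 := ⟨y / 61, by omega⟩
  have r2 : y ^ 2 % 96 = 25 := by norm_num [Nat.pow_mod, hy]
  have r5 : y ^ 5 % 96 = 91 := by norm_num [Nat.pow_mod, hy]
  obtain ⟨g2, e2⟩ : ∃ g2, 4 * g2 = 9 * y + 1 :=
    ⟨(9 * y + 1) / 4, by omega⟩
  have m0 : g0 % 24 = 23 := by clear * - e0 r5; omega
  have m1 : g1 % 24 = 7 := by clear * - e1 r2; omega
  have m2 : g2 % 24 = 1 := by clear * - e2 hy; omega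
  have z0 : 4 * (g0 : ℤ) = (y : ℤ) ^ 5 + 1 := by exact_mod_cast e0
  have z1 : 4 * (g1 : ℤ) = (y : ℤ) ^ 2 + 3 := by exact_mod_cast e1
  have z2 : 4 * (g2 : ℤ) = 9 * (y : ℤ) + 1 := by exact_mod_cast e2
  rw [jacobiSym_two.1 (Or.inr (mod_eq_mod_of_dvd m0 (by norm_num))), jacobiSym_neg_one.2 (mod_eq_mod_of_dvd m0 (by norm_num))] at hJ
  have f1 := jacobiSym.quadratic_reciprocity_three_mod_four (a := g1) (b := g0)
    (mod_eq_mod_of_dvd m1 (by norm_num)) (mod_eq_mod_of_dvd m0 (by norm_num))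
  have s1 := jacobiSym_mul_congr (b := g1) (x := 3 ^ 0 * 2 ^ 2) (a := g0)
    (z := 1 * 3 ^ 0 * 2 ^ 2) (c := g2) ⟨4 * (1 * (y : ℤ) ^ 3 - 3 * (y : ℤ)), by
      push_cast
      linear_combination 1 * z0 - (1 * (y : ℤ) ^ 3 - 3 * (y : ℤ)) * z1 - (1) * z2⟩
  simp only [jacobiSym.mul_left, jacobiSym.pow_left, jacobiSym.one_left] at s1
  rw [jacobiSym_two.1 (Or.inr (mod_eq_mod_of_dvd m1 (by norm_num)))] at s1
  norm_num at s1
  have f2 := jacobiSym.quadratic_reciprocity_one_mod_four (a := g2) (b := g1)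
    (mod_eq_mod_of_dvd m2 (by norm_num)) (Nat.odd_iff.2 (mod_eq_mod_of_dvd m1 (by norm_num)))
  have s2 := jacobiSym_mul_congr (b := g2) (x := 3 ^ 4 * 2 ^ 2) (a := g1)
    (z := 1 * 3 ^ 0 * 2 ^ 2) (c := (61 : ℕ)) ⟨4 * (9 * (y : ℤ) - 1), by
      push_cast
      linear_combination 81 * z1 - (9 * (y : ℤ) - 1) * z2⟩
  simp only [jacobiSym.mul_left, jacobiSym.pow_left, jacobiSym.one_left] at s2
  rw [jacobiSym_three.1 (Or.inl (mod_eq_mod_of_dvd m2 (by norm_num))), jacobiSym_two.1 (Or.inl (mod_eq_mod_of_dvd m2 (by norm_num)))] at s2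
  norm_num at s2
  have f3 := jacobiSym.quadratic_reciprocity_one_mod_four (a := 61) (b := g2) (by norm_num)
    (Nat.odd_iff.2 (mod_eq_mod_of_dvd m2 (by norm_num)))
  have s3 := jacobiSym_mul_congr (b := 61) (x := 4) (a := g2) (z := 10) (c := 1)
    ⟨9 * c, by
      have hcz : (y : ℤ) = 61 * c + 1 := by exact_mod_cast hc
      push_cast
      linear_combination z2 + 9 * hcz⟩
  rw [show jacobiSym 4 61 = 1 by norm_num, show jacobiSym (10) 61 = -1 by norm_num,
    jacobiSym.one_left] at s3
  push_cast at f1 f2 f3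
  clear * - hJ f1 s1 f2 s2 f3 s3
  omega

theorem false_of_jacobiSym_seven_three {y g0 g1 : ℕ} (hy : y % 96 = 43) (hN : y % 547 = 1)
    (e0 : 4 * g0 = y ^ 7 + 1) (e1 : 4 * g1 = y ^ 4 + 3)
    (hJ : jacobiSym 2 g0 = jacobiSym (-1) g0 * jacobiSym g1 g0) : False := by
  obtain ⟨c, hc⟩ : ∃ c, y = 547 * c + 1 := ⟨y / 547, by omega⟩
  have r3 : y ^ 3 % 96 = 19 := by norm_num [Nat.pow_mod, hy]
  have r4 : y ^ 4 % 96 = 49 := by norm_num [Nat.pow_mod, hy]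
  have r7 : y ^ 7 % 96 = 67 := by norm_num [Nat.pow_mod, hy]
  have l3 : y ≤ y ^ 3 := Nat.le_self_pow (by norm_num) y
  obtain ⟨g2, e2⟩ : ∃ g2, 8 * g2 + 1 = 3 * y ^ 3 :=
    ⟨(3 * y ^ 3 - 1) / 8, by omega⟩
  obtain ⟨g3, e3⟩ : ∃ g3, 4 * g3 = y + 9 :=
    ⟨(y + 9) / 4, by omega⟩
  have m0 : g0 % 24 = 17 := by clear * - e0 r7; omega
  have m1 : g1 % 24 = 13 := by clear * - e1 r4; omega
  have m2 : g2 % 12 = 7 := by clear * - e2 r3; omega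
  have m3 : g3 % 24 = 13 := by clear * - e3 hy; omega
  have z0 : 4 * (g0 : ℤ) = (y : ℤ) ^ 7 + 1 := by exact_mod_cast e0
  have z1 : 4 * (g1 : ℤ) = (y : ℤ) ^ 4 + 3 := by exact_mod_cast e1
  have z2 : 8 * (g2 : ℤ) = 3 * (y : ℤ) ^ 3 - 1 := eq_sub_of_add_eq (by exact_mod_cast e2)
  have z3 : 4 * (g3 : ℤ) = (y : ℤ) + 9 := by exact_mod_cast e3
  rw [jacobiSym_two.1 (Or.inl (mod_eq_mod_of_dvd m0 (by norm_num))), jacobiSym_neg_one.1 (mod_eq_mod_of_dvd m0 (by norm_num))] at hJ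
  have f1 := jacobiSym.quadratic_reciprocity_one_mod_four (a := g1) (b := g0)
    (mod_eq_mod_of_dvd m1 (by norm_num)) (Nat.odd_iff.2 (mod_eq_mod_of_dvd m0 (by norm_num)))
  have s1 := jacobiSym_mul_congr (b := g1) (x := 3 ^ 0 * 2 ^ 2) (a := g0)
    (z := -1 * 3 ^ 0 * 2 ^ 3) (c := g2) ⟨4 * (1 * (y : ℤ) ^ 3), by
      push_cast
      linear_combination 1 * z0 - (1 * (y : ℤ) ^ 3) * z1 - (-1) * z2⟩
  simp only [jacobiSym.mul_left, jacobiSym.pow_left] at s1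
  rw [jacobiSym_two.2 (Or.inr (mod_eq_mod_of_dvd m1 (by norm_num))), jacobiSym_neg_one.1 (mod_eq_mod_of_dvd m1 (by norm_num))] at s1
  norm_num at s1
  have f2 := jacobiSym.quadratic_reciprocity_one_mod_four' (a := g2) (b := g1)
    (Nat.odd_iff.2 (mod_eq_mod_of_dvd m2 (by norm_num))) (mod_eq_mod_of_dvd m1 (by norm_num))
  have s2 := jacobiSym_mul_congr (b := g2) (x := 3 ^ 1 * 2 ^ 2) (a := g1)
    (z := 1 * 3 ^ 0 * 2 ^ 2) (c := g3) ⟨8 * (1 * (y : ℤ)), by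
      push_cast
      linear_combination 3 * z1 - (1 * (y : ℤ)) * z2 - (1) * z3⟩
  have t2 : jacobiSym 2 g2 ^ 2 = 1 := jacobiSym.sq_one (by
    exact_mod_cast (Nat.coprime_two_left.2 (Nat.odd_iff.2 (mod_eq_mod_of_dvd m2 (by norm_num)))))
  simp only [jacobiSym.mul_left, jacobiSym.pow_left, jacobiSym.one_left] at s2
  rw [jacobiSym_three.2 (Or.inr (mod_eq_mod_of_dvd m2 (by norm_num))), t2] at s2
  norm_num at s2
  have f3 := jacobiSym.quadratic_reciprocity_one_mod_four (a := g3) (b := g2)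
    (mod_eq_mod_of_dvd m3 (by norm_num)) (Nat.odd_iff.2 (mod_eq_mod_of_dvd m2 (by norm_num)))
  have s3 := jacobiSym_mul_congr (b := g3) (x := 3 ^ 0 * 2 ^ 3) (a := g2)
    (z := -1 * 3 ^ 0 * 2 ^ 2) (c := (547 : ℕ)) ⟨4 * (3 * (y : ℤ) ^ 2 - 27 * (y : ℤ) + 243), by
      push_cast
      linear_combination 1 * z2 - (3 * (y : ℤ) ^ 2 - 27 * (y : ℤ) + 243) * z3⟩
  simp only [jacobiSym.mul_left, jacobiSym.pow_left] at s3
  rw [jacobiSym_two.2 (Or.inr (mod_eq_mod_of_dvd m3 (by norm_num))), jacobiSym_neg_one.1 (mod_eq_mod_of_dvd m3 (by norm_num))] at s3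
  norm_num at s3
  have f4 := jacobiSym.quadratic_reciprocity_one_mod_four' (a := 547) (b := g3)
    (by decide) (mod_eq_mod_of_dvd m3 (by norm_num))
  have s4 := jacobiSym_mul_congr (b := 547) (x := 4) (a := g3) (z := 10) (c := 1)
    ⟨1 * c, by
      have hcz : (y : ℤ) = 547 * c + 1 := by exact_mod_cast hc
      push_cast
      linear_combination z3 + 1 * hcz⟩
  rw [show jacobiSym 4 547 = 1 by norm_num, show jacobiSym (10) 547 = 1 by norm_num,
    jacobiSym.one_left] at s4
  push_cast at f1 f2 f3 f4
  clear * - hJ f1 s1 f2 s2 f3 s3 f4 s4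
  omega

theorem false_of_jacobiSym_seven_five {y g0 g1 : ℕ} (hy : y % 96 = 43) (hN : y % 547 = 1)
    (e0 : 4 * g0 = y ^ 7 + 1) (e1 : 4 * g1 = y ^ 2 + 3)
    (hJ : jacobiSym 2 g0 = jacobiSym (-1) g0 * jacobiSym g1 g0) : False := by
  obtain ⟨c, hc⟩ : ∃ c, y = 547 * c + 1 := ⟨y / 547, by omega⟩
  have r2 : y ^ 2 % 96 = 25 := by norm_num [Nat.pow_mod, hy]
  have r7 : y ^ 7 % 96 = 67 := by norm_num [Nat.pow_mod, hy]
  obtain ⟨g2, e2⟩ : ∃ g2, 8 * g2 + 1 = 27 * y :=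
    ⟨(27 * y - 1) / 8, by omega⟩
  have m0 : g0 % 24 = 17 := by clear * - e0 r7; omega
  have m1 : g1 % 24 = 7 := by clear * - e1 r2; omega
  have m2 : g2 % 12 = 1 := by clear * - e2 hy; omega
  have z0 : 4 * (g0 : ℤ) = (y : ℤ) ^ 7 + 1 := by exact_mod_cast e0
  have z1 : 4 * (g1 : ℤ) = (y : ℤ) ^ 2 + 3 := by exact_mod_cast e1
  have z2 : 8 * (g2 : ℤ) = 27 * (y : ℤ) - 1 := eq_sub_of_add_eq (by exact_mod_cast e2)
  rw [jacobiSym_two.1 (Or.inl (mod_eq_mod_of_dvd m0 (by norm_num))), jacobiSym_neg_one.1 (mod_eq_mod_of_dvd m0 (by norm_num))] at hJ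
  have f1 := jacobiSym.quadratic_reciprocity_one_mod_four' (a := g1) (b := g0)
    (Nat.odd_iff.2 (mod_eq_mod_of_dvd m1 (by norm_num))) (mod_eq_mod_of_dvd m0 (by norm_num))
  have s1 := jacobiSym_mul_congr (b := g1) (x := 3 ^ 0 * 2 ^ 2) (a := g0)
    (z := -1 * 3 ^ 0 * 2 ^ 3) (c := g2) ⟨4 * (1 * (y : ℤ) ^ 5 - 3 * (y : ℤ) ^ 3 + 9 * (y : ℤ)), by
      push_cast
      linear_combination 1 * z0 - (1 * (y : ℤ) ^ 5 - 3 * (y : ℤ) ^ 3 + 9 * (y : ℤ)) * z1 - (-1) * z2⟩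
  simp only [jacobiSym.mul_left, jacobiSym.pow_left] at s1
  rw [jacobiSym_two.1 (Or.inr (mod_eq_mod_of_dvd m1 (by norm_num))), jacobiSym_neg_one.2 (mod_eq_mod_of_dvd m1 (by norm_num))] at s1
  norm_num at s1
  have f2 := jacobiSym.quadratic_reciprocity_one_mod_four (a := g2) (b := g1)
    (mod_eq_mod_of_dvd m2 (by norm_num)) (Nat.odd_iff.2 (mod_eq_mod_of_dvd m1 (by norm_num)))
  have s2 := jacobiSym_mul_congr (b := g2) (x := 3 ^ 6 * 2 ^ 2) (a := g1)
    (z := 1 * 3 ^ 0 * 2 ^ 2) (c := (547 : ℕ)) ⟨8 * (27 * (y : ℤ) + 1), by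
      push_cast
      linear_combination 729 * z1 - (27 * (y : ℤ) + 1) * z2⟩
  have t2 : jacobiSym 2 g2 ^ 2 = 1 := jacobiSym.sq_one (by
    exact_mod_cast (Nat.coprime_two_left.2 (Nat.odd_iff.2 (mod_eq_mod_of_dvd m2 (by norm_num)))))
  simp only [jacobiSym.mul_left, jacobiSym.pow_left, jacobiSym.one_left] at s2
  rw [jacobiSym_three.1 (Or.inl (mod_eq_mod_of_dvd m2 (by norm_num))), t2] at s2
  norm_num at s2
  have f3 := jacobiSym.quadratic_reciprocity_one_mod_four' (a := 547) (b := g2)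
    (by decide) (mod_eq_mod_of_dvd m2 (by norm_num))
  have s3 := jacobiSym_mul_congr (b := 547) (x := 8) (a := g2) (z := 26) (c := 1)
    ⟨27 * c, by
      have hcz : (y : ℤ) = 547 * c + 1 := by exact_mod_cast hc
      push_cast
      linear_combination z2 + 27 * hcz⟩
  rw [show jacobiSym 8 547 = -1 by norm_num, show jacobiSym (26) 547 = -1 by norm_num,
    jacobiSym.one_left] at s3
  push_cast at f1 f2 f3
  clear * - hJ f1 s1 f2 s2 f3 s3
  omega

theorem false_of_jacobiSym_seven_six {y g0 g1 : ℕ} (hy : y % 96 = 43) (hN : y % 547 = 1)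
    (e0 : 4 * g0 = y ^ 7 + 1) (e1 : 4 * g1 = 3 * y ^ 6 + 1)
    (hJ : jacobiSym 2 g0 = jacobiSym (-1) g0 * jacobiSym g1 g0) : False := by
  obtain ⟨c, hc⟩ : ∃ c, y = 547 * c + 1 := ⟨y / 547, by omega⟩
  have r6 : y ^ 6 % 96 = 73 := by norm_num [Nat.pow_mod, hy]
  have r7 : y ^ 7 % 96 = 67 := by norm_num [Nat.pow_mod, hy]
  obtain ⟨g2, e2⟩ : ∃ g2, 8 * g2 + 3 = y :=
    ⟨(y - 3) / 8, by omega⟩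
  have m0 : g0 % 24 = 17 := by clear * - e0 r7; omega
  have m1 : g1 % 24 = 7 := by clear * - e1 r6; omega
  have m2 : g2 % 12 = 5 := by clear * - e2 hy; omega
  have z0 : 4 * (g0 : ℤ) = (y : ℤ) ^ 7 + 1 := by exact_mod_cast e0
  have z1 : 4 * (g1 : ℤ) = 3 * (y : ℤ) ^ 6 + 1 := by exact_mod_cast e1
  have z2 : 8 * (g2 : ℤ) = (y : ℤ) - 3 := eq_sub_of_add_eq (by exact_mod_cast e2)
  rw [jacobiSym_two.1 (Or.inl (mod_eq_mod_of_dvd m0 (by norm_num))), jacobiSym_neg_one.1 (mod_eq_mod_of_dvd m0 (by norm_num))] at hJ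
  have f1 := jacobiSym.quadratic_reciprocity_one_mod_four' (a := g1) (b := g0)
    (Nat.odd_iff.2 (mod_eq_mod_of_dvd m1 (by norm_num))) (mod_eq_mod_of_dvd m0 (by norm_num))
  have s1 := jacobiSym_mul_congr (b := g1) (x := 3 ^ 1 * 2 ^ 2) (a := g0)
    (z := -1 * 3 ^ 0 * 2 ^ 3) (c := g2) ⟨4 * (1 * (y : ℤ)), by
      push_cast
      linear_combination 3 * z0 - (1 * (y : ℤ)) * z1 - (-1) * z2⟩
  simp only [jacobiSym.mul_left, jacobiSym.pow_left] at s1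
  rw [jacobiSym_three.2 (Or.inr (mod_eq_mod_of_dvd m1 (by norm_num))), jacobiSym_two.1 (Or.inr (mod_eq_mod_of_dvd m1 (by norm_num))), jacobiSym_neg_one.2 (mod_eq_mod_of_dvd m1 (by norm_num))] at s1
  norm_num at s1
  have f2 := jacobiSym.quadratic_reciprocity_one_mod_four (a := g2) (b := g1)
    (mod_eq_mod_of_dvd m2 (by norm_num)) (Nat.odd_iff.2 (mod_eq_mod_of_dvd m1 (by norm_num)))
  have s2 := jacobiSym_mul_congr (b := g2) (x := 3 ^ 0 * 2 ^ 2) (a := g1)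
    (z := 1 * 3 ^ 0 * 2 ^ 2) (c := (547 : ℕ)) ⟨8 * (3 * (y : ℤ) ^ 5 + 9 * (y : ℤ) ^ 4 + 27 * (y : ℤ) ^ 3 + 81 * (y : ℤ) ^ 2 + 243 * (y : ℤ) + 729), by
      push_cast
      linear_combination 1 * z1 - (3 * (y : ℤ) ^ 5 + 9 * (y : ℤ) ^ 4 + 27 * (y : ℤ) ^ 3 + 81 * (y : ℤ) ^ 2 + 243 * (y : ℤ) + 729) * z2⟩
  have t2 : jacobiSym 2 g2 ^ 2 = 1 := jacobiSym.sq_one (by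
    exact_mod_cast (Nat.coprime_two_left.2 (Nat.odd_iff.2 (mod_eq_mod_of_dvd m2 (by norm_num)))))
  simp only [jacobiSym.mul_left, jacobiSym.pow_left, jacobiSym.one_left] at s2
  rw [t2] at s2
  norm_num at s2
  have f3 := jacobiSym.quadratic_reciprocity_one_mod_four' (a := 547) (b := g2)
    (by decide) (mod_eq_mod_of_dvd m2 (by norm_num))
  have s3 := jacobiSym_mul_congr (b := 547) (x := 8) (a := g2) (z := -2) (c := 1)
    ⟨1 * c, by
      have hcz : (y : ℤ) = 547 * c + 1 := by exact_mod_cast hc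
      push_cast
      linear_combination z2 + 1 * hcz⟩
  rw [show jacobiSym 8 547 = -1 by norm_num, show jacobiSym (-2) 547 = 1 by norm_num,
    jacobiSym.one_left] at s3
  push_cast at f1 f2 f3
  clear * - hJ f1 s1 f2 s2 f3 s3
  omega

theorem false_of_jacobiSym_eleven_two {y g0 g1 : ℕ} (hy : y % 96 = 43) (hN : y % 44287 = 1)
    (e0 : 4 * g0 = y ^ 11 + 1) (e1 : 4 * g1 = 3 * y ^ 2 + 1)
    (hJ : jacobiSym 2 g0 = jacobiSym (-1) g0 * jacobiSym g1 g0) : False := by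
  obtain ⟨c, hc⟩ : ∃ c, y = 44287 * c + 1 := ⟨y / 44287, by omega⟩
  have r2 : y ^ 2 % 96 = 25 := by norm_num [Nat.pow_mod, hy]
  have r11 : y ^ 11 % 96 = 19 := by norm_num [Nat.pow_mod, hy]
  obtain ⟨g2, e2⟩ : ∃ g2, 8 * g2 + 243 = y :=
    ⟨(y - 243) / 8, by omega⟩
  have m0 : g0 % 24 = 5 := by clear * - e0 r11; omega
  have m1 : g1 % 24 = 19 := by clear * - e1 r2; omega
  have m2 : g2 % 12 = 11 := by clear * - e2 hy; omega
  have z0 : 4 * (g0 : ℤ) = (y : ℤ) ^ 11 + 1 := by exact_mod_cast e0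
  have z1 : 4 * (g1 : ℤ) = 3 * (y : ℤ) ^ 2 + 1 := by exact_mod_cast e1
  have z2 : 8 * (g2 : ℤ) = (y : ℤ) - 243 := eq_sub_of_add_eq (by exact_mod_cast e2)
  rw [jacobiSym_two.2 (Or.inr (mod_eq_mod_of_dvd m0 (by norm_num))), jacobiSym_neg_one.1 (mod_eq_mod_of_dvd m0 (by norm_num))] at hJ
  have f1 := jacobiSym.quadratic_reciprocity_one_mod_four' (a := g1) (b := g0)
    (Nat.odd_iff.2 (mod_eq_mod_of_dvd m1 (by norm_num))) (mod_eq_mod_of_dvd m0 (by norm_num))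
  have s1 := jacobiSym_mul_congr (b := g1) (x := 3 ^ 5 * 2 ^ 2) (a := g0)
    (z := -1 * 3 ^ 0 * 2 ^ 3) (c := g2) ⟨4 * (81 * (y : ℤ) ^ 9 - 27 * (y : ℤ) ^ 7 + 9 * (y : ℤ) ^ 5 - 3 * (y : ℤ) ^ 3 + 1 * (y : ℤ)), by
      push_cast
      linear_combination 243 * z0 - (81 * (y : ℤ) ^ 9 - 27 * (y : ℤ) ^ 7 + 9 * (y : ℤ) ^ 5 - 3 * (y : ℤ) ^ 3 + 1 * (y : ℤ)) * z1 - (-1) * z2⟩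
  simp only [jacobiSym.mul_left, jacobiSym.pow_left] at s1
  rw [jacobiSym_three.2 (Or.inr (mod_eq_mod_of_dvd m1 (by norm_num))), jacobiSym_two.2 (Or.inl (mod_eq_mod_of_dvd m1 (by norm_num))), jacobiSym_neg_one.2 (mod_eq_mod_of_dvd m1 (by norm_num))] at s1
  norm_num at s1
  have f2 := jacobiSym.quadratic_reciprocity_three_mod_four (a := g2) (b := g1)
    (mod_eq_mod_of_dvd m2 (by norm_num)) (mod_eq_mod_of_dvd m1 (by norm_num))
  have s2 := jacobiSym_mul_congr (b := g2) (x := 3 ^ 0 * 2 ^ 2) (a := g1)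
    (z := 1 * 3 ^ 0 * 2 ^ 2) (c := (44287 : ℕ)) ⟨8 * (3 * (y : ℤ) + 729), by
      push_cast
      linear_combination 1 * z1 - (3 * (y : ℤ) + 729) * z2⟩
  have t2 : jacobiSym 2 g2 ^ 2 = 1 := jacobiSym.sq_one (by
    exact_mod_cast (Nat.coprime_two_left.2 (Nat.odd_iff.2 (mod_eq_mod_of_dvd m2 (by norm_num)))))
  simp only [jacobiSym.mul_left, jacobiSym.pow_left, jacobiSym.one_left] at s2
  rw [t2] at s2
  norm_num at s2
  have f3 := jacobiSym.quadratic_reciprocity_three_mod_four (a := 44287) (b := g2)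
    (by norm_num) (mod_eq_mod_of_dvd m2 (by norm_num))
  have s3 := jacobiSym_mul_congr (b := 44287) (x := 8) (a := g2) (z := -242) (c := 1)
    ⟨1 * c, by
      have hcz : (y : ℤ) = 44287 * c + 1 := by exact_mod_cast hc
      push_cast
      linear_combination z2 + 1 * hcz⟩
  rw [show jacobiSym 8 44287 = 1 by norm_num, show jacobiSym (-242) 44287 = -1 by norm_num,
    jacobiSym.one_left] at s3
  push_cast at f1 f2 f3
  clear * - hJ f1 s1 f2 s2 f3 s3
  omega

theorem false_of_jacobiSym_eleven_six {y g0 g1 : ℕ} (hy : y % 96 = 43) (hN : y % 44287 = 1)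
    (e0 : 4 * g0 = y ^ 11 + 1) (e1 : 4 * g1 = 3 * y ^ 6 + 1)
    (hJ : jacobiSym 2 g0 = jacobiSym (-1) g0 * jacobiSym g1 g0) : False := by
  obtain ⟨c, hc⟩ : ∃ c, y = 44287 * c + 1 := ⟨y / 44287, by omega⟩
  have r5 : y ^ 5 % 96 = 91 := by norm_num [Nat.pow_mod, hy]
  have r6 : y ^ 6 % 96 = 73 := by norm_num [Nat.pow_mod, hy]
  have r11 : y ^ 11 % 96 = 19 := by norm_num [Nat.pow_mod, hy]
  have l5 : y ≤ y ^ 5 := Nat.le_self_pow (by norm_num) y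
  obtain ⟨g2, e2⟩ : ∃ g2, 8 * g2 + 3 = y ^ 5 :=
    ⟨(y ^ 5 - 3) / 8, by omega⟩
  obtain ⟨g3, e3⟩ : ∃ g3, 4 * g3 = 9 * y + 1 :=
    ⟨(9 * y + 1) / 4, by omega⟩
  have m0 : g0 % 24 = 5 := by clear * - e0 r11; omega
  have m1 : g1 % 24 = 7 := by clear * - e1 r6; omega
  have m2 : g2 % 12 = 11 := by clear * - e2 r5; omega
  have m3 : g3 % 24 = 1 := by clear * - e3 hy; omega
  have z0 : 4 * (g0 : ℤ) = (y : ℤ) ^ 11 + 1 := by exact_mod_cast e0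
  have z1 : 4 * (g1 : ℤ) = 3 * (y : ℤ) ^ 6 + 1 := by exact_mod_cast e1
  have z2 : 8 * (g2 : ℤ) = (y : ℤ) ^ 5 - 3 := eq_sub_of_add_eq (by exact_mod_cast e2)
  have z3 : 4 * (g3 : ℤ) = 9 * (y : ℤ) + 1 := by exact_mod_cast e3
  rw [jacobiSym_two.2 (Or.inr (mod_eq_mod_of_dvd m0 (by norm_num))), jacobiSym_neg_one.1 (mod_eq_mod_of_dvd m0 (by norm_num))] at hJ
  have f1 := jacobiSym.quadratic_reciprocity_one_mod_four' (a := g1) (b := g0)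
    (Nat.odd_iff.2 (mod_eq_mod_of_dvd m1 (by norm_num))) (mod_eq_mod_of_dvd m0 (by norm_num))
  have s1 := jacobiSym_mul_congr (b := g1) (x := 3 ^ 1 * 2 ^ 2) (a := g0)
    (z := -1 * 3 ^ 0 * 2 ^ 3) (c := g2) ⟨4 * (1 * (y : ℤ) ^ 5), by
      push_cast
      linear_combination 3 * z0 - (1 * (y : ℤ) ^ 5) * z1 - (-1) * z2⟩
  simp only [jacobiSym.mul_left, jacobiSym.pow_left] at s1
  rw [jacobiSym_three.2 (Or.inr (mod_eq_mod_of_dvd m1 (by norm_num))), jacobiSym_two.1 (Or.inr (mod_eq_mod_of_dvd m1 (by norm_num))), jacobiSym_neg_one.2 (mod_eq_mod_of_dvd m1 (by norm_num))] at s1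
  norm_num at s1
  have f2 := jacobiSym.quadratic_reciprocity_three_mod_four (a := g2) (b := g1)
    (mod_eq_mod_of_dvd m2 (by norm_num)) (mod_eq_mod_of_dvd m1 (by norm_num))
  have s2 := jacobiSym_mul_congr (b := g2) (x := 3 ^ 0 * 2 ^ 2) (a := g1)
    (z := 1 * 3 ^ 0 * 2 ^ 2) (c := g3) ⟨8 * (3 * (y : ℤ)), by
      push_cast
      linear_combination 1 * z1 - (3 * (y : ℤ)) * z2 - (1) * z3⟩
  have t2 : jacobiSym 2 g2 ^ 2 = 1 := jacobiSym.sq_one (by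
    exact_mod_cast (Nat.coprime_two_left.2 (Nat.odd_iff.2 (mod_eq_mod_of_dvd m2 (by norm_num)))))
  simp only [jacobiSym.mul_left, jacobiSym.pow_left, jacobiSym.one_left] at s2
  rw [t2] at s2
  norm_num at s2
  have f3 := jacobiSym.quadratic_reciprocity_one_mod_four (a := g3) (b := g2)
    (mod_eq_mod_of_dvd m3 (by norm_num)) (Nat.odd_iff.2 (mod_eq_mod_of_dvd m2 (by norm_num)))
  have s3 := jacobiSym_mul_congr (b := g3) (x := 3 ^ 10 * 2 ^ 3) (a := g2)
    (z := -1 * 3 ^ 0 * 2 ^ 2) (c := (44287 : ℕ)) ⟨4 * (6561 * (y : ℤ) ^ 4 - 729 * (y : ℤ) ^ 3 + 81 * (y : ℤ) ^ 2 - 9 * (y : ℤ) + 1), by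
      push_cast
      linear_combination 59049 * z2 - (6561 * (y : ℤ) ^ 4 - 729 * (y : ℤ) ^ 3 + 81 * (y : ℤ) ^ 2 - 9 * (y : ℤ) + 1) * z3⟩
  simp only [jacobiSym.mul_left, jacobiSym.pow_left] at s3
  rw [jacobiSym_three.1 (Or.inl (mod_eq_mod_of_dvd m3 (by norm_num))), jacobiSym_two.1 (Or.inl (mod_eq_mod_of_dvd m3 (by norm_num))), jacobiSym_neg_one.1 (mod_eq_mod_of_dvd m3 (by norm_num))] at s3
  norm_num at s3
  have f4 := jacobiSym.quadratic_reciprocity_one_mod_four' (a := 44287) (b := g3)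
    (by decide) (mod_eq_mod_of_dvd m3 (by norm_num))
  have s4 := jacobiSym_mul_congr (b := 44287) (x := 4) (a := g3) (z := 10) (c := 1)
    ⟨9 * c, by
      have hcz : (y : ℤ) = 44287 * c + 1 := by exact_mod_cast hc
      push_cast
      linear_combination z3 + 9 * hcz⟩
  rw [show jacobiSym 4 44287 = 1 by norm_num, show jacobiSym (10) 44287 = -1 by norm_num,
    jacobiSym.one_left] at s4
  push_cast at f1 f2 f3 f4
  clear * - hJ f1 s1 f2 s2 f3 s3 f4 s4
  omega

theorem false_of_jacobiSym_eleven_eight {y g0 g1 : ℕ} (hy : y % 96 = 43) (hN : y % 44287 = 1)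
    (e0 : 4 * g0 = y ^ 11 + 1) (e1 : 4 * g1 = 3 * y ^ 8 + 1)
    (hJ : jacobiSym 2 g0 = jacobiSym (-1) g0 * jacobiSym g1 g0) : False := by
  obtain ⟨c, hc⟩ : ∃ c, y = 44287 * c + 1 := ⟨y / 44287, by omega⟩
  have r2 : y ^ 2 % 96 = 25 := by norm_num [Nat.pow_mod, hy]
  have r3 : y ^ 3 % 96 = 19 := by norm_num [Nat.pow_mod, hy]
  have r8 : y ^ 8 % 96 = 1 := by norm_num [Nat.pow_mod, hy]
  have r11 : y ^ 11 % 96 = 19 := by norm_num [Nat.pow_mod, hy]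
  have l3 : y ≤ y ^ 3 := Nat.le_self_pow (by norm_num) y
  obtain ⟨g2, e2⟩ : ∃ g2, 16 * g2 + 3 = y ^ 3 :=
    ⟨(y ^ 3 - 3) / 16, by omega⟩
  obtain ⟨g3, e3⟩ : ∃ g3, 4 * g3 = 27 * y ^ 2 + 1 :=
    ⟨(27 * y ^ 2 + 1) / 4, by omega⟩
  obtain ⟨g4, e4⟩ : ∃ g4, 4 * g4 = y + 81 :=
    ⟨(y + 81) / 4, by omega⟩
  have m0 : g0 % 24 = 5 := by clear * - e0 r11; omega
  have m1 : g1 % 24 = 1 := by clear * - e1 r8; omega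
  have m2 : g2 % 6 = 1 := by clear * - e2 r3; omega
  have m3 : g3 % 24 = 1 := by clear * - e3 r2; omega
  have m4 : g4 % 24 = 7 := by clear * - e4 hy; omega
  have z0 : 4 * (g0 : ℤ) = (y : ℤ) ^ 11 + 1 := by exact_mod_cast e0
  have z1 : 4 * (g1 : ℤ) = 3 * (y : ℤ) ^ 8 + 1 := by exact_mod_cast e1
  have z2 : 16 * (g2 : ℤ) = (y : ℤ) ^ 3 - 3 := eq_sub_of_add_eq (by exact_mod_cast e2)
  have z3 : 4 * (g3 : ℤ) = 27 * (y : ℤ) ^ 2 + 1 := by exact_mod_cast e3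
  have z4 : 4 * (g4 : ℤ) = (y : ℤ) + 81 := by exact_mod_cast e4
  rw [jacobiSym_two.2 (Or.inr (mod_eq_mod_of_dvd m0 (by norm_num))), jacobiSym_neg_one.1 (mod_eq_mod_of_dvd m0 (by norm_num))] at hJ
  have f1 := jacobiSym.quadratic_reciprocity_one_mod_four (a := g1) (b := g0)
    (mod_eq_mod_of_dvd m1 (by norm_num)) (Nat.odd_iff.2 (mod_eq_mod_of_dvd m0 (by norm_num)))
  have s1 := jacobiSym_mul_congr (b := g1) (x := 3 ^ 1 * 2 ^ 2) (a := g0)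
    (z := -1 * 3 ^ 0 * 2 ^ 4) (c := g2) ⟨4 * (1 * (y : ℤ) ^ 3), by
      push_cast
      linear_combination 3 * z0 - (1 * (y : ℤ) ^ 3) * z1 - (-1) * z2⟩
  simp only [jacobiSym.mul_left, jacobiSym.pow_left] at s1
  rw [jacobiSym_three.1 (Or.inl (mod_eq_mod_of_dvd m1 (by norm_num))), jacobiSym_two.1 (Or.inl (mod_eq_mod_of_dvd m1 (by norm_num))), jacobiSym_neg_one.1 (mod_eq_mod_of_dvd m1 (by norm_num))] at s1
  norm_num at s1
  have f2 := jacobiSym.quadratic_reciprocity_one_mod_four' (a := g2) (b := g1)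
    (Nat.odd_iff.2 (mod_eq_mod_of_dvd m2 (by norm_num))) (mod_eq_mod_of_dvd m1 (by norm_num))
  have s2 := jacobiSym_mul_congr (b := g2) (x := 3 ^ 0 * 2 ^ 2) (a := g1)
    (z := 1 * 3 ^ 0 * 2 ^ 2) (c := g3) ⟨16 * (3 * (y : ℤ) ^ 5 + 9 * (y : ℤ) ^ 2), by
      push_cast
      linear_combination 1 * z1 - (3 * (y : ℤ) ^ 5 + 9 * (y : ℤ) ^ 2) * z2 - (1) * z3⟩
  have t2 : jacobiSym 2 g2 ^ 2 = 1 := jacobiSym.sq_one (by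
    exact_mod_cast (Nat.coprime_two_left.2 (Nat.odd_iff.2 (mod_eq_mod_of_dvd m2 (by norm_num)))))
  simp only [jacobiSym.mul_left, jacobiSym.pow_left, jacobiSym.one_left] at s2
  rw [t2] at s2
  norm_num at s2
  have f3 := jacobiSym.quadratic_reciprocity_one_mod_four (a := g3) (b := g2)
    (mod_eq_mod_of_dvd m3 (by norm_num)) (Nat.odd_iff.2 (mod_eq_mod_of_dvd m2 (by norm_num)))
  have s3 := jacobiSym_mul_congr (b := g3) (x := 3 ^ 3 * 2 ^ 4) (a := g2)
    (z := -1 * 3 ^ 0 * 2 ^ 2) (c := g4) ⟨4 * (1 * (y : ℤ)), by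
      push_cast
      linear_combination 27 * z2 - (1 * (y : ℤ)) * z3 - (-1) * z4⟩
  simp only [jacobiSym.mul_left, jacobiSym.pow_left] at s3
  rw [jacobiSym_three.1 (Or.inl (mod_eq_mod_of_dvd m3 (by norm_num))), jacobiSym_two.1 (Or.inl (mod_eq_mod_of_dvd m3 (by norm_num))), jacobiSym_neg_one.1 (mod_eq_mod_of_dvd m3 (by norm_num))] at s3
  norm_num at s3
  have f4 := jacobiSym.quadratic_reciprocity_one_mod_four' (a := g4) (b := g3)
    (Nat.odd_iff.2 (mod_eq_mod_of_dvd m4 (by norm_num))) (mod_eq_mod_of_dvd m3 (by norm_num))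
  have s4 := jacobiSym_mul_congr (b := g4) (x := 3 ^ 0 * 2 ^ 2) (a := g3)
    (z := 1 * 3 ^ 0 * 2 ^ 2) (c := (44287 : ℕ)) ⟨4 * (27 * (y : ℤ) - 2187), by
      push_cast
      linear_combination 1 * z3 - (27 * (y : ℤ) - 2187) * z4⟩
  simp only [jacobiSym.mul_left, jacobiSym.pow_left, jacobiSym.one_left] at s4
  rw [jacobiSym_two.1 (Or.inr (mod_eq_mod_of_dvd m4 (by norm_num)))] at s4
  norm_num at s4
  have f5 := jacobiSym.quadratic_reciprocity_three_mod_four (a := 44287) (b := g4)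
    (by norm_num) (mod_eq_mod_of_dvd m4 (by norm_num))
  have s5 := jacobiSym_mul_congr (b := 44287) (x := 4) (a := g4) (z := 82) (c := 1)
    ⟨1 * c, by
      have hcz : (y : ℤ) = 44287 * c + 1 := by exact_mod_cast hc
      push_cast
      linear_combination z4 + 1 * hcz⟩
  rw [show jacobiSym 4 44287 = 1 by norm_num, show jacobiSym (82) 44287 = -1 by norm_num,
    jacobiSym.one_left] at s5
  push_cast at f1 f2 f3 f4 f5
  clear * - hJ f1 s1 f2 s2 f3 s3 f4 s4 f5 s5
  omega

theorem false_of_jacobiSym_eleven_ten {y g0 g1 : ℕ} (hy : y % 96 = 43) (hN : y % 44287 = 1)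
    (e0 : 4 * g0 = y ^ 11 + 1) (e1 : 4 * g1 = 3 * y ^ 10 + 1)
    (hJ : jacobiSym 2 g0 = jacobiSym (-1) g0 * jacobiSym g1 g0) : False := by
  obtain ⟨c, hc⟩ : ∃ c, y = 44287 * c + 1 := ⟨y / 44287, by omega⟩
  have r10 : y ^ 10 % 96 = 25 := by norm_num [Nat.pow_mod, hy]
  have r11 : y ^ 11 % 96 = 19 := by norm_num [Nat.pow_mod, hy]
  obtain ⟨g2, e2⟩ : ∃ g2, 8 * g2 + 3 = y :=
    ⟨(y - 3) / 8, by omega⟩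
  have m0 : g0 % 24 = 5 := by clear * - e0 r11; omega
  have m1 : g1 % 24 = 19 := by clear * - e1 r10; omega
  have m2 : g2 % 12 = 5 := by clear * - e2 hy; omega
  have z0 : 4 * (g0 : ℤ) = (y : ℤ) ^ 11 + 1 := by exact_mod_cast e0
  have z1 : 4 * (g1 : ℤ) = 3 * (y : ℤ) ^ 10 + 1 := by exact_mod_cast e1
  have z2 : 8 * (g2 : ℤ) = (y : ℤ) - 3 := eq_sub_of_add_eq (by exact_mod_cast e2)
  rw [jacobiSym_two.2 (Or.inr (mod_eq_mod_of_dvd m0 (by norm_num))), jacobiSym_neg_one.1 (mod_eq_mod_of_dvd m0 (by norm_num))] at hJ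
  have f1 := jacobiSym.quadratic_reciprocity_one_mod_four' (a := g1) (b := g0)
    (Nat.odd_iff.2 (mod_eq_mod_of_dvd m1 (by norm_num))) (mod_eq_mod_of_dvd m0 (by norm_num))
  have s1 := jacobiSym_mul_congr (b := g1) (x := 3 ^ 1 * 2 ^ 2) (a := g0)
    (z := -1 * 3 ^ 0 * 2 ^ 3) (c := g2) ⟨4 * (1 * (y : ℤ)), by
      push_cast
      linear_combination 3 * z0 - (1 * (y : ℤ)) * z1 - (-1) * z2⟩
  simp only [jacobiSym.mul_left, jacobiSym.pow_left] at s1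
  rw [jacobiSym_three.2 (Or.inr (mod_eq_mod_of_dvd m1 (by norm_num))), jacobiSym_two.2 (Or.inl (mod_eq_mod_of_dvd m1 (by norm_num))), jacobiSym_neg_one.2 (mod_eq_mod_of_dvd m1 (by norm_num))] at s1
  norm_num at s1
  have f2 := jacobiSym.quadratic_reciprocity_one_mod_four (a := g2) (b := g1)
    (mod_eq_mod_of_dvd m2 (by norm_num)) (Nat.odd_iff.2 (mod_eq_mod_of_dvd m1 (by norm_num)))
  have s2 := jacobiSym_mul_congr (b := g2) (x := 3 ^ 0 * 2 ^ 2) (a := g1)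
    (z := 1 * 3 ^ 0 * 2 ^ 2) (c := (44287 : ℕ)) ⟨8 * (3 * (y : ℤ) ^ 9 + 9 * (y : ℤ) ^ 8 + 27 * (y : ℤ) ^ 7 + 81 * (y : ℤ) ^ 6 + 243 * (y : ℤ) ^ 5 + 729 * (y : ℤ) ^ 4 + 2187 * (y : ℤ) ^ 3 + 6561 * (y : ℤ) ^ 2 + 19683 * (y : ℤ) + 59049), by
      push_cast
      linear_combination 1 * z1 - (3 * (y : ℤ) ^ 9 + 9 * (y : ℤ) ^ 8 + 27 * (y : ℤ) ^ 7 + 81 * (y : ℤ) ^ 6 + 243 * (y : ℤ) ^ 5 + 729 * (y : ℤ) ^ 4 + 2187 * (y : ℤ) ^ 3 + 6561 * (y : ℤ) ^ 2 + 19683 * (y : ℤ) + 59049) * z2⟩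
  have t2 : jacobiSym 2 g2 ^ 2 = 1 := jacobiSym.sq_one (by
    exact_mod_cast (Nat.coprime_two_left.2 (Nat.odd_iff.2 (mod_eq_mod_of_dvd m2 (by norm_num)))))
  simp only [jacobiSym.mul_left, jacobiSym.pow_left, jacobiSym.one_left] at s2
  rw [t2] at s2
  norm_num at s2
  have f3 := jacobiSym.quadratic_reciprocity_one_mod_four' (a := 44287) (b := g2)
    (by decide) (mod_eq_mod_of_dvd m2 (by norm_num))
  have s3 := jacobiSym_mul_congr (b := 44287) (x := 8) (a := g2) (z := -2) (c := 1)
    ⟨1 * c, by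
      have hcz : (y : ℤ) = 44287 * c + 1 := by exact_mod_cast hc
      push_cast
      linear_combination z2 + 1 * hcz⟩
  rw [show jacobiSym 8 44287 = 1 by norm_num, show jacobiSym (-2) 44287 = -1 by norm_num,
    jacobiSym.one_left] at s3
  push_cast at f1 f2 f3
  clear * - hJ f1 s1 f2 s2 f3 s3
  omega

theorem false_of_jacobiSym_seventeen_three {y g0 g1 : ℕ} (hy : y % 96 = 43) (hN : y % 32285041 = 1)
    (e0 : 4 * g0 = y ^ 17 + 1) (e1 : 4 * g1 = y ^ 14 + 3)
    (hJ : jacobiSym 2 g0 = jacobiSym (-1) g0 * jacobiSym g1 g0) : False := by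
  obtain ⟨c, hc⟩ : ∃ c, y = 32285041 * c + 1 := ⟨y / 32285041, by omega⟩
  have r2 : y ^ 2 % 96 = 25 := by norm_num [Nat.pow_mod, hy]
  have r3 : y ^ 3 % 96 = 19 := by norm_num [Nat.pow_mod, hy]
  have r14 : y ^ 14 % 96 = 73 := by norm_num [Nat.pow_mod, hy]
  have r17 : y ^ 17 % 96 = 43 := by norm_num [Nat.pow_mod, hy]
  have l3 : y ≤ y ^ 3 := Nat.le_self_pow (by norm_num) y
  obtain ⟨g2, e2⟩ : ∃ g2, 8 * g2 + 1 = 3 * y ^ 3 :=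
    ⟨(3 * y ^ 3 - 1) / 8, by omega⟩
  obtain ⟨g3, e3⟩ : ∃ g3, 4 * g3 = y ^ 2 + 243 :=
    ⟨(y ^ 2 + 243) / 4, by omega⟩
  obtain ⟨g4, e4⟩ : ∃ g4, 4 * g4 = 729 * y + 1 :=
    ⟨(729 * y + 1) / 4, by omega⟩
  have m0 : g0 % 24 = 11 := by clear * - e0 r17; omega
  have m1 : g1 % 24 = 19 := by clear * - e1 r14; omega
  have m2 : g2 % 12 = 7 := by clear * - e2 r3; omega
  have m3 : g3 % 24 = 19 := by clear * - e3 r2; omega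
  have m4 : g4 % 24 = 13 := by clear * - e4 hy; omega
  have z0 : 4 * (g0 : ℤ) = (y : ℤ) ^ 17 + 1 := by exact_mod_cast e0
  have z1 : 4 * (g1 : ℤ) = (y : ℤ) ^ 14 + 3 := by exact_mod_cast e1
  have z2 : 8 * (g2 : ℤ) = 3 * (y : ℤ) ^ 3 - 1 := eq_sub_of_add_eq (by exact_mod_cast e2)
  have z3 : 4 * (g3 : ℤ) = (y : ℤ) ^ 2 + 243 := by exact_mod_cast e3
  have z4 : 4 * (g4 : ℤ) = 729 * (y : ℤ) + 1 := by exact_mod_cast e4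
  rw [jacobiSym_two.2 (Or.inl (mod_eq_mod_of_dvd m0 (by norm_num))), jacobiSym_neg_one.2 (mod_eq_mod_of_dvd m0 (by norm_num))] at hJ
  have f1 := jacobiSym.quadratic_reciprocity_three_mod_four (a := g1) (b := g0)
    (mod_eq_mod_of_dvd m1 (by norm_num)) (mod_eq_mod_of_dvd m0 (by norm_num))
  have s1 := jacobiSym_mul_congr (b := g1) (x := 3 ^ 0 * 2 ^ 2) (a := g0)
    (z := -1 * 3 ^ 0 * 2 ^ 3) (c := g2) ⟨4 * (1 * (y : ℤ) ^ 3), by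
      push_cast
      linear_combination 1 * z0 - (1 * (y : ℤ) ^ 3) * z1 - (-1) * z2⟩
  simp only [jacobiSym.mul_left, jacobiSym.pow_left] at s1
  rw [jacobiSym_two.2 (Or.inl (mod_eq_mod_of_dvd m1 (by norm_num))), jacobiSym_neg_one.2 (mod_eq_mod_of_dvd m1 (by norm_num))] at s1
  norm_num at s1
  have f2 := jacobiSym.quadratic_reciprocity_three_mod_four (a := g2) (b := g1)
    (mod_eq_mod_of_dvd m2 (by norm_num)) (mod_eq_mod_of_dvd m1 (by norm_num))
  have s2 := jacobiSym_mul_congr (b := g2) (x := 3 ^ 4 * 2 ^ 2) (a := g1)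
    (z := 1 * 3 ^ 0 * 2 ^ 2) (c := g3) ⟨8 * (27 * (y : ℤ) ^ 11 + 9 * (y : ℤ) ^ 8 + 3 * (y : ℤ) ^ 5 + 1 * (y : ℤ) ^ 2), by
      push_cast
      linear_combination 81 * z1 - (27 * (y : ℤ) ^ 11 + 9 * (y : ℤ) ^ 8 + 3 * (y : ℤ) ^ 5 + 1 * (y : ℤ) ^ 2) * z2 - (1) * z3⟩
  have t2 : jacobiSym 2 g2 ^ 2 = 1 := jacobiSym.sq_one (by
    exact_mod_cast (Nat.coprime_two_left.2 (Nat.odd_iff.2 (mod_eq_mod_of_dvd m2 (by norm_num)))))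
  simp only [jacobiSym.mul_left, jacobiSym.pow_left, jacobiSym.one_left] at s2
  rw [jacobiSym_three.2 (Or.inr (mod_eq_mod_of_dvd m2 (by norm_num))), t2] at s2
  norm_num at s2
  have f3 := jacobiSym.quadratic_reciprocity_three_mod_four (a := g3) (b := g2)
    (mod_eq_mod_of_dvd m3 (by norm_num)) (mod_eq_mod_of_dvd m2 (by norm_num))
  have s3 := jacobiSym_mul_congr (b := g3) (x := 3 ^ 0 * 2 ^ 3) (a := g2)
    (z := -1 * 3 ^ 0 * 2 ^ 2) (c := g4) ⟨4 * (3 * (y : ℤ)), by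
      push_cast
      linear_combination 1 * z2 - (3 * (y : ℤ)) * z3 - (-1) * z4⟩
  simp only [jacobiSym.mul_left, jacobiSym.pow_left] at s3
  rw [jacobiSym_two.2 (Or.inl (mod_eq_mod_of_dvd m3 (by norm_num))), jacobiSym_neg_one.2 (mod_eq_mod_of_dvd m3 (by norm_num))] at s3
  norm_num at s3
  have f4 := jacobiSym.quadratic_reciprocity_one_mod_four (a := g4) (b := g3)
    (mod_eq_mod_of_dvd m4 (by norm_num)) (Nat.odd_iff.2 (mod_eq_mod_of_dvd m3 (by norm_num)))
  have s4 := jacobiSym_mul_congr (b := g4) (x := 3 ^ 12 * 2 ^ 2) (a := g3)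
    (z := 1 * 3 ^ 0 * 2 ^ 2) (c := (32285041 : ℕ)) ⟨4 * (729 * (y : ℤ) - 1), by
      push_cast
      linear_combination 531441 * z3 - (729 * (y : ℤ) - 1) * z4⟩
  simp only [jacobiSym.mul_left, jacobiSym.pow_left, jacobiSym.one_left] at s4
  rw [jacobiSym_three.1 (Or.inl (mod_eq_mod_of_dvd m4 (by norm_num))), jacobiSym_two.2 (Or.inr (mod_eq_mod_of_dvd m4 (by norm_num)))] at s4
  norm_num at s4
  have f5 := jacobiSym.quadratic_reciprocity_one_mod_four (a := 32285041) (b := g4) (by norm_num)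
    (Nat.odd_iff.2 (mod_eq_mod_of_dvd m4 (by norm_num)))
  have s5 := jacobiSym_mul_congr (b := 32285041) (x := 4) (a := g4) (z := 730) (c := 1)
    ⟨729 * c, by
      have hcz : (y : ℤ) = 32285041 * c + 1 := by exact_mod_cast hc
      push_cast
      linear_combination z4 + 729 * hcz⟩
  rw [show jacobiSym 4 32285041 = 1 by norm_num, show jacobiSym (730) 32285041 = 1 by norm_num,
    jacobiSym.one_left] at s5
  push_cast at f1 f2 f3 f4 f5
  clear * - hJ f1 s1 f2 s2 f3 s3 f4 s4 f5 s5
  omega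

theorem false_of_jacobiSym_eleven_seven {y g0 g1 : ℕ} (hy : y % 192 = 43) (hN : y % 44287 = 1)
    (e0 : 4 * g0 = y ^ 11 + 1) (e1 : 4 * g1 = y ^ 4 + 3)
    (hJ : jacobiSym 2 g0 = jacobiSym (-1) g0 * jacobiSym g1 g0) : False := by
  obtain ⟨c, hc⟩ : ∃ c, y = 44287 * c + 1 := ⟨y / 44287, by omega⟩
  have r3 : y ^ 3 % 192 = 19 := by norm_num [Nat.pow_mod, hy]
  have r4 : y ^ 4 % 192 = 49 := by norm_num [Nat.pow_mod, hy]
  have r11 : y ^ 11 % 192 = 115 := by norm_num [Nat.pow_mod, hy]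
  obtain ⟨g2, e2⟩ : ∃ g2, 4 * g2 = 9 * y ^ 3 + 1 :=
    ⟨(9 * y ^ 3 + 1) / 4, by omega⟩
  obtain ⟨g3, e3⟩ : ∃ g3, 16 * g3 + 27 = y :=
    ⟨(y - 27) / 16, by omega⟩
  have m0 : g0 % 48 = 29 := by clear * - e0 r11; omega
  have m1 : g1 % 48 = 13 := by clear * - e1 r4; omega
  have m2 : g2 % 48 = 43 := by clear * - e2 r3; omega
  have m3 : g3 % 12 = 1 := by clear * - e3 hy; omega
  have z0 : 4 * (g0 : ℤ) = (y : ℤ) ^ 11 + 1 := by exact_mod_cast e0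
  have z1 : 4 * (g1 : ℤ) = (y : ℤ) ^ 4 + 3 := by exact_mod_cast e1
  have z2 : 4 * (g2 : ℤ) = 9 * (y : ℤ) ^ 3 + 1 := by exact_mod_cast e2
  have z3 : 16 * (g3 : ℤ) = (y : ℤ) - 27 := eq_sub_of_add_eq (by exact_mod_cast e3)
  rw [jacobiSym_two.2 (Or.inr (mod_eq_mod_of_dvd m0 (by norm_num))), jacobiSym_neg_one.1 (mod_eq_mod_of_dvd m0 (by norm_num))] at hJ
  have f1 := jacobiSym.quadratic_reciprocity_one_mod_four (a := g1) (b := g0)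
    (mod_eq_mod_of_dvd m1 (by norm_num)) (Nat.odd_iff.2 (mod_eq_mod_of_dvd m0 (by norm_num)))
  have s1 := jacobiSym_mul_congr (b := g1) (x := 3 ^ 0 * 2 ^ 2) (a := g0)
    (z := 1 * 3 ^ 0 * 2 ^ 2) (c := g2) ⟨4 * (1 * (y : ℤ) ^ 7 - 3 * (y : ℤ) ^ 3), by
      push_cast
      linear_combination 1 * z0 - (1 * (y : ℤ) ^ 7 - 3 * (y : ℤ) ^ 3) * z1 - (1) * z2⟩
  simp only [jacobiSym.mul_left, jacobiSym.pow_left, jacobiSym.one_left] at s1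
  rw [jacobiSym_two.2 (Or.inr (mod_eq_mod_of_dvd m1 (by norm_num)))] at s1
  norm_num at s1
  have f2 := jacobiSym.quadratic_reciprocity_one_mod_four' (a := g2) (b := g1)
    (Nat.odd_iff.2 (mod_eq_mod_of_dvd m2 (by norm_num))) (mod_eq_mod_of_dvd m1 (by norm_num))
  have s2 := jacobiSym_mul_congr (b := g2) (x := 3 ^ 2 * 2 ^ 2) (a := g1)
    (z := -1 * 3 ^ 0 * 2 ^ 4) (c := g3) ⟨4 * (1 * (y : ℤ)), by
      push_cast
      linear_combination 9 * z1 - (1 * (y : ℤ)) * z2 - (-1) * z3⟩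
  simp only [jacobiSym.mul_left, jacobiSym.pow_left] at s2
  rw [jacobiSym_three.2 (Or.inr (mod_eq_mod_of_dvd m2 (by norm_num))), jacobiSym_two.2 (Or.inl (mod_eq_mod_of_dvd m2 (by norm_num))), jacobiSym_neg_one.2 (mod_eq_mod_of_dvd m2 (by norm_num))] at s2
  norm_num at s2
  have f3 := jacobiSym.quadratic_reciprocity_one_mod_four (a := g3) (b := g2)
    (mod_eq_mod_of_dvd m3 (by norm_num)) (Nat.odd_iff.2 (mod_eq_mod_of_dvd m2 (by norm_num)))
  have s3 := jacobiSym_mul_congr (b := g3) (x := 3 ^ 0 * 2 ^ 2) (a := g2)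
    (z := 1 * 3 ^ 0 * 2 ^ 2) (c := (44287 : ℕ)) ⟨16 * (9 * (y : ℤ) ^ 2 + 243 * (y : ℤ) + 6561), by
      push_cast
      linear_combination 1 * z2 - (9 * (y : ℤ) ^ 2 + 243 * (y : ℤ) + 6561) * z3⟩
  have t3 : jacobiSym 2 g3 ^ 2 = 1 := jacobiSym.sq_one (by
    exact_mod_cast (Nat.coprime_two_left.2 (Nat.odd_iff.2 (mod_eq_mod_of_dvd m3 (by norm_num)))))
  simp only [jacobiSym.mul_left, jacobiSym.pow_left, jacobiSym.one_left] at s3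
  rw [t3] at s3
  norm_num at s3
  have f4 := jacobiSym.quadratic_reciprocity_one_mod_four' (a := 44287) (b := g3)
    (by decide) (mod_eq_mod_of_dvd m3 (by norm_num))
  have s4 := jacobiSym_mul_congr (b := 44287) (x := 16) (a := g3) (z := -26) (c := 1)
    ⟨1 * c, by
      have hcz : (y : ℤ) = 44287 * c + 1 := by exact_mod_cast hc
      push_cast
      linear_combination z3 + 1 * hcz⟩
  rw [show jacobiSym 16 44287 = 1 by norm_num, show jacobiSym (-26) 44287 = -1 by norm_num,
    jacobiSym.one_left] at s4
  push_cast at f1 f2 f3 f4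
  clear * - hJ f1 s1 f2 s2 f3 s3 f4 s4
  omega

theorem false_of_jacobiSym_eleven_seven' {y g0 g1 : ℕ} (hy : y % 192 = 139) (hN : y % 44287 = 1)
    (e0 : 4 * g0 = y ^ 11 + 1) (e1 : 4 * g1 = y ^ 4 + 3)
    (hJ : jacobiSym 2 g0 = jacobiSym (-1) g0 * jacobiSym g1 g0) : False := by
  obtain ⟨c, hc⟩ : ∃ c, y = 44287 * c + 1 := ⟨y / 44287, by omega⟩
  have r3 : y ^ 3 % 192 = 115 := by norm_num [Nat.pow_mod, hy]
  have r4 : y ^ 4 % 192 = 49 := by norm_num [Nat.pow_mod, hy]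
  have r11 : y ^ 11 % 192 = 19 := by norm_num [Nat.pow_mod, hy]
  obtain ⟨g2, e2⟩ : ∃ g2, 4 * g2 = 9 * y ^ 3 + 1 :=
    ⟨(9 * y ^ 3 + 1) / 4, by omega⟩
  obtain ⟨g3, e3⟩ : ∃ g3, 16 * g3 + 27 = y :=
    ⟨(y - 27) / 16, by omega⟩
  have m0 : g0 % 48 = 5 := by clear * - e0 r11; omega
  have m1 : g1 % 48 = 13 := by clear * - e1 r4; omega
  have m2 : g2 % 48 = 19 := by clear * - e2 r3; omega
  have m3 : g3 % 12 = 7 := by clear * - e3 hy; omega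
  have z0 : 4 * (g0 : ℤ) = (y : ℤ) ^ 11 + 1 := by exact_mod_cast e0
  have z1 : 4 * (g1 : ℤ) = (y : ℤ) ^ 4 + 3 := by exact_mod_cast e1
  have z2 : 4 * (g2 : ℤ) = 9 * (y : ℤ) ^ 3 + 1 := by exact_mod_cast e2
  have z3 : 16 * (g3 : ℤ) = (y : ℤ) - 27 := eq_sub_of_add_eq (by exact_mod_cast e3)
  rw [jacobiSym_two.2 (Or.inr (mod_eq_mod_of_dvd m0 (by norm_num))), jacobiSym_neg_one.1 (mod_eq_mod_of_dvd m0 (by norm_num))] at hJ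
  have f1 := jacobiSym.quadratic_reciprocity_one_mod_four (a := g1) (b := g0)
    (mod_eq_mod_of_dvd m1 (by norm_num)) (Nat.odd_iff.2 (mod_eq_mod_of_dvd m0 (by norm_num)))
  have s1 := jacobiSym_mul_congr (b := g1) (x := 3 ^ 0 * 2 ^ 2) (a := g0)
    (z := 1 * 3 ^ 0 * 2 ^ 2) (c := g2) ⟨4 * (1 * (y : ℤ) ^ 7 - 3 * (y : ℤ) ^ 3), by
      push_cast
      linear_combination 1 * z0 - (1 * (y : ℤ) ^ 7 - 3 * (y : ℤ) ^ 3) * z1 - (1) * z2⟩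
  simp only [jacobiSym.mul_left, jacobiSym.pow_left, jacobiSym.one_left] at s1
  rw [jacobiSym_two.2 (Or.inr (mod_eq_mod_of_dvd m1 (by norm_num)))] at s1
  norm_num at s1
  have f2 := jacobiSym.quadratic_reciprocity_one_mod_four' (a := g2) (b := g1)
    (Nat.odd_iff.2 (mod_eq_mod_of_dvd m2 (by norm_num))) (mod_eq_mod_of_dvd m1 (by norm_num))
  have s2 := jacobiSym_mul_congr (b := g2) (x := 3 ^ 2 * 2 ^ 2) (a := g1)
    (z := -1 * 3 ^ 0 * 2 ^ 4) (c := g3) ⟨4 * (1 * (y : ℤ)), by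
      push_cast
      linear_combination 9 * z1 - (1 * (y : ℤ)) * z2 - (-1) * z3⟩
  simp only [jacobiSym.mul_left, jacobiSym.pow_left] at s2
  rw [jacobiSym_three.2 (Or.inr (mod_eq_mod_of_dvd m2 (by norm_num))), jacobiSym_two.2 (Or.inl (mod_eq_mod_of_dvd m2 (by norm_num))), jacobiSym_neg_one.2 (mod_eq_mod_of_dvd m2 (by norm_num))] at s2
  norm_num at s2
  have f3 := jacobiSym.quadratic_reciprocity_three_mod_four (a := g3) (b := g2)
    (mod_eq_mod_of_dvd m3 (by norm_num)) (mod_eq_mod_of_dvd m2 (by norm_num))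
  have s3 := jacobiSym_mul_congr (b := g3) (x := 3 ^ 0 * 2 ^ 2) (a := g2)
    (z := 1 * 3 ^ 0 * 2 ^ 2) (c := (44287 : ℕ)) ⟨16 * (9 * (y : ℤ) ^ 2 + 243 * (y : ℤ) + 6561), by
      push_cast
      linear_combination 1 * z2 - (9 * (y : ℤ) ^ 2 + 243 * (y : ℤ) + 6561) * z3⟩
  have t3 : jacobiSym 2 g3 ^ 2 = 1 := jacobiSym.sq_one (by
    exact_mod_cast (Nat.coprime_two_left.2 (Nat.odd_iff.2 (mod_eq_mod_of_dvd m3 (by norm_num)))))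
  simp only [jacobiSym.mul_left, jacobiSym.pow_left, jacobiSym.one_left] at s3
  rw [t3] at s3
  norm_num at s3
  have f4 := jacobiSym.quadratic_reciprocity_three_mod_four (a := 44287) (b := g3)
    (by norm_num) (mod_eq_mod_of_dvd m3 (by norm_num))
  have s4 := jacobiSym_mul_congr (b := 44287) (x := 16) (a := g3) (z := -26) (c := 1)
    ⟨1 * c, by
      have hcz : (y : ℤ) = 44287 * c + 1 := by exact_mod_cast hc
      push_cast
      linear_combination z3 + 1 * hcz⟩
  rw [show jacobiSym 16 44287 = 1 by norm_num, show jacobiSym (-26) 44287 = -1 by norm_num,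
    jacobiSym.one_left] at s4
  push_cast at f1 f2 f3 f4
  clear * - hJ f1 s1 f2 s2 f3 s3 f4 s4
  omega

theorem false_of_jacobiSym_seventeen_ten {y g0 g1 : ℕ} (hy : y % 768 = 139) (hN : y % 32285041 = 1)
    (e0 : 4 * g0 = y ^ 17 + 1) (e1 : 4 * g1 = 3 * y ^ 10 + 1)
    (hJ : jacobiSym 2 g0 = jacobiSym (-1) g0 * jacobiSym g1 g0) : False := by
  obtain ⟨c, hc⟩ : ∃ c, y = 32285041 * c + 1 := ⟨y / 32285041, by omega⟩
  have r3 : y ^ 3 % 768 = 691 := by norm_num [Nat.pow_mod, hy]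
  have r7 : y ^ 7 % 768 = 67 := by norm_num [Nat.pow_mod, hy]
  have r10 : y ^ 10 % 768 = 217 := by norm_num [Nat.pow_mod, hy]
  have r17 : y ^ 17 % 768 = 715 := by norm_num [Nat.pow_mod, hy]
  have l7 : y ≤ y ^ 7 := Nat.le_self_pow (by norm_num) y
  obtain ⟨g2, e2⟩ : ∃ g2, 64 * g2 + 3 = y ^ 7 :=
    ⟨(y ^ 7 - 3) / 64, by omega⟩
  obtain ⟨g3, e3⟩ : ∃ g3, 4 * g3 = 9 * y ^ 3 + 1 :=
    ⟨(9 * y ^ 3 + 1) / 4, by omega⟩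
  obtain ⟨g4, e4⟩ : ∃ g4, 8 * g4 + 243 = y :=
    ⟨(y - 243) / 8, by omega⟩
  have m0 : g0 % 192 = 179 := by clear * - e0 r17; omega
  have m1 : g1 % 192 = 163 := by clear * - e1 r10; omega
  have m2 : g2 % 12 = 1 := by clear * - e2 r7; omega
  have m3 : g3 % 192 = 19 := by clear * - e3 r3; omega
  have m4 : g4 % 96 = 83 := by clear * - e4 hy; omega
  have z0 : 4 * (g0 : ℤ) = (y : ℤ) ^ 17 + 1 := by exact_mod_cast e0
  have z1 : 4 * (g1 : ℤ) = 3 * (y : ℤ) ^ 10 + 1 := by exact_mod_cast e1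
  have z2 : 64 * (g2 : ℤ) = (y : ℤ) ^ 7 - 3 := eq_sub_of_add_eq (by exact_mod_cast e2)
  have z3 : 4 * (g3 : ℤ) = 9 * (y : ℤ) ^ 3 + 1 := by exact_mod_cast e3
  have z4 : 8 * (g4 : ℤ) = (y : ℤ) - 243 := eq_sub_of_add_eq (by exact_mod_cast e4)
  rw [jacobiSym_two.2 (Or.inl (mod_eq_mod_of_dvd m0 (by norm_num))), jacobiSym_neg_one.2 (mod_eq_mod_of_dvd m0 (by norm_num))] at hJ
  have f1 := jacobiSym.quadratic_reciprocity_three_mod_four (a := g1) (b := g0)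
    (mod_eq_mod_of_dvd m1 (by norm_num)) (mod_eq_mod_of_dvd m0 (by norm_num))
  have s1 := jacobiSym_mul_congr (b := g1) (x := 3 ^ 1 * 2 ^ 2) (a := g0)
    (z := -1 * 3 ^ 0 * 2 ^ 6) (c := g2) ⟨4 * (1 * (y : ℤ) ^ 7), by
      push_cast
      linear_combination 3 * z0 - (1 * (y : ℤ) ^ 7) * z1 - (-1) * z2⟩
  simp only [jacobiSym.mul_left, jacobiSym.pow_left] at s1
  rw [jacobiSym_three.2 (Or.inr (mod_eq_mod_of_dvd m1 (by norm_num))), jacobiSym_two.2 (Or.inl (mod_eq_mod_of_dvd m1 (by norm_num))), jacobiSym_neg_one.2 (mod_eq_mod_of_dvd m1 (by norm_num))] at s1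
  norm_num at s1
  have f2 := jacobiSym.quadratic_reciprocity_one_mod_four (a := g2) (b := g1)
    (mod_eq_mod_of_dvd m2 (by norm_num)) (Nat.odd_iff.2 (mod_eq_mod_of_dvd m1 (by norm_num)))
  have s2 := jacobiSym_mul_congr (b := g2) (x := 3 ^ 0 * 2 ^ 2) (a := g1)
    (z := 1 * 3 ^ 0 * 2 ^ 2) (c := g3) ⟨64 * (3 * (y : ℤ) ^ 3), by
      push_cast
      linear_combination 1 * z1 - (3 * (y : ℤ) ^ 3) * z2 - (1) * z3⟩
  have t2 : jacobiSym 2 g2 ^ 2 = 1 := jacobiSym.sq_one (by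
    exact_mod_cast (Nat.coprime_two_left.2 (Nat.odd_iff.2 (mod_eq_mod_of_dvd m2 (by norm_num)))))
  simp only [jacobiSym.mul_left, jacobiSym.pow_left, jacobiSym.one_left] at s2
  rw [t2] at s2
  norm_num at s2
  have f3 := jacobiSym.quadratic_reciprocity_one_mod_four' (a := g3) (b := g2)
    (Nat.odd_iff.2 (mod_eq_mod_of_dvd m3 (by norm_num))) (mod_eq_mod_of_dvd m2 (by norm_num))
  have s3 := jacobiSym_mul_congr (b := g3) (x := 3 ^ 4 * 2 ^ 6) (a := g2)
    (z := 1 * 3 ^ 0 * 2 ^ 3) (c := g4) ⟨4 * (9 * (y : ℤ) ^ 4 - 1 * (y : ℤ)), by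
      push_cast
      linear_combination 81 * z2 - (9 * (y : ℤ) ^ 4 - 1 * (y : ℤ)) * z3 - (1) * z4⟩
  simp only [jacobiSym.mul_left, jacobiSym.pow_left, jacobiSym.one_left] at s3
  rw [jacobiSym_three.2 (Or.inr (mod_eq_mod_of_dvd m3 (by norm_num))), jacobiSym_two.2 (Or.inl (mod_eq_mod_of_dvd m3 (by norm_num)))] at s3
  norm_num at s3
  have f4 := jacobiSym.quadratic_reciprocity_three_mod_four (a := g4) (b := g3)
    (mod_eq_mod_of_dvd m4 (by norm_num)) (mod_eq_mod_of_dvd m3 (by norm_num))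
  have s4 := jacobiSym_mul_congr (b := g4) (x := 3 ^ 0 * 2 ^ 2) (a := g3)
    (z := 1 * 3 ^ 0 * 2 ^ 2) (c := (32285041 : ℕ)) ⟨8 * (9 * (y : ℤ) ^ 2 + 2187 * (y : ℤ) + 531441), by
      push_cast
      linear_combination 1 * z3 - (9 * (y : ℤ) ^ 2 + 2187 * (y : ℤ) + 531441) * z4⟩
  simp only [jacobiSym.mul_left, jacobiSym.pow_left, jacobiSym.one_left] at s4
  rw [jacobiSym_two.2 (Or.inl (mod_eq_mod_of_dvd m4 (by norm_num)))] at s4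
  norm_num at s4
  have f5 := jacobiSym.quadratic_reciprocity_one_mod_four (a := 32285041) (b := g4) (by norm_num)
    (Nat.odd_iff.2 (mod_eq_mod_of_dvd m4 (by norm_num)))
  have s5 := jacobiSym_mul_congr (b := 32285041) (x := 8) (a := g4) (z := -242) (c := 1)
    ⟨1 * c, by
      have hcz : (y : ℤ) = 32285041 * c + 1 := by exact_mod_cast hc
      push_cast
      linear_combination z4 + 1 * hcz⟩
  rw [show jacobiSym 8 32285041 = 1 by norm_num, show jacobiSym (-242) 32285041 = 1 by norm_num,
    jacobiSym.one_left] at s5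
  push_cast at f1 f2 f3 f4 f5
  clear * - hJ f1 s1 f2 s2 f3 s3 f4 s4 f5 s5
  omega

theorem odd_of_four_mul_eq {y m g : ℕ} (hm : Odd m) (hy : y % 8 = 3) (e : 4 * g = y ^ m + 1) :
    Odd g := by
  have := pow_eq_self_mod_eight (Nat.odd_iff.2 (show y % 2 = 1 by omega)) hm
  exact Nat.odd_iff.2 (by omega)

theorem jacobiSym_two_eq_of_eq_mul_add {p q y c m e g g' : ℕ} (hm : Odd m) (hq : Odd q)
    (hp : p = m * (2 * c + 1) + e) (hy : y % 8 = 3) (h0 : 4 * g = y ^ m + 1)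
    (h1 : 4 * g' = 3 * y ^ e + 1) (h : 2 ^ q + 1 = 3 * y ^ p) :
    jacobiSym 2 g = jacobiSym (-1) g * jacobiSym g' g := by
  have hg := odd_of_four_mul_eq hm hy h0
  have hc2 : IsCoprime (2 : ℤ) g := by
    exact_mod_cast Nat.isCoprime_iff_coprime.2 hg.coprime_two_left
  suffices key : jacobiSym (2 ^ q) g = jacobiSym (2 ^ 2 * (-1 * g')) g by
    rwa [jacobiSym_two_pow hq hg, jacobiSym.mul_left, jacobiSym.mul_left,
      jacobiSym_sq_eq_one hc2, one_mul] at key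
  apply jacobiSym_congr
  have hd := Odd.add_dvd_pow_add_pow ((y : ℤ) ^ m) 1 (⟨c, rfl⟩ : Odd (2 * c + 1))
  rw [one_pow, ← pow_mul] at hd
  have h0' : 4 * (g : ℤ) = (y : ℤ) ^ m + 1 := by exact_mod_cast h0
  have h1' : 4 * (g' : ℤ) = 3 * (y : ℤ) ^ e + 1 := by exact_mod_cast h1
  have h' : (2 : ℤ) ^ q + 1 = 3 * (y : ℤ) ^ p := by exact_mod_cast h
  obtain ⟨d, hd⟩ := (Dvd.intro_left _ h0').trans hd
  refine ⟨3 * d * (y : ℤ) ^ e, ?_⟩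
  rw [hp, pow_add] at h'
  linear_combination h' + 3 * (y : ℤ) ^ e * hd + h1'

theorem jacobiSym_two_eq_of_add_eq_mul {p q y c m f g g' : ℕ} (hm : Odd m) (hq : Odd q)
    (hf : Even f) (hp : p + f = m * (2 * c + 1)) (hy : y % 8 = 3) (h0 : 4 * g = y ^ m + 1)
    (h1 : 4 * g' = y ^ f + 3) (h : 2 ^ q + 1 = 3 * y ^ p) :
    jacobiSym 2 g = jacobiSym (-1) g * jacobiSym g' g := by
  have hg := odd_of_four_mul_eq hm hy h0
  have hc2 : IsCoprime (2 : ℤ) g := by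
    exact_mod_cast Nat.isCoprime_iff_coprime.2 hg.coprime_two_left
  have h0' : 4 * (g : ℤ) = (y : ℤ) ^ m + 1 := by exact_mod_cast h0
  have h1' : 4 * (g' : ℤ) = (y : ℤ) ^ f + 3 := by exact_mod_cast h1
  have h' : (2 : ℤ) ^ q + 1 = 3 * (y : ℤ) ^ p := by exact_mod_cast h
  have hcy : IsCoprime (y : ℤ) g := by
    obtain ⟨k, hk⟩ := hm
    rw [hk, pow_succ] at h0'
    exact ⟨-(y : ℤ) ^ (2 * k), 4, by linear_combination h0'⟩
  have hyf : jacobiSym ((y : ℤ) ^ f) g = 1 := by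
    obtain ⟨k, rfl⟩ := hf
    rw [← two_mul, mul_comm, pow_mul]
    exact jacobiSym_sq_eq_one hcy.pow_left
  suffices key : jacobiSym (2 ^ q * (y : ℤ) ^ f) g = jacobiSym (2 ^ 2 * (-1 * g')) g by
    rwa [jacobiSym.mul_left, jacobiSym_two_pow hq hg, hyf, mul_one, jacobiSym.mul_left,
      jacobiSym.mul_left, jacobiSym_sq_eq_one hc2, one_mul] at key
  apply jacobiSym_congr
  have hd := Odd.add_dvd_pow_add_pow ((y : ℤ) ^ m) 1 (⟨c, rfl⟩ : Odd (2 * c + 1))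
  rw [one_pow, ← pow_mul] at hd
  obtain ⟨d, hd⟩ := (Dvd.intro_left _ h0').trans hd
  refine ⟨3 * d, ?_⟩
  rw [← hp, pow_add] at hd
  linear_combination (y : ℤ) ^ f * h' + 3 * hd + h1'

theorem mod_eq_one_of_mod_eq_one {l n p q y : ℕ} (hl : l.Prime) (hl3 : 3 < l) (hp0 : p ≠ 0)
    (hp : p.Coprime (l - 1)) (hn : 2 ^ n % l = 1) (hq : q % n = 1)
    (h : 2 ^ q + 1 = 3 * y ^ p) : y % l = 1 := by
  refine mod_eq_one_of_pow_mod_eq_one hl hp0 hp ?_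
  have h2 : 2 ^ q ≡ 2 [MOD l] := by
    rw [← Nat.div_add_mod q n, hq, pow_succ, pow_mul]
    have : 2 ^ n ≡ 1 [MOD l] := by rw [Nat.ModEq, hn, Nat.mod_eq_of_lt hl.one_lt]
    simpa using (this.pow (q / n)).mul_right 2
  have h3 : 3 * y ^ p ≡ 3 * 1 [MOD l] := h ▸ h2.add_right 1
  have hc : Nat.gcd l 3 = 1 :=
    (Nat.coprime_primes hl Nat.prime_three).2 hl3.ne'
  have := Nat.ModEq.cancel_left_of_coprime hc h3
  rw [Nat.ModEq, Nat.mod_eq_of_lt hl.one_lt] at this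
  exact this

theorem mod_ninetysix_of_eq {p q y : ℕ} (hp : p % 24 = 1) (hq : q % 6 = 1) (hq5 : 5 ≤ q)
    (h : 2 ^ q + 1 = 3 * y ^ p) : y % 96 = 43 := by
  have hpo : Odd p := Nat.odd_iff.2 (by omega)
  have h32 := (mod_thirtytwo_of_eq hpo hq5 h).2 (by omega)
  have hq' : 2 ^ q % 9 = 2 := by
    obtain ⟨k, rfl⟩ : ∃ k, q = 6 * k + 1 := ⟨q / 6, by omega⟩
    rw [pow_succ, pow_mul, Nat.mul_mod, Nat.pow_mod]; norm_num
  have h3 : y % 3 = 1 := mod_eq_one_of_pow_mod_eq_one Nat.prime_three hpo.pos.ne'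
    (Nat.coprime_two_right.2 hpo) (by omega)
  omega

theorem coprime_of_prime_of_lt {p : ℕ} (hp : p.Prime) (h : 25 ≤ p) :
    Nat.Coprime (2 * 3 * 5 * 7 * 11 * 13 * 17) p := by
  refine (Nat.Coprime.symm (hp.coprime_iff_not_dvd.2 fun hd => ?_))
  simp only [hp.dvd_mul] at hd
  rcases hd with (((((h | h) | h) | h) | h) | h) | h <;>
  · have := Nat.le_of_dvd (by norm_num) h
    omega

set_option exponentiation.threshold 1100 in
theorem false_of_mod_five {p q y : ℕ} (hpp : p.Prime) (hp : p % 24 = 1)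
    (hm : p % 5 = 2 ∨ p % 5 = 3)
    (hq : q % 60 = 1) (hq5 : 5 ≤ q) (h : 2 ^ q + 1 = 3 * y ^ p) : False := by
  have hq2 : Odd q := Nat.odd_iff.2 (by omega)
  have hy := mod_ninetysix_of_eq hp (by omega) hq5 h
  have hy8 : y % 8 = 3 := by omega
  have hp73 : 25 ≤ p := by
    have := hpp.two_le
    omega
  have hmo : Odd 5 := by decide
  have hp8 := pow_eq_self_mod_eight (Nat.odd_iff.2 (show y % 2 = 1 by omega)) hmo
  have h61 : y % 61 = 1 := by
    refine mod_eq_one_of_mod_eq_one (n := 60) (by norm_num) (by norm_num) hpp.ne_zero ?_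
      (by norm_num) hq h
    refine Nat.Coprime.symm (Nat.Coprime.coprime_dvd_left 
      (show 60 ∣ (2 * 3 * 5 * 7 * 11 * 13 * 17) ^ 2 by norm_num) ?_)
    exact Nat.Coprime.pow_left 2 (coprime_of_prime_of_lt hpp hp73)
  rcases hm with hm | hm
  · have hr : y ^ 2 % 8 = 1 := by
      rw [Nat.pow_mod, hy8]
    obtain ⟨g0, e0⟩ : ∃ g0, 4 * g0 = y ^ 5 + 1 := ⟨(y ^ 5 + 1) / 4, by clear * - hp8 hy8; omega⟩
    obtain ⟨g1, e1⟩ : ∃ g1, 4 * g1 = 3 * y ^ 2 + 1 := ⟨(3 * y ^ 2 + 1) / 4, by clear * - hr; omega⟩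
    have hJ := jacobiSym_two_eq_of_eq_mul_add (c := p / 10) hmo hq2
      (by clear * - hp hm; omega) hy8 e0 e1 h
    exact false_of_jacobiSym_five_two hy h61 e0 e1 hJ
  · have hr : y ^ 2 % 8 = 1 := by
      rw [Nat.pow_mod, hy8]
    obtain ⟨g0, e0⟩ : ∃ g0, 4 * g0 = y ^ 5 + 1 := ⟨(y ^ 5 + 1) / 4, by clear * - hp8 hy8; omega⟩
    obtain ⟨g1, e1⟩ : ∃ g1, 4 * g1 = y ^ 2 + 3 := ⟨(y ^ 2 + 3) / 4, by clear * - hr; omega⟩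
    have hJ := jacobiSym_two_eq_of_add_eq_mul (c := (p + 2) / 10) hmo hq2 (by decide)
      (by clear * - hp hm; omega) hy8 e0 e1 h
    exact false_of_jacobiSym_five_three hy h61 e0 e1 hJ

set_option exponentiation.threshold 1100 in
theorem false_of_mod_seven {p q y : ℕ} (hpp : p.Prime) (hp : p % 24 = 1)
    (hm : p % 7 = 3 ∨ p % 7 = 5 ∨ p % 7 = 6)
    (hq : q % 546 = 1) (hq5 : 5 ≤ q) (h : 2 ^ q + 1 = 3 * y ^ p) : False := by
  have hq2 : Odd q := Nat.odd_iff.2 (by omega)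
  have hy := mod_ninetysix_of_eq hp (by omega) hq5 h
  have hy8 : y % 8 = 3 := by omega
  have hp73 : 25 ≤ p := by
    have := hpp.two_le
    omega
  have hmo : Odd 7 := by decide
  have hp8 := pow_eq_self_mod_eight (Nat.odd_iff.2 (show y % 2 = 1 by omega)) hmo
  have h547 : y % 547 = 1 := by
    refine mod_eq_one_of_mod_eq_one (n := 546) (by norm_num) (by norm_num) hpp.ne_zero ?_
      (by norm_num) hq h
    refine Nat.Coprime.symm (Nat.Coprime.coprime_dvd_left 
      (show 546 ∣ (2 * 3 * 5 * 7 * 11 * 13 * 17) ^ 2 by norm_num) ?_)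
    exact Nat.Coprime.pow_left 2 (coprime_of_prime_of_lt hpp hp73)
  rcases hm with hm | hm | hm
  · have hr : y ^ 4 % 8 = 1 := by
      rw [Nat.pow_mod, hy8]
    obtain ⟨g0, e0⟩ : ∃ g0, 4 * g0 = y ^ 7 + 1 := ⟨(y ^ 7 + 1) / 4, by clear * - hp8 hy8; omega⟩
    obtain ⟨g1, e1⟩ : ∃ g1, 4 * g1 = y ^ 4 + 3 := ⟨(y ^ 4 + 3) / 4, by clear * - hr; omega⟩
    have hJ := jacobiSym_two_eq_of_add_eq_mul (c := (p + 4) / 14) hmo hq2 (by decide)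
      (by clear * - hp hm; omega) hy8 e0 e1 h
    exact false_of_jacobiSym_seven_three hy h547 e0 e1 hJ
  · have hr : y ^ 2 % 8 = 1 := by
      rw [Nat.pow_mod, hy8]
    obtain ⟨g0, e0⟩ : ∃ g0, 4 * g0 = y ^ 7 + 1 := ⟨(y ^ 7 + 1) / 4, by clear * - hp8 hy8; omega⟩
    obtain ⟨g1, e1⟩ : ∃ g1, 4 * g1 = y ^ 2 + 3 := ⟨(y ^ 2 + 3) / 4, by clear * - hr; omega⟩
    have hJ := jacobiSym_two_eq_of_add_eq_mul (c := (p + 2) / 14) hmo hq2 (by decide)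
      (by clear * - hp hm; omega) hy8 e0 e1 h
    exact false_of_jacobiSym_seven_five hy h547 e0 e1 hJ
  · have hr : y ^ 6 % 8 = 1 := by
      rw [Nat.pow_mod, hy8]
    obtain ⟨g0, e0⟩ : ∃ g0, 4 * g0 = y ^ 7 + 1 := ⟨(y ^ 7 + 1) / 4, by clear * - hp8 hy8; omega⟩
    obtain ⟨g1, e1⟩ : ∃ g1, 4 * g1 = 3 * y ^ 6 + 1 := ⟨(3 * y ^ 6 + 1) / 4, by clear * - hr; omega⟩
    have hJ := jacobiSym_two_eq_of_eq_mul_add (c := p / 14) hmo hq2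
      (by clear * - hp hm; omega) hy8 e0 e1 h
    exact false_of_jacobiSym_seven_six hy h547 e0 e1 hJ

set_option exponentiation.threshold 1100 in
theorem false_of_mod_eleven {p q y : ℕ} (hpp : p.Prime) (hp : p % 24 = 1)
    (hm : p % 11 = 2 ∨ p % 11 = 6 ∨ p % 11 = 7 ∨ p % 11 = 8 ∨ p % 11 = 10)
    (hq : q % 660 = 1) (hq5 : 5 ≤ q) (h : 2 ^ q + 1 = 3 * y ^ p) : False := by
  have hq2 : Odd q := Nat.odd_iff.2 (by omega)
  have hy := mod_ninetysix_of_eq hp (by omega) hq5 h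
  have hy8 : y % 8 = 3 := by omega
  have hp73 : 25 ≤ p := by
    have := hpp.two_le
    omega
  have hmo : Odd 11 := by decide
  have hp8 := pow_eq_self_mod_eight (Nat.odd_iff.2 (show y % 2 = 1 by omega)) hmo
  have h67 : y % 67 = 1 := by
    refine mod_eq_one_of_mod_eq_one (n := 660) (by norm_num) (by norm_num) hpp.ne_zero ?_
      (by norm_num) hq h
    refine Nat.Coprime.symm (Nat.Coprime.coprime_dvd_left 
      (show 66 ∣ (2 * 3 * 5 * 7 * 11 * 13 * 17) ^ 2 by norm_num) ?_)
    exact Nat.Coprime.pow_left 2 (coprime_of_prime_of_lt hpp hp73)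
  have h661 : y % 661 = 1 := by
    refine mod_eq_one_of_mod_eq_one (n := 660) (by norm_num) (by norm_num) hpp.ne_zero ?_
      (by norm_num) hq h
    refine Nat.Coprime.symm (Nat.Coprime.coprime_dvd_left 
      (show 660 ∣ (2 * 3 * 5 * 7 * 11 * 13 * 17) ^ 2 by norm_num) ?_)
    exact Nat.Coprime.pow_left 2 (coprime_of_prime_of_lt hpp hp73)
  have hN : y % 44287 = 1 := (Nat.modEq_and_modEq_iff_modEq_mul (a := y) (b := 1)
    (show Nat.Coprime 67 661 by norm_num)).1
    ⟨h67, h661⟩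
  rcases hm with hm | hm | hm | hm | hm
  · have hr : y ^ 2 % 8 = 1 := by
      rw [Nat.pow_mod, hy8]
    obtain ⟨g0, e0⟩ : ∃ g0, 4 * g0 = y ^ 11 + 1 := ⟨(y ^ 11 + 1) / 4, by clear * - hp8 hy8; omega⟩
    obtain ⟨g1, e1⟩ : ∃ g1, 4 * g1 = 3 * y ^ 2 + 1 := ⟨(3 * y ^ 2 + 1) / 4, by clear * - hr; omega⟩
    have hJ := jacobiSym_two_eq_of_eq_mul_add (c := p / 22) hmo hq2
      (by clear * - hp hm; omega) hy8 e0 e1 h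
    exact false_of_jacobiSym_eleven_two hy hN e0 e1 hJ
  · have hr : y ^ 6 % 8 = 1 := by
      rw [Nat.pow_mod, hy8]
    obtain ⟨g0, e0⟩ : ∃ g0, 4 * g0 = y ^ 11 + 1 := ⟨(y ^ 11 + 1) / 4, by clear * - hp8 hy8; omega⟩
    obtain ⟨g1, e1⟩ : ∃ g1, 4 * g1 = 3 * y ^ 6 + 1 := ⟨(3 * y ^ 6 + 1) / 4, by clear * - hr; omega⟩
    have hJ := jacobiSym_two_eq_of_eq_mul_add (c := p / 22) hmo hq2
      (by clear * - hp hm; omega) hy8 e0 e1 h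
    exact false_of_jacobiSym_eleven_six hy hN e0 e1 hJ
  · have hr : y ^ 4 % 8 = 1 := by
      rw [Nat.pow_mod, hy8]
    obtain ⟨g0, e0⟩ : ∃ g0, 4 * g0 = y ^ 11 + 1 := ⟨(y ^ 11 + 1) / 4, by clear * - hp8 hy8; omega⟩
    obtain ⟨g1, e1⟩ : ∃ g1, 4 * g1 = y ^ 4 + 3 := ⟨(y ^ 4 + 3) / 4, by clear * - hr; omega⟩
    have hJ := jacobiSym_two_eq_of_add_eq_mul (c := (p + 4) / 22) hmo hq2 (by decide)
      (by clear * - hp hm; omega) hy8 e0 e1 h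
    rcases (by clear * - hy; omega : y % 192 = 43 ∨ y % 192 = 139) with hy' | hy'
    · exact false_of_jacobiSym_eleven_seven hy' hN e0 e1 hJ
    · exact false_of_jacobiSym_eleven_seven' hy' hN e0 e1 hJ
  · have hr : y ^ 8 % 8 = 1 := by
      rw [Nat.pow_mod, hy8]
    obtain ⟨g0, e0⟩ : ∃ g0, 4 * g0 = y ^ 11 + 1 := ⟨(y ^ 11 + 1) / 4, by clear * - hp8 hy8; omega⟩
    obtain ⟨g1, e1⟩ : ∃ g1, 4 * g1 = 3 * y ^ 8 + 1 := ⟨(3 * y ^ 8 + 1) / 4, by clear * - hr; omega⟩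
    have hJ := jacobiSym_two_eq_of_eq_mul_add (c := p / 22) hmo hq2
      (by clear * - hp hm; omega) hy8 e0 e1 h
    exact false_of_jacobiSym_eleven_eight hy hN e0 e1 hJ
  · have hr : y ^ 10 % 8 = 1 := by
      rw [Nat.pow_mod, hy8]
    obtain ⟨g0, e0⟩ : ∃ g0, 4 * g0 = y ^ 11 + 1 := ⟨(y ^ 11 + 1) / 4, by clear * - hp8 hy8; omega⟩
    obtain ⟨g1, e1⟩ : ∃ g1, 4 * g1 = 3 * y ^ 10 + 1 := ⟨(3 * y ^ 10 + 1) / 4, by clear * - hr; omega⟩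
    have hJ := jacobiSym_two_eq_of_eq_mul_add (c := p / 22) hmo hq2
      (by clear * - hp hm; omega) hy8 e0 e1 h
    exact false_of_jacobiSym_eleven_ten hy hN e0 e1 hJ

set_option maxHeartbeats 400000 in
set_option exponentiation.threshold 1100 in
theorem false_of_mod_seventeen {p q y : ℕ} (hpp : p.Prime) (hp : p % 24 = 1)
    (hm : p % 17 = 3 ∨ p % 17 = 10 ∧ p % 64 = 9)
    (hq : q % 1020 = 1) (hq5 : 8 ≤ q) (h : 2 ^ q + 1 = 3 * y ^ p) : False := by
  have hq2 : Odd q := Nat.odd_iff.2 (by omega)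
  have hy := mod_ninetysix_of_eq hp (by omega) (by omega) h
  have hy8 : y % 8 = 3 := by omega
  have hp73 : 25 ≤ p := by
    have := hpp.two_le
    omega
  have hmo : Odd 17 := by decide
  have hp8 := pow_eq_self_mod_eight (Nat.odd_iff.2 (show y % 2 = 1 by omega)) hmo
  have h103 : y % 103 = 1 := by
    refine mod_eq_one_of_mod_eq_one (n := 1020) (by norm_num) (by norm_num) hpp.ne_zero ?_
      (by norm_num) hq h
    refine Nat.Coprime.symm (Nat.Coprime.coprime_dvd_left 
      (show 102 ∣ (2 * 3 * 5 * 7 * 11 * 13 * 17) ^ 2 by norm_num) ?_)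
    exact Nat.Coprime.pow_left 2 (coprime_of_prime_of_lt hpp hp73)
  have h307 : y % 307 = 1 := by
    refine mod_eq_one_of_mod_eq_one (n := 1020) (by norm_num) (by norm_num) hpp.ne_zero ?_
      (by norm_num) hq h
    refine Nat.Coprime.symm (Nat.Coprime.coprime_dvd_left 
      (show 306 ∣ (2 * 3 * 5 * 7 * 11 * 13 * 17) ^ 2 by norm_num) ?_)
    exact Nat.Coprime.pow_left 2 (coprime_of_prime_of_lt hpp hp73)
  have h1021 : y % 1021 = 1 := by
    refine mod_eq_one_of_mod_eq_one (n := 1020) (by norm_num) (by norm_num) hpp.ne_zero ?_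
      (by norm_num) hq h
    refine Nat.Coprime.symm (Nat.Coprime.coprime_dvd_left 
      (show 1020 ∣ (2 * 3 * 5 * 7 * 11 * 13 * 17) ^ 2 by norm_num) ?_)
    exact Nat.Coprime.pow_left 2 (coprime_of_prime_of_lt hpp hp73)
  have hN : y % 32285041 = 1 := (Nat.modEq_and_modEq_iff_modEq_mul (a := y) (b := 1)
    (show Nat.Coprime (103 * 307) 1021 by norm_num)).1
    ⟨(Nat.modEq_and_modEq_iff_modEq_mul (a := y) (b := 1)
    (show Nat.Coprime 103 307 by norm_num)).1
    ⟨h103, h307⟩, h1021⟩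
  rcases hm with hm | ⟨hm, hm64⟩
  · have hr : y ^ 14 % 8 = 1 := by
      rw [Nat.pow_mod, hy8]
    obtain ⟨g0, e0⟩ : ∃ g0, 4 * g0 = y ^ 17 + 1 := ⟨(y ^ 17 + 1) / 4, by clear * - hp8 hy8; omega⟩
    obtain ⟨g1, e1⟩ : ∃ g1, 4 * g1 = y ^ 14 + 3 := ⟨(y ^ 14 + 3) / 4, by clear * - hr; omega⟩
    have hJ := jacobiSym_two_eq_of_add_eq_mul (c := (p + 14) / 34) hmo hq2 (by decide)
      (by clear * - hp hm; omega) hy8 e0 e1 h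
    exact false_of_jacobiSym_seventeen_three hy hN e0 e1 hJ
  · have hr : y ^ 10 % 8 = 1 := by
      rw [Nat.pow_mod, hy8]
    obtain ⟨g0, e0⟩ : ∃ g0, 4 * g0 = y ^ 17 + 1 := ⟨(y ^ 17 + 1) / 4, by clear * - hp8 hy8; omega⟩
    obtain ⟨g1, e1⟩ : ∃ g1, 4 * g1 = 3 * y ^ 10 + 1 := ⟨(3 * y ^ 10 + 1) / 4, by clear * - hr; omega⟩
    have hy256 : y ^ 9 % 256 = 171 := by
      have h1 : 256 ∣ 2 ^ q := pow_dvd_pow 2 hq5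
      have h2 : y ^ p % 256 = 171 := by clear * - h1 h; omega
      have h3 : y ^ 64 % 256 = 1 := by
        have h5 : y % 32 = 11 := by clear * - hy; omega
        have h4 : y ^ 8 % 256 % 32 = 1 := by
          rw [Nat.mod_mod_of_dvd _ (by norm_num), Nat.pow_mod, h5]
        have h6 : ∀ a < 256, a % 32 = 1 → a ^ 8 % 256 = 1 := by decide +kernel
        rw [show 64 = 8 * 8 by norm_num, pow_mul, Nat.pow_mod]
        exact h6 _ (Nat.mod_lt _ (by norm_num)) h4
      rw [← Nat.div_add_mod p 64, hm64, pow_add, pow_mul, Nat.mul_mod, Nat.pow_mod (y ^ 64), h3,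
        one_pow] at h2
      simpa using h2
    have hy' : y % 256 = 139 := by
      have h6 : ∀ a < 256, a ^ 9 % 256 = 171 → a = 139 := by decide +kernel
      exact h6 _ (Nat.mod_lt _ (by norm_num)) (by rw [← Nat.pow_mod, hy256])
    have hy768 : y % 768 = 139 := by clear * - hy hy'; omega
    have hJ := jacobiSym_two_eq_of_eq_mul_add (c := p / 34) hmo hq2
      (by clear * - hp hm; omega) hy8 e0 e1 h
    exact false_of_jacobiSym_seventeen_ten hy768 hN e0 e1 hJ

/-- `b ^ x % l`, computed with intermediate powers of moderate size. -/
def powMod (l b x : ℕ) : ℕ :=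
  (b ^ (x % 256) % l) * ((b ^ 256 % l) ^ (x / 256) % l) % l

theorem powMod_eq (l b x : ℕ) : powMod l b x = b ^ x % l := by
  rw [powMod, ← Nat.pow_mod, ← pow_mul, ← Nat.mul_mod, ← pow_add, Nat.mod_add_div]

theorem powMod_eq_powMod_iff {l b x b' x' : ℕ} :
    powMod l b x = powMod l b' x' ↔ (b : ZMod l) ^ x = (b' : ZMod l) ^ x' := by
  rw [powMod_eq, powMod_eq, ← ZMod.natCast_eq_natCast_iff', Nat.cast_pow, Nat.cast_pow]

theorem powMod_eq_one_iff {l b x : ℕ} (hl : 1 < l) :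
    powMod l b x = 1 ↔ (b : ZMod l) ^ x = 1 := by
  have := ZMod.natCast_eq_natCast_iff' (b ^ x) 1 l
  rwa [Nat.mod_eq_of_lt hl, Nat.cast_pow, Nat.cast_one, ← powMod_eq, Iff.comm] at this

/-- No integer in `[2, f]` divides `n`. -/
def noDivisorUpTo (n : ℕ) : ℕ → Bool
  | 0 => true
  | f + 1 => (Nat.beq f 0 || !Nat.beq (n % (f + 1)) 0) && noDivisorUpTo n f

theorem not_dvd_of_noDivisorUpTo {n f : ℕ} (h : noDivisorUpTo n f = true) {d : ℕ} (hd : 2 ≤ d)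
    (hdf : d ≤ f) : ¬ d ∣ n := by
  induction f with
  | zero => omega
  | succ f ih =>
    simp only [noDivisorUpTo, Bool.and_eq_true, Bool.or_eq_true, Nat.beq_eq,
      Bool.not_eq_true'] at h
    rcases hdf.eq_or_lt with rfl | hlt
    · intro hn
      rcases h.1 with h1 | h1
      · omega
      · rw [Nat.mod_eq_zero_of_dvd hn] at h1
        simp at h1
    · exact ih h.2 (by omega)

/-- Primality by trial division. -/
def isPrimeByTrial (n : ℕ) : Bool :=
  Nat.ble 2 n && noDivisorUpTo n (2 ^ (Nat.log2 n / 2 + 1))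

theorem prime_of_isPrimeByTrial {n : ℕ} (h : isPrimeByTrial n = true) : n.Prime := by
  simp only [isPrimeByTrial, Bool.and_eq_true, Nat.ble_eq] at h
  by_contra hn
  have h1 := Nat.minFac_sq_le_self (by omega) hn
  have h2 := Nat.minFac_dvd n
  have h3 := (Nat.minFac_prime (n := n) (by omega)).two_le
  refine not_dvd_of_noDivisorUpTo h.2 h3 ?_ h2
  have h4 : n < 2 ^ (Nat.log2 n + 1) := Nat.lt_log2_self
  have h5 : n.minFac ^ 2 < (2 ^ (Nat.log2 n / 2 + 1)) ^ 2 := by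
    refine h1.trans_lt (h4.trans_le ?_)
    rw [← pow_mul]
    exact Nat.pow_le_pow_right (by norm_num) (by omega)
  exact (lt_of_pow_lt_pow_left₀ 2 (by positivity) h5).le

/-- The congruence `x ≡ c [MOD gcd 12 m]` holds for some `c` in `cs`. -/
def compatible (cs : List ℕ) (m x : ℕ) : Bool :=
  cs.any fun c => Nat.beq (x % Nat.gcd 12 m) (c % Nat.gcd 12 m)

theorem compatible_mod {cs : List ℕ} {q : ℕ} (hq : q % 12 ∈ cs) (m : ℕ) :
    compatible cs m (q % m) = true := by
  simp only [compatible, List.any_eq_true, Nat.beq_eq]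
  refine ⟨_, hq, ?_⟩
  rw [Nat.mod_mod_of_dvd _ (Nat.gcd_dvd_right _ _), Nat.mod_mod_of_dvd _ (Nat.gcd_dvd_left _ _)]

/-- The condition on `x = q % (l - 1)` imposed by `2 ^ q + 1 = 3 * y ^ p` modulo the prime
`l = 2 * k * p + 1`. -/
def localTest (l k x : ℕ) : Bool :=
  Nat.beq ((powMod l 2 x + 1) % l) 0 || Nat.beq (powMod l (powMod l 2 x + 1) (2 * k))
    (powMod l 3 (2 * k))

theorem localTest_mod {p q y k : ℕ} (hl : (2 * k * p + 1).Prime) (hk : 0 < k) (hp : 1 < p)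
    (h : 2 ^ q + 1 = 3 * y ^ p) : localTest (2 * k * p + 1) k (q % (2 * k * p)) = true := by
  have := Fact.mk hl
  set l := 2 * k * p + 1 with hld
  have hkp : 1 < k * p := by nlinarith
  have h2 : ((2 : ℕ) : ZMod l) ^ (2 * k * p) = 1 := by
    have h2 : ((2 : ℕ) : ZMod l) ≠ 0 := by
      rw [Ne, ZMod.natCast_eq_zero_iff]
      intro hd
      have := Nat.le_of_dvd (by norm_num) hd
      nlinarith
    simpa [hld] using ZMod.pow_card_sub_one_eq_one h2
  have hq : 2 ^ (q % (2 * k * p)) % l = 2 ^ q % l := by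
    apply (ZMod.natCast_eq_natCast_iff' _ _ _).1
    conv_rhs => rw [← Nat.mod_add_div q (2 * k * p)]
    rw [Nat.cast_pow, Nat.cast_pow, pow_add, pow_mul, h2, one_pow, mul_one]
  have hq' : (2 ^ (q % (2 * k * p)) % l + 1) % l = 3 * y ^ p % l := by
    rw [hq, ← h]
    simp
  simp only [localTest, Bool.or_eq_true, Nat.beq_eq]
  rw [powMod_eq l 2, hq']
  by_cases hy : (y : ZMod l) = 0
  · left
    rw [ZMod.natCast_eq_zero_iff] at hy
    exact Nat.mod_eq_zero_of_dvd ((hy.trans (dvd_pow_self _ (by omega))).mul_left _)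
  · right
    rw [powMod_eq_powMod_iff, ← ZMod.natCast_mod (_ + 1), hq', ZMod.natCast_mod]
    have := ZMod.pow_card_sub_one_eq_one hy
    push_cast
    rw [mul_pow, ← pow_mul, mul_comm p, show 2 * k * p = l - 1 by omega, this, mul_one]

/-- Lift a list `s` of residues modulo `m` to residues modulo `m * (2 * k * p / gcd)`. -/
def liftResidues (cs : List ℕ) (p k m : ℕ) (s : List ℕ) : List ℕ :=
  s.flatMap fun x => ((List.range (2 * k * p / Nat.gcd m (2 * k * p))).map
    fun j => x + m * j).filter fun z =>
      compatible cs (Nat.lcm m (2 * k * p)) z &&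
        localTest (2 * k * p + 1) k (z % (2 * k * p))

theorem mod_mem_liftResidues {cs s : List ℕ} {p q y k m : ℕ} (hl : (2 * k * p + 1).Prime) (hk : 0 < k)
    (hp : 1 < p) (h : 2 ^ q + 1 = 3 * y ^ p) (hq : q % 12 ∈ cs) (hm : q % m ∈ s) :
    q % Nat.lcm m (2 * k * p) ∈ liftResidues cs p k m s := by
  have e : Nat.lcm m (2 * k * p) = m * (2 * k * p / Nat.gcd m (2 * k * p)) := by
    rw [Nat.lcm, Nat.mul_div_assoc _ (Nat.gcd_dvd_right _ _)]
  have h0 : 0 < 2 * k * p / Nat.gcd m (2 * k * p) :=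
    Nat.div_pos (Nat.le_of_dvd (by positivity) (Nat.gcd_dvd_right _ _))
      (Nat.gcd_pos_of_pos_right _ (by positivity))
  simp only [liftResidues, List.mem_flatMap, List.mem_filter, List.mem_map, List.mem_range,
    Bool.and_eq_true]
  refine ⟨_, hm, ⟨_, Nat.mod_lt (q / m) h0, ?_⟩, compatible_mod hq _, ?_⟩
  · rw [e, Nat.mod_mul]
  · rw [Nat.mod_mod_of_dvd _ (Nat.dvd_lcm_right _ _)]
    exact localTest_mod hl hk hp h

/-- Sieve the residues `s` modulo `m` with the primes `2 * k * p + 1`, `k` in `ks`, and test the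
surviving residues and the final modulus with `f`. -/
def sieve (cs : List ℕ) (p : ℕ) (f : ℕ → List ℕ → Bool) : List ℕ → ℕ → List ℕ → Bool
  | [], m, s => f m s
  | k :: ks, m, s => Nat.ble 1 k && isPrimeByTrial (2 * k * p + 1) &&
      sieve cs p f ks (Nat.lcm m (2 * k * p)) (liftResidues cs p k m s)

theorem exists_of_sieve {cs : List ℕ} {p q y : ℕ} {f : ℕ → List ℕ → Bool} (hp : 1 < p)
    (h : 2 ^ q + 1 = 3 * y ^ p) (hq : q % 12 ∈ cs) (ks : List ℕ) :
    ∀ (m : ℕ) (s : List ℕ), sieve cs p f ks m s = true → q % m ∈ s →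
      ∃ m' s', f m' s' = true ∧ q % m' ∈ s' := by
  induction ks with
  | nil => exact fun m s hs hm => ⟨m, s, hs, hm⟩
  | cons k ks ih =>
    intro m s hs hm
    simp only [sieve, Bool.and_eq_true, Nat.ble_eq] at hs
    exact ih _ _ hs.2 (mod_mem_liftResidues (prime_of_isPrimeByTrial hs.1.2) hs.1.1 hp h hq hm)

/-- If `a` is `2 ^ q` modulo the prime `l = 2 * k * p + 1`, then `q % p` lies in `s`. -/
def targetTest (cs : List ℕ) (p k : ℕ) (s : List ℕ) (a : ℕ) : Bool :=
  !(cs.any fun c => Nat.beq (powMod (2 * k * p + 1)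
      (a * 2 ^ (12 - c)) (2 * k * p / Nat.gcd 12 (2 * k * p))) 1) ||
    s.any fun r => Nat.beq (powMod (2 * k * p + 1) 2 (2 * k * r)) (powMod (2 * k * p + 1) a (2 * k))

theorem mod_mem_of_targetTest {cs s : List ℕ} {p q k a : ℕ} (hp : p.Prime)
    (hl : (2 * k * p + 1).Prime) (h2 : powMod (2 * k * p + 1) 2 (2 * k) ≠ 1) (hk : 0 < k)
    (hs : ∀ r ∈ s, r < p) (ha : (2 : ZMod (2 * k * p + 1)) ^ q = a) (hq : q % 12 ∈ cs)
    (h : targetTest cs p k s a = true) : q % p ∈ s := by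
  have := Fact.mk hl
  have := Fact.mk hp
  have hp1 := hp.two_le
  set l := 2 * k * p + 1 with hld
  have hkp : 1 < k * p := by nlinarith
  have h2l : (2 : ZMod l) ^ (2 * k * p) = 1 := by
    have h2 : ((2 : ℕ) : ZMod l) ≠ 0 := by
      rw [Ne, ZMod.natCast_eq_zero_iff]
      intro hd
      have := Nat.le_of_dvd (by norm_num) hd
      nlinarith
    simpa [hld] using ZMod.pow_card_sub_one_eq_one h2
  simp only [targetTest, Bool.or_eq_true, Bool.not_eq_true', List.any_eq_false,
    Nat.beq_eq, List.any_eq_true] at h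
  have hl1 : 1 < l := hl.one_lt
  rcases h with h | ⟨r, hr, h⟩
  · refine absurd ?_ (h _ hq)
    rw [powMod_eq_one_iff hl1]
    push_cast
    rw [← ha, ← pow_add, ← pow_mul]
    have h12 : q + (12 - q % 12) = 12 * (q / 12 + 1) := by omega
    obtain ⟨u, hu⟩ := Nat.gcd_dvd_left 12 (2 * k * p)
    have h13 : 12 * (q / 12 + 1) * (2 * k * p / Nat.gcd 12 (2 * k * p)) =
        (Nat.gcd 12 (2 * k * p) * (2 * k * p / Nat.gcd 12 (2 * k * p))) * (u * (q / 12 + 1)) := by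
      calc _ = (Nat.gcd 12 (2 * k * p) * u) * (q / 12 + 1) *
              (2 * k * p / Nat.gcd 12 (2 * k * p)) := by rw [← hu]
        _ = _ := by ring
    rw [h12, h13, Nat.mul_div_cancel' (Nat.gcd_dvd_right _ _), pow_mul, h2l, one_pow]
  · have h' := powMod_eq_powMod_iff.1 h
    push_cast at h'
    rw [← ha, ← pow_mul, mul_comm q, pow_mul _ _ r, pow_mul _ _ q] at h'
    have ho : orderOf ((2 : ZMod l) ^ (2 * k)) = p := by
      apply orderOf_eq_prime
      · rw [← pow_mul, h2l]
      · intro h3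
        apply h2
        rw [powMod_eq_one_iff hl1]
        push_cast
        exact h3
    have h4 := (orderOf_pos_iff.1 (hp.pos.trans_eq ho.symm)).pow_eq_pow_iff_modEq.1 h'
    rw [ho, Nat.ModEq, Nat.mod_eq_of_lt (hs r hr)] at h4
    exact h4 ▸ hr

/-- The residues of `q` modulo `p` all lie in `s`, by working modulo the prime
`l = 2 * k * p + 1`, where `g` is a primitive `2 * k`-th root of unity. -/
def initialTest (cs : List ℕ) (p k g : ℕ) (s : List ℕ) : Bool :=
  Nat.ble 1 k && isPrimeByTrial (2 * k * p + 1) && !Nat.beq (powMod (2 * k * p + 1) 2 (2 * k)) 1 &&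
  Nat.beq (powMod (2 * k * p + 1) g (2 * k)) 1 &&
  (List.range (2 * k)).all (fun i => Nat.beq i 0 || !Nat.beq (powMod (2 * k * p + 1) g i) 1) &&
  s.all (fun r => Nat.blt r p) && targetTest cs p k s (2 * k * p) &&
  (List.range (2 * k)).all fun i =>
    targetTest cs p k s ((3 * powMod (2 * k * p + 1) g i + 2 * k * p) % (2 * k * p + 1))

theorem mod_mem_of_initialTest {cs s : List ℕ} {p q y k g : ℕ} (hp : p.Prime)
    (h : 2 ^ q + 1 = 3 * y ^ p) (hq : q % 12 ∈ cs) (ht : initialTest cs p k g s = true) :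
    q % p ∈ s := by
  simp only [initialTest, Bool.and_eq_true, Nat.ble_eq, Bool.not_eq_true', List.all_eq_true,
    List.mem_range, Bool.or_eq_true, Nat.beq_eq, Nat.blt_eq] at ht
  obtain ⟨⟨⟨⟨⟨⟨⟨hk, hl⟩, h2⟩, hg⟩, hg'⟩, hs⟩, h0⟩, h1⟩ := ht
  have hl := prime_of_isPrimeByTrial hl
  have := Fact.mk hl
  have hp1 := hp.two_le
  have h2' : powMod (2 * k * p + 1) 2 (2 * k) ≠ 1 := by
    intro h3
    rw [h3] at h2
    simp at h2
  have hN := hl.one_lt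
  have hG : IsPrimitiveRoot (g : ZMod (2 * k * p + 1)) (2 * k) := by
    refine IsPrimitiveRoot.mk_of_lt _ (by omega) ?_ ?_
    · exact (powMod_eq_one_iff hN).1 hg
    · intro i hi hik hi1
      rcases hg' i hik with h3 | h3
      · omega
      · rw [(powMod_eq_one_iff hN).2 hi1] at h3
        simp at h3
  have hz : ((2 * k * p : ℕ) : ZMod (2 * k * p + 1)) = -1 := by
    have := ZMod.natCast_self (2 * k * p + 1)
    rw [Nat.cast_succ] at this
    exact eq_neg_of_add_eq_zero_left this
  have hz2 : (2 : ZMod (2 * k * p + 1)) ^ q = 3 * (y : ZMod (2 * k * p + 1)) ^ p - 1 := by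
    rw [eq_sub_iff_add_eq]
    exact_mod_cast congrArg (Nat.cast : ℕ → ZMod (2 * k * p + 1)) h
  by_cases hy : (y : ZMod (2 * k * p + 1)) = 0
  · refine mod_mem_of_targetTest hp hl h2' hk hs ?_ hq h0
    rw [hz2, hy, zero_pow hp.ne_zero, hz]
    ring
  · have h3 : ((y : ZMod (2 * k * p + 1)) ^ p) ^ (2 * k) = 1 := by
      have := ZMod.pow_card_sub_one_eq_one hy
      rwa [← pow_mul, mul_comm p]
    have : NeZero (2 * k) := ⟨by omega⟩
    obtain ⟨i, hi, h4⟩ := hG.eq_pow_of_pow_eq_one h3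
    refine mod_mem_of_targetTest hp hl h2' hk hs ?_ hq (h1 i hi)
    rw [hz2, ← h4, ZMod.natCast_mod, Nat.cast_add, hz, powMod_eq, Nat.cast_mul, ZMod.natCast_mod]
    push_cast
    ring

/-- Either no residue survives, or the surviving residues modulo `m` are `1` modulo a number for
which a quadratic reciprocity argument applies. -/
def finalTest (p m : ℕ) (s : List ℕ) : Bool :=
  s.isEmpty || Nat.beq (p % 24) 1 &&
    ([2, 3].contains (p % 5) && test 60 ||
      [3, 5, 6].contains (p % 7) && test 546 ||
      [2, 6, 7, 8, 10].contains (p % 11) && test 660 ||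
      (Nat.beq (p % 17) 3 || Nat.beq (p % 17) 10 && Nat.beq (p % 64) 9) && test 1020)
where
  test (o : ℕ) : Bool := Nat.beq (m % o) 0 && s.all fun x => Nat.beq (x % o) 1

/-- The possible residues modulo `12` of the exponent `q`. -/
def exponentResidues (p : ℕ) : List ℕ :=
  if p % 8 = 7 then [7, 11] else if p % 24 = 17 then [5, 11] else [1, 5, 7, 11]

/-- The sieve with data `(p, g, s, k, ks)`. -/
def fullSieve : ℕ × ℕ × List ℕ × ℕ × List ℕ → Bool
  | (p, g, s, k, ks) => initialTest (exponentResidues p) p k g s &&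
      sieve (exponentResidues p) p (finalTest p) ks p s

theorem mod_eq_one_of_test {q m o : ℕ} {s : List ℕ} (h : finalTest.test m s o = true)
    (hm : q % m ∈ s) : q % o = 1 := by
  simp only [finalTest.test, Bool.and_eq_true, Nat.beq_eq, List.all_eq_true] at h
  rw [← Nat.mod_mod_of_dvd q (Nat.dvd_of_mod_eq_zero h.1)]
  exact h.2 _ hm

theorem false_of_fullSieve {p q y g k : ℕ} {s ks : List ℕ} (hp : p.Prime)
    (hp8 : p % 8 = 1 ∨ p % 8 = 7) (hq : Odd q) (hq3 : ¬ 3 ∣ q) (hq8 : 8 ≤ q)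
    (h : 2 ^ q + 1 = 3 * y ^ p) (hs : fullSieve (p, g, s, k, ks) = true) : False := by
  have hp3 : p % 3 ≠ 0 := by
    intro h3
    have := (Nat.prime_dvd_prime_iff_eq Nat.prime_three hp).1 (Nat.dvd_of_mod_eq_zero h3)
    omega
  have hq1 := Nat.odd_iff.1 hq
  have hc : q % 12 ∈ exponentResidues p := by
    rw [exponentResidues]
    split_ifs with h7 h17
    · have := mod_four_of_eq h7 hq (by omega) h
      simp
      omega
    · have := mod_three_of_eq h17 hq hq3 (by omega) h
      simp
      omega
    · simp
      omega
  simp only [fullSieve, Bool.and_eq_true] at hs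
  obtain ⟨m, t, hf, hm⟩ := exists_of_sieve hp.one_lt h hc ks _ _ hs.2
    (mod_mem_of_initialTest hp h hc hs.1)
  simp only [finalTest, Bool.or_eq_true, Bool.and_eq_true, Nat.beq_eq, List.isEmpty_iff,
    List.contains_iff_mem, List.mem_cons, List.not_mem_nil, or_false] at hf
  rcases hf with rfl | ⟨h24, ((⟨h5, ht⟩ | ⟨h5, ht⟩) | ⟨h5, ht⟩) | ⟨h5, ht⟩⟩
  · simp at hm
  · exact false_of_mod_five hp h24 h5 (mod_eq_one_of_test ht hm) (by omega) h
  · exact false_of_mod_seven hp h24 h5 (mod_eq_one_of_test ht hm) (by omega) h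
  · exact false_of_mod_eleven hp h24 h5 (mod_eq_one_of_test ht hm) (by omega) h
  · exact false_of_mod_seventeen hp h24 h5 (mod_eq_one_of_test ht hm) hq8 h

/-- Sieve data for the primes `p < 5040` with `p % 8 = 1` or `p % 8 = 7`. -/
def sieveData : List (ℕ × ℕ × List ℕ × ℕ × List ℕ) := [
  (7, 12, [], 2, []), (17, 57, [], 3, []), (23, 46, [1], 1, [6]),
  (31, 305, [1, 8, 15, 25], 5, [6]), (41, 82, [0, 1, 2], 1, [15]),
  (47, 239, [0, 1, 2, 38], 3, [10]), (71, 277, [1, 38, 69], 4, [6]),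
  (73, 138, [1, 41, 60], 2, [140, 6]), (79, 203, [], 2, []), (89, 178, [0, 1, 2], 1, [12]),
  (97, 115, [1, 41], 2, [150]), (103, 367, [1, 2, 58], 3, [6]), (113, 226, [0, 1, 2], 1, [12]),
  (127, 301, [], 2, []), (137, 649, [119], 3, [4]), (151, 385, [1, 2, 69], 3, [8]),
  (167, 190, [0, 1, 2, 47, 64, 70, 95, 154], 7, [22]), (191, 382, [1], 1, [6]),
  (193, 317, [1], 2, [15, 2]), (199, 215, [], 2, []), (223, 1501, [10, 58, 122, 214], 6, [15]),
  (233, 466, [0, 1, 2], 1, [6]), (239, 478, [1], 1, [16]), (241, 705, [1], 3, [156, 56]),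
  (257, 862, [169], 3, [27]), (263, 640, [0, 1, 2], 3, [10]), (271, 1363, [0, 1, 2], 3, [6]),
  (281, 562, [0, 1, 2], 1, [15]), (311, 835, [1, 2, 44, 122], 3, [6]), (313, 1391, [1], 3, [60]),
  (337, 1175, [0, 1, 2, 89, 140, 212, 285], 5, [90]),
  (353, 4531, [1, 43, 68, 82, 107, 138, 249, 254], 7, [21]), (359, 718, [1], 1, [16]),
  (367, 286, [0, 1, 2], 3, [38]), (383, 1842, [], 6, []), (401, 22, [1, 248], 4, [6]),
  (409, 316, [1, 145, 378], 2, [156, 84]), (431, 862, [1], 1, [28]),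
  (433, 1323, [1, 255, 313], 2, [45, 2]), (439, 372, [1, 42, 114, 133, 366], 5, [42]),
  (449, 1439, [1], 4, [7, 21]), (457, 11525, [1, 19, 44, 63, 75, 112, 259, 399, 437], 15, [90]),
  (463, 1649, [355, 371, 374], 6, [12]), (479, 19, [0, 1, 2, 37], 4, [6]),
  (487, 589, [403], 2, [5]), (503, 240, [1, 2, 58, 102, 319], 3, [6]),
  (521, 4368, [0, 1, 2, 10, 55, 214, 226, 230, 236, 277, 372, 399, 424], 16, [18]),
  (569, 3124, [], 6, []), (577, 1621, [1, 64], 2, [105, 2]), (593, 1186, [0, 1, 2], 1, [3]),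
  (599, 3420, [1, 155], 4, [4]), (601, 1400, [1], 3, [21, 26]), (607, 423, [1, 2], 3, [24]),
  (617, 95, [0, 1, 2, 247, 287, 542], 4, [42]), (631, 1654, [1, 26, 385, 490, 496, 529], 5, [6]),
  (641, 1282, [0, 1, 2], 1, [3]), (647, 7332, [0, 1, 2, 36, 115, 252, 267, 515], 7, [10]),
  (673, 1834, [1, 147, 468], 2, [225, 2]), (719, 1438, [1], 1, [6]), (727, 2031, [], 2, []),
  (743, 1486, [1], 1, [22]), (751, 3716, [1, 2, 94, 221], 3, [6]),
  (761, 1522, [0, 1, 2], 1, [18]), (769, 6688, [0, 1, 2, 96, 554, 613, 680], 5, [126, 26]),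
  (809, 1618, [0, 1, 2], 1, [24]), (823, 3857, [1, 332, 494, 592, 710], 5, [12]),
  (839, 4903, [606, 721, 747, 784], 6, [15]), (857, 6261, [0, 1, 2, 147, 836], 4, [9, 18]),
  (863, 1498, [1, 2, 141], 3, [6]), (881, 9768, [2, 630], 9, [15]),
  (887, 1283, [0, 1, 2], 3, [24]), (911, 1822, [1], 1, [16]), (919, 1309, [709, 743], 2, [11]),
  (929, 146, [1, 468, 552, 809], 4, [7, 21]), (937, 2014, [1, 546, 642], 3, [105, 14]),
  (953, 1906, [0, 1, 2], 1, [6]), (967, 2105, [1, 442, 610, 636], 8, [14]),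
  (977, 6862, [0, 1, 2], 4, [39]),
  (983, 2490, [0, 1, 2, 324, 729, 738, 740, 747, 790, 908], 7, [10]),
  (991, 5028, [1, 125, 682, 846, 856, 980], 9, [14]),
  (1009, 456, [0, 1, 2, 240, 361, 515, 818, 847], 5, [15, 44, 6]), (1031, 2062, [1], 1, [6]),
  (1033, 3400, [1], 2, [210]), (1039, 1761, [], 2, []), (1049, 2098, [0, 1, 2], 1, [6]),
  (1063, 561, [979], 2, [3]), (1087, 3741, [], 2, []),
  (1097, 875, [1, 66, 241, 458, 712, 765, 946, 1086], 7, [15]), (1103, 2206, [1], 1, [18]),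
  (1129, 1474, [1], 2, [99, 30]), (1151, 5051, [1, 2, 92, 537], 3, [10]),
  (1153, 18520, [1, 3, 113, 330, 582, 702, 926, 934, 988, 1105], 11, [15, 90]),
  (1193, 2881, [1169], 3, [7]), (1201, 5369, [1, 100, 411], 3, [198, 5]),
  (1217, 11725, [2, 483, 1106], 12, [12]), (1223, 2446, [1], 1, [18]),
  (1231, 9327, [1, 560, 977, 1116], 8, [14]), (1249, 12192, [0, 1, 2, 295, 1083], 5, [195, 42]),
  (1279, 4121, [1, 105, 168, 827, 1004], 5, [6]), (1289, 2578, [0, 1, 2], 1, [15]),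
  (1297, 2743, [1, 699], 2, [240]), (1303, 17144, [1, 1213, 1241, 1300], 8, [20]),
  (1319, 11693, [1, 54, 272, 345, 642], 9, [12]), (1321, 4168, [1, 1001], 3, [273, 78]),
  (1327, 1804, [821], 2, [3]), (1361, 3093, [1], 3, [6]),
  (1367, 4285, [0, 1, 2, 845, 990], 4, [22]), (1399, 8291, [1, 110, 380, 1347], 9, [24]),
  (1409, 2818, [0, 1, 2], 1, [36]), (1423, 1193, [220], 2, [3]), (1433, 7394, [306], 3, [7]),
  (1439, 2878, [1], 1, [12]), (1447, 16677, [1, 243, 657, 937], 12, [12, 24]),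
  (1471, 18315, [0, 1, 2, 1296, 1379], 8, [14]), (1481, 2962, [0, 1, 2], 1, [3]),
  (1487, 5076, [1, 2, 1168], 3, [4]),
  (1489, 2055, [0, 1, 2, 41, 185, 355, 451, 1189], 5, [234, 21]), (1511, 3022, [1], 1, [6]),
  (1543, 2447, [], 2, []), (1553, 3139, [], 3, []), (1559, 3118, [1], 1, [10]),
  (1567, 1523, [638], 2, [3]), (1583, 3166, [1], 1, [18]), (1601, 3202, [0, 1, 2], 1, [18]),
  (1607, 4597, [1, 2, 1601], 3, [10]),
  (1609, 7837, [0, 1, 2, 359, 1089, 1183, 1192], 5, [182, 15]),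
  (1657, 16837, [0, 1, 2, 1236], 8, [60]), (1663, 752, [], 2, []),
  (1697, 6865, [1, 1214, 1323], 4, [4, 24]),
  (1721, 8144, [1, 214, 328, 596, 650, 699, 1275, 1304, 1428, 1556, 1568, 1694], 10, [15]),
  (1753, 2480, [1, 385, 417], 2, [60]), (1759, 9004, [1, 710, 812, 1072, 1482], 9, [14]),
  (1777, 304, [1, 1047], 2, [225, 2]), (1783, 11341, [], 6, []),
  (1801, 7761, [1, 94, 610, 619, 1318], 6, [66, 30]), (1823, 6543, [0, 1, 2], 3, [16]),
  (1831, 6629, [1, 2, 1282, 1434], 3, [8]), (1847, 6706, [1, 2, 78], 3, [24]),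
  (1871, 3847, [0, 1, 2, 615], 4, [6]), (1873, 5673, [1, 746], 3, [210]),
  (1879, 4108, [667, 1768], 2, [6]), (1889, 3778, [0, 1, 2], 1, [6]),
  (1913, 25739, [1, 128, 330, 344, 846, 1335, 1854], 7, [21]),
  (1951, 33820, [0, 1, 2, 208, 785, 876, 878, 986, 1009, 1217, 1478, 1485, 1529, 1906], 11, [14]),
  (1993, 766, [1, 864], 3, [15, 6]), (1999, 14636, [1, 97, 359, 802, 1041, 1229], 5, [12]),
  (2017, 5337, [1, 7], 2, [90]), (2039, 4078, [1], 1, [6]), (2063, 4126, [1], 1, [36]),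
  (2081, 5034, [33, 717], 3, [4]),
  (2087, 12642, [1, 730, 1130, 1233, 1525, 1740, 1864, 1963], 9, [18]),
  (2089, 39059, [1, 774, 860, 976, 1188, 1447, 1485, 1571, 1617, 1697, 1881], 11, [117, 21]),
  (2111, 15416, [1, 471, 854, 1822], 4, [10]), (2113, 9223, [1, 978, 1778, 2002], 6, [30]),
  (2129, 4258, [0, 1, 2], 1, [27]), (2137, 11432, [1, 56, 116, 613], 3, [300]),
  (2143, 6378, [], 2, []), (2153, 5521, [1296], 3, [12]),
  (2161, 7250, [1, 176, 1183, 1188], 3, [39, 14]), (2207, 3822, [1, 1508], 4, [4]),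
  (2239, 5096, [1, 739, 1491, 1609, 1791], 5, [30]), (2273, 4546, [0, 1, 2], 1, [27]),
  (2281, 2676, [1, 457, 1111], 3, [234, 126]), (2287, 2151, [1, 2, 1769, 2148], 3, [14]),
  (2297, 27998, [1, 684, 719, 826, 1083, 1752, 1966, 2064], 7, [33]),
  (2311, 14179, [420], 6, [14]), (2351, 4702, [1], 1, [30]),
  (2377, 20441, [0, 1, 2, 464, 1204, 1832], 9, [42, 180]), (2383, 7556, [1441], 2, [5]),
  (2393, 4786, [0, 1, 2], 1, [27]), (2399, 4798, [1], 1, [6]), (2417, 4174, [1, 409], 3, [30]),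
  (2423, 23108, [484, 1207, 1315], 6, [7]),
  (2441, 23795, [1, 69, 333, 461, 630, 693, 857, 897, 1041, 1524, 1930], 10, [18]),
  (2447, 3299, [0, 1, 2, 1751], 3, [18]),
  (2473, 10770, [1, 902, 1789, 1880, 1897, 2173, 2203], 8, [90]),
  (2503, 8839, [1, 494, 552, 1957, 2071, 2143], 5, [50]),
  (2521, 3668, [1, 140, 442, 568, 584, 1763], 6, [210, 44]), (2543, 5086, [1], 1, [6]),
  (2551, 10760, [0, 1, 2, 401, 2271], 3, [14]), (2591, 30686, [1, 832, 1239, 2360], 9, [16]),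
  (2593, 3635, [1, 550], 3, [150]), (2609, 20153, [0, 1, 2, 277, 1689], 4, [7, 21]),
  (2617, 14939, [0, 1, 2, 576, 1329, 2014, 2025, 2331], 5, [90]),
  (2633, 91271, [380, 477, 673, 1296, 1501, 1554, 2442], 18, [21]), (2647, 7849, [], 2, []),
  (2657, 36354, [1, 150, 333, 938, 1136, 1509], 7, [30]), (2663, 16322, [783], 6, [12]),
  (2671, 16903, [1, 444, 528, 1012, 1873, 2178], 5, [8]),
  (2687, 16037, [0, 1, 2, 268, 847, 993, 1695, 2006, 2034], 7, [30]),
  (2689, 11226, [0, 1, 2, 942, 1792, 2120], 5, [204, 15]), (2711, 15471, [0, 1, 2, 2466], 3, [6]),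
  (2713, 2573, [1, 974, 1928], 2, [75, 2]), (2719, 3894, [1, 106, 802, 1183, 1339], 5, [24]),
  (2729, 32339, [55, 1990], 6, [9]), (2753, 5506, [0, 1, 2], 1, [3]),
  (2767, 6250, [2735], 2, [3]),
  (2777, 12582, [1, 434, 628, 1363, 1602, 1631, 1860, 2032, 2557, 2626], 10, [15]),
  (2791, 14458, [1, 2, 1393, 2336], 3, [6]), (2801, 5684, [1, 2556], 4, [21]),
  (2833, 29248, [1, 420, 1752, 2093, 2596, 2772], 6, [45, 6]),
  (2857, 23678, [0, 1, 2, 1095, 1147, 1596, 1907, 2385], 5, [15, 14]),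
  (2879, 6524, [391, 1859, 2458], 6, [15]), (2887, 8095, [], 2, []), (2897, 14211, [1], 3, [9]),
  (2903, 5806, [1], 1, [10]), (2927, 15597, [0, 1, 2, 812, 2905], 4, [18]),
  (2953, 3014, [1, 830, 1425], 2, [195, 2]), (2969, 5938, [0, 1, 2], 1, [12]),
  (2999, 18824, [0, 1, 2], 4, [10]), (3001, 6388, [0, 1, 2, 417, 620, 1049, 1074], 5, [273, 6]),
  (3023, 6046, [1], 1, [6]), (3041, 17860, [0, 1, 2, 291], 4, [6]),
  (3049, 4718, [1, 666, 1674], 2, [150, 11]), (3079, 40331, [1, 711], 12, [12]),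
  (3089, 14530, [2, 2416, 2832], 9, [10]), (3119, 11418, [0, 1, 2], 4, [4, 12]),
  (3121, 5183, [1, 286, 676, 1328, 2160, 2636, 2737], 8, [234, 63]),
  (3137, 11919, [1, 1614, 3116], 4, [9]),
  (3167, 36553, [64, 100, 302, 784, 858, 2007, 2150, 2342], 18, [24]),
  (3169, 59642, [1, 289, 1087, 1097, 1248, 1354, 1581, 2038, 2202, 2263, 2753, 2824], 15, [182, 117]),
  (3191, 52287, [1, 2, 107, 323, 329, 805, 834, 880, 1534, 2394, 2463], 15, [30]),
  (3209, 19890, [0, 1, 2, 63], 4, [60]), (3217, 9151, [1, 111, 2951, 3184], 8, [60]),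
  (3257, 12324, [], 3, []),
  (3271, 67003, [0, 1, 2, 12, 1649, 1662, 2011, 2125, 2239, 2309, 2559, 2806, 3126], 11, [18]),
  (3313, 45062, [1, 167, 396, 529, 675, 940, 1505, 2038, 2680], 15, [90]),
  (3319, 13052, [1, 327, 2296, 3180], 5, [6]), (3329, 6658, [0, 1, 2], 1, [15]),
  (3343, 5416, [0, 1, 2, 356, 514, 810, 906, 1481, 2168, 2735, 2996, 3135, 3260], 11, [12]),
  (3359, 6718, [1], 1, [10]), (3361, 36742, [0, 1, 2, 530, 1510], 8, [99, 30]),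
  (3391, 19349, [0, 1, 2], 3, [6]), (3407, 3986, [1, 2, 1969], 3, [10]),
  (3433, 6819, [1, 256, 1340, 2822], 3, [30]), (3449, 6898, [0, 1, 2], 1, [15]),
  (3457, 13405, [1, 2094], 2, [180]), (3463, 18320, [1, 69, 1949, 2575], 5, [18]),
  (3511, 17387, [1, 2, 797], 3, [18]), (3527, 16826, [1, 2, 1486], 3, [42]),
  (3529, 34364, [0, 1, 2, 1513, 1613, 2930], 5, [30, 204]),
  (3559, 33595, [1, 2301, 2863, 2946], 5, [6]), (3583, 15336, [0, 1, 2, 2415], 3, [8]),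
  (3593, 7186, [0, 1, 2], 1, [6]), (3607, 39367, [1, 619, 2003, 2973, 3521], 8, [9, 18]),
  (3617, 18288, [1, 89, 278, 427, 750, 768, 1575, 2106, 2234, 2697, 3131, 3436, 3611], 10, [24]),
  (3623, 7246, [1], 1, [10]), (3631, 4436, [0, 1, 2], 3, [6]),
  (3671, 17398, [0, 1, 2, 1119, 2008], 3, [6]), (3673, 1320, [1], 3, [150]),
  (3697, 2292, [1, 2, 702, 2038, 3230, 3663], 12, [270]), (3719, 28175, [1, 683, 2582], 4, [10]),
  (3727, 5798, [1, 693, 1744, 2032, 3279], 12, [12, 24]), (3761, 7522, [0, 1, 2], 1, [3]),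
  (3767, 9717, [0, 1, 2, 342], 4, [9, 18]), (3769, 4009, [1], 2, [39, 14]),
  (3793, 9825, [1, 194, 232], 2, [210]), (3823, 11905, [1, 2278, 2718, 3715, 3772], 5, [8]),
  (3833, 6288, [886, 889, 1355, 1502, 1616, 1621, 1623, 2903, 2905, 2995, 3442, 3525, 3785], 30, [33]),
  (3847, 3289, [0, 1, 2, 2391, 2490, 3619], 8, [14]), (3863, 7726, [1], 1, [10]),
  (3881, 13573, [3065, 3649], 6, [9]),
  (3889, 3941, [0, 1, 2, 357, 934, 1202, 3211], 5, [110, 12]), (3911, 7822, [1], 1, [6]),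
  (3919, 14108, [1, 3524, 3589, 3817], 5, [12]), (3929, 22994, [72], 6, [22]),
  (3943, 1470, [], 2, []), (3967, 16215, [1, 591, 770, 876, 1061, 3433], 5, [38]),
  (4001, 11241, [1], 3, [9]), (4007, 10343, [1, 2, 3177, 3561], 3, [4]),
  (4049, 33962, [1], 6, [24]), (4057, 11373, [1, 760], 2, [30]), (4073, 8146, [0, 1, 2], 1, [3]),
  (4079, 2968, [1, 2554, 2788], 4, [4, 7]), (4111, 8175, [819, 2306, 3699], 6, [8]),
  (4127, 5222, [1, 2, 3544, 4081], 3, [18]), (4129, 31257, [1], 6, [195, 35]),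
  (4153, 7700, [1, 3187, 4051], 3, [240]),
  (4159, 73162, [0, 1, 2, 384, 419, 421, 615, 1206, 1283, 1865, 2060, 2316, 3372, 3507, 3549, 3551, 3837, 3952], 11, [30]),
  (4177, 9518, [0, 1, 2, 1538, 1561, 3724, 4049], 5, [120]),
  (4201, 32728, [0, 1, 2, 120, 810, 1677, 2463, 3268, 3467, 4151], 8, [99, 60]),
  (4217, 7148, [], 3, []), (4231, 15055, [], 6, []), (4241, 8536, [3038], 3, [6]),
  (4271, 8542, [1], 1, [18]), (4273, 15272, [1], 2, [20, 60]),
  (4289, 2085, [0, 1, 2, 2864, 3974], 4, [27]), (4297, 3041, [1, 3161], 2, [240]),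
  (4327, 39114, [1, 127, 2150, 2425, 2595, 3690, 4021], 5, [8]),
  (4337, 23375, [1, 935, 1220, 2186, 3596, 3660, 3766], 7, [39]), (4391, 8782, [1], 1, [4]),
  (4409, 8818, [0, 1, 2], 1, [12]), (4423, 6743, [1, 2, 2814, 4079], 3, [6]),
  (4441, 20805, [1], 3, [195, 14]), (4447, 12439, [], 2, []),
  (4457, 112582, [0, 1, 2, 180, 353, 661, 1096, 1735, 2053, 2148, 2351, 3274, 3960, 4369], 13, [15]),
  (4463, 29316, [0, 1, 2, 475, 1185, 1998, 2694, 3547], 7, [10]), (4481, 8962, [0, 1, 2], 1, [6]),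
  (4513, 43115, [0, 1, 2, 1154, 1449, 3013, 3138], 5, [150]), (4519, 8229, [], 2, []),
  (4561, 10890, [1], 3, [165, 80]), (4567, 17285, [], 2, []),
  (4583, 43363, [1, 222, 861, 1211, 1329, 1548, 1712, 2547, 2778, 2812, 3715, 4110], 13, [22]),
  (4591, 27223, [702, 740, 1596, 2596, 3570, 3840], 14, [23]),
  (4639, 95999, [0, 1, 2, 1001, 1732, 1963, 2038, 2193, 2334, 2408, 3570, 3945], 11, [14]),
  (4649, 53540, [], 12, [12]), (4657, 5647, [1, 3345], 3, [30]),
  (4663, 6467, [0, 1, 2, 915, 1059, 4336], 8, [42]),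
  (4673, 65315, [1, 96, 351, 2798, 4252, 4638], 7, [12]), (4679, 25206, [], 6, []),
  (4703, 3356, [0, 1, 2], 3, [6]), (4721, 19038, [2, 3747], 9, [10]),
  (4729, 1835, [1, 1392, 1537], 2, [110, 15]),
  (4751, 78156, [1997, 2038, 2056, 2136, 2565, 2705, 2814, 3286, 3835, 3921, 4572], 10, [13]),
  (4759, 13570, [2363, 3660], 2, [5]), (4783, 7831, [39, 871], 6, [11]),
  (4793, 9586, [0, 1, 2], 1, [3]), (4799, 6542, [1, 1315], 4, [4]),
  (4801, 10747, [1, 1400, 1473], 3, [273]),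
  (4817, 27686, [0, 1, 2, 224, 524, 573, 788, 810, 1241, 1629, 2071, 2574, 3841, 4781, 4801], 13, [15]),
  (4831, 37009, [1, 368, 2152, 2223, 3067], 5, [6]), (4871, 9742, [1], 1, [6]),
  (4889, 8917, [0, 1, 2, 1516, 3924], 4, [7, 21]),
  (4903, 19442, [1, 1164, 1539, 2202, 3700], 5, [18]), (4919, 9838, [1], 1, [6]),
  (4937, 30075, [1, 187, 665, 1380, 4317, 4550], 7, [9]), (4943, 9886, [1], 1, [18]),
  (4951, 46793, [1, 603, 2897, 2898, 3128], 9, [14]), (4967, 753, [0, 1, 2], 3, [18]),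
  (4969, 37705, [1, 1345, 1648, 2713, 3265, 4620], 6, [234, 14]),
  (4993, 6763, [1, 4943, 4949], 2, [120]), (4999, 17695, [], 2, []),
  (5009, 63589, [2, 1412, 3764], 9, [24]), (5023, 17198, [1, 2, 4059], 3, [8]),
  (5039, 10078, [1], 1, [22])]

set_option maxRecDepth 100000 in
theorem all_sieveData : sieveData.all fullSieve = true := by
  decide +kernel

set_option maxRecDepth 100000 in
theorem sieveData_complete : ((List.range 5040).all fun p =>
    !(Nat.beq (p % 8) 1 || Nat.beq (p % 8) 7) || Nat.ble p 1 ||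
      [3, 5, 7, 11, 13, 17, 19, 23, 29, 31, 37, 41, 43, 47, 53, 59, 61, 67].any
        (fun d => Nat.blt d p && Nat.beq (p % d) 0) ||
      sieveData.any fun d => Nat.beq d.1 p) = true := by
  decide +kernel

theorem exists_fullSieve {p : ℕ} (hp : p.Prime) (hp8 : p % 8 = 1 ∨ p % 8 = 7)
    (hlt : p < 5040) : ∃ g s k ks, fullSieve (p, g, s, k, ks) = true := by
  have h := List.all_eq_true.1 sieveData_complete p (List.mem_range.2 hlt)
  simp only [Bool.or_eq_true, Bool.not_eq_true', Bool.or_eq_false_iff, Nat.ble_eq,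
    List.any_eq_true, Bool.and_eq_true, Nat.blt_eq, Nat.beq_eq] at h
  rcases h with ((⟨h1, h7⟩ | h) | ⟨d, hd, hdp, h⟩) | ⟨⟨p', g, s, k, ks⟩, hd, h⟩
  · rcases hp8 with h | h
    · simp [h] at h1
    · simp [h] at h7
  · exact absurd hp.two_le (by omega)
  · rcases (Nat.dvd_prime hp).1 (Nat.dvd_of_mod_eq_zero h) with rfl | rfl
    · simp at hd
    · exact absurd hdp (lt_irrefl _)
  · obtain rfl : p' = p := h
    exact ⟨g, s, k, ks, List.all_eq_true.1 all_sieveData _ hd⟩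

theorem two_pow_add_one_ne_three_mul_pow {p q y : ℕ} (hp : p.Prime) (hp2 : p ≠ 2) (hq : Odd q)
    (hq3 : ¬ 3 ∣ q) (hy : 1 < y) : 2 ^ q + 1 ≠ 3 * y ^ p := by
  intro h
  have hodd := hp.odd_of_ne_two hp2
  have h3 : 3 * p ≤ q := three_mul_le_of_eq hodd hq hq3 hy h
  have hp3 : 3 ≤ p := hp.two_le.lt_of_ne' hp2
  rcases le_or_gt 5040 p with hbig | hlt
  · exact two_pow_add_one_ne_three_mul_pow_of_large hodd hbig h3 h
  by_cases h35 : p % 8 = 3 ∨ p % 8 = 5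
  · exact mod_eight_ne_of_eq h35 hq (by omega) h
  · have hp8 : p % 8 = 1 ∨ p % 8 = 7 := by
      have := Nat.odd_iff.1 hodd
      omega
    obtain ⟨g, s, k, ks, hs⟩ := exists_fullSieve hp hp8 hlt
    exact false_of_fullSieve hp hp8 hq hq3 (by omega) h hs

/-- The equation `2^r + 1 = 3^s · y^n` has no solution in positive integers
`r, s, y, n` with `3 ∤ y`, `y > 1` and `n > 1`. -/
theorem stmt_2 :
    ¬ ∃ r s y n : ℕ, 0 < r ∧ 0 < s ∧ 0 < y ∧ 0 < n ∧
      ¬ (3 ∣ y) ∧ 1 < y ∧ 1 < n ∧ 2 ^ r + 1 = 3 ^ s * y ^ n := by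
  rintro ⟨r, s, y, n, -, hs, -, hn0, hy3, hy, hn, h⟩
  obtain ⟨p, hp, m, rfl⟩ := Nat.exists_prime_and_dvd hn.ne'
  have hm : m ≠ 0 := by rintro rfl; simp at hn0
  rw [mul_comm p m, pow_mul] at h
  have hz : 1 < y ^ m := Nat.one_lt_pow hm hy
  have hz3 : ¬ 3 ∣ y ^ m := fun hd => hy3 (Nat.prime_three.dvd_of_dvd_pow hd)
  generalize y ^ m = z at h hz hz3
  rcases eq_or_ne p 2 with rfl | hp2
  · exact two_pow_add_one_ne_three_pow_mul_sq hs hz h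
  · exact hz.not_ge (le_one_of_two_pow_add_one_eq hp
      (fun q w hw hq3 hq => two_pow_add_one_ne_three_mul_pow hp hp2 hq hq3 hw) r s z hs hz3 h)
end

section
/- The only solutions in positive integers r, s, y, n with y > 1 and n > 1 of the equation 2^r · 3^s + 1 = y^n are (r,s,y,n) = (3,1,5,2), (4,1,7,2) and (5,2,17,2). -/
theorem two_pow_mul_three_pow_inj {a b c d : ℕ} (h : 2 ^ a * 3 ^ b = 2 ^ c * 3 ^ d) :
    a = c ∧ b = d := by
  have le : ∀ {a b c d : ℕ}, 2 ^ a * 3 ^ b = 2 ^ c * 3 ^ d → a ≤ c ∧ b ≤ d := by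
    intro a b c d h
    have h23 : ∀ i j : ℕ, Nat.Coprime (2 ^ i) (3 ^ j) :=
      fun i j => Nat.Coprime.pow i j (by norm_num)
    exact ⟨(Nat.pow_dvd_pow_iff_le_right (by norm_num)).1
        ((h23 a d).dvd_of_dvd_mul_right (h ▸ Dvd.intro _ rfl)),
      (Nat.pow_dvd_pow_iff_le_right (by norm_num)).1
        ((h23 c b).symm.dvd_of_dvd_mul_left (h ▸ Dvd.intro_left _ rfl))⟩
  exact ⟨le_antisymm (le h).1 (le h.symm).1, le_antisymm (le h).2 (le h.symm).2⟩

theorem eq_three_pow_of_odd_of_dvd {d r s : ℕ} (hd : Odd d) (h : d ∣ 2 ^ r * 3 ^ s) :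
    ∃ k, d = 3 ^ k := by
  have hc : Nat.Coprime d (2 ^ r) := (Nat.coprime_two_right.2 hd).pow_right r
  obtain ⟨k, -, hk⟩ := (Nat.dvd_prime_pow Nat.prime_three).1 (hc.dvd_of_dvd_mul_left h)
  exact ⟨k, hk⟩

theorem eq_two_pow_of_not_three_dvd_of_dvd {d r s : ℕ} (hd : ¬ 3 ∣ d)
    (h : d ∣ 2 ^ r * 3 ^ s) : ∃ k, d = 2 ^ k := by
  have hc : Nat.Coprime d (3 ^ s) :=
    ((Nat.Prime.coprime_iff_not_dvd Nat.prime_three).2 hd).symm.pow_right s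
  obtain ⟨k, -, hk⟩ := (Nat.dvd_prime_pow Nat.prime_two).1 (hc.dvd_of_dvd_mul_right h)
  exact ⟨k, hk⟩

theorem three_pow_eq_two_pow_add_one {k a : ℕ} (h : 3 ^ k = 2 ^ a + 1) :
    (k = 1 ∧ a = 1) ∨ (k = 2 ∧ a = 3) := by
  have ha : a < 4 := by
    by_contra! ha
    obtain ⟨b, rfl⟩ := Nat.exists_eq_add_of_le ha
    have h80 : 3 ^ k % 80 = 3 ^ (k % 4) % 80 := by
      conv_lhs => rw [← Nat.div_add_mod k 4, pow_add, pow_mul, Nat.mul_mod, Nat.pow_mod]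
      norm_num
    have h5 : ¬ 5 ∣ 2 ^ (4 + b) := fun h' =>
      absurd (Nat.prime_five.dvd_of_dvd_pow h') (by norm_num)
    have h16 : 2 ^ (4 + b) = 16 * 2 ^ b := by rw [pow_add]; norm_num
    have hk : k % 4 < 4 := Nat.mod_lt _ (by norm_num)
    interval_cases k % 4 <;> norm_num at h80 <;> omega
  have hk : k < 3 := by
    by_contra! hk
    have := Nat.pow_le_pow_right (n := 3) (by norm_num) hk
    interval_cases a <;> omega
  interval_cases a <;> interval_cases k <;> simp_all

theorem two_pow_eq_three_pow_add_one {k a : ℕ} (h : 2 ^ a = 3 ^ k + 1) (hk : k ≠ 0) :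
    k = 1 ∧ a = 2 := by
  have ha : a < 3 := by
    by_contra! ha
    obtain ⟨b, rfl⟩ := Nat.exists_eq_add_of_le ha
    have h8 : 3 ^ k % 8 = 3 ^ (k % 2) % 8 := by
      conv_lhs => rw [← Nat.div_add_mod k 2, pow_add, pow_mul, Nat.mul_mod, Nat.pow_mod]
      norm_num
    have hb : 2 ^ (3 + b) = 8 * 2 ^ b := by rw [pow_add]; norm_num
    have hk : k % 2 < 2 := Nat.mod_lt _ (by norm_num)
    interval_cases k % 2 <;> norm_num at h8 <;> omega
  have hk' : k < 2 := by
    by_contra! hk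
    have := Nat.pow_le_pow_right (n := 3) (by norm_num) hk
    interval_cases a <;> omega
  interval_cases a <;> interval_cases k <;> simp_all

theorem two_pow_mul_three_pow_add_one_eq_sq {r s z : ℕ} (hr : 0 < r) (hs : 0 < s)
    (h : 2 ^ r * 3 ^ s + 1 = z ^ 2) :
    (r = 3 ∧ s = 1 ∧ z = 5) ∨ (r = 4 ∧ s = 1 ∧ z = 7) ∨ (r = 5 ∧ s = 2 ∧ z = 17) := by
  have hz : Odd z := by
    have : Odd (z ^ 2) := h ▸ ((even_two.pow_of_ne_zero hr.ne').mul_right _).add_one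
    exact Nat.Odd.of_mul_left (sq z ▸ this)
  obtain ⟨w, rfl⟩ := hz
  have hw : 4 * (w * (w + 1)) = 2 ^ r * 3 ^ s := by nlinarith
  have hd₀ : w ∣ 2 ^ r * 3 ^ s := ⟨4 * (w + 1), by rw [← hw]; ring⟩
  have hd₁ : w + 1 ∣ 2 ^ r * 3 ^ s := ⟨4 * w, by rw [← hw]; ring⟩
  have three_dvd : ∀ {k : ℕ}, k ≠ 0 → 3 ∣ 3 ^ k := fun hk => dvd_pow_self 3 hk
  rcases Nat.even_or_odd w with he | ho
  · obtain ⟨k, hk⟩ := eq_three_pow_of_odd_of_dvd he.add_one hd₁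
    have hk0 : k ≠ 0 := by
      rintro rfl
      have : 0 < 2 ^ r * 3 ^ s := by positivity
      obtain rfl : w = 0 := by simpa using hk
      omega
    have h3 := three_dvd hk0
    obtain ⟨a, ha⟩ := eq_two_pow_of_not_three_dvd_of_dvd (by omega) hd₀
    have huniq : 2 ^ (a + 2) * 3 ^ k = 2 ^ r * 3 ^ s := by
      rw [← hw, hk, ha, pow_add]; ring
    obtain ⟨rfl, rfl⟩ := two_pow_mul_three_pow_inj huniq
    rcases three_pow_eq_two_pow_add_one (hk.symm.trans (by rw [ha])) with
      ⟨rfl, rfl⟩ | ⟨rfl, rfl⟩ <;> simp [ha]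
  · obtain ⟨k, hk⟩ := eq_three_pow_of_odd_of_dvd ho hd₀
    have hk0 : k ≠ 0 := by
      rintro rfl
      have h3 : 3 ∣ 2 ^ r * 3 ^ s := (three_dvd hs.ne').mul_left _
      obtain rfl : w = 1 := by simpa using hk
      omega
    have h3 := three_dvd hk0
    obtain ⟨a, ha⟩ := eq_two_pow_of_not_three_dvd_of_dvd (by omega) hd₁
    have huniq : 2 ^ (a + 2) * 3 ^ k = 2 ^ r * 3 ^ s := by
      rw [← hw, ha, hk, pow_add]; ring
    obtain ⟨rfl, rfl⟩ := two_pow_mul_three_pow_inj huniq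
    obtain ⟨rfl, rfl⟩ := two_pow_eq_three_pow_add_one (ha.symm.trans (by rw [hk])) hk0
    simp [hk]

theorem two_pow_mul_three_pow_add_one_ne_cube {r s z : ℕ} (hz : 1 < z) :
    2 ^ r * 3 ^ s + 1 ≠ z ^ 3 := by
  intro h
  have hd : z ^ 2 + z + 1 ∣ 2 ^ r * 3 ^ s := by
    obtain ⟨x, rfl⟩ := Nat.exists_eq_add_of_lt hz
    exact ⟨x + 1, by ring_nf at h ⊢; omega⟩
  have ho : Odd (z ^ 2 + z + 1) := by
    rw [sq]; exact (Nat.even_mul_succ_self z).add_one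
  obtain ⟨k, hk⟩ := eq_three_pow_of_odd_of_dvd ho hd
  have hk2 : 2 ≤ k := by
    by_contra! hk2
    interval_cases k <;> nlinarith
  have h9 : (z ^ 2 + z + 1) % 9 = 0 :=
    Nat.mod_eq_zero_of_dvd (hk ▸ pow_dvd_pow 3 hk2)
  have hlt : z % 9 < 9 := Nat.mod_lt _ (by norm_num)
  rw [Nat.add_mod, Nat.add_mod (z ^ 2), Nat.pow_mod] at h9
  interval_cases z % 9 <;> simp at h9

theorem three_dvd_of_two_pow_mul_three_pow_add_one_eq_pow {r s y n : ℕ} (hr : 0 < r)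
    (hs : 0 < s) (hy : 1 < y) (hn : 1 < n) (hodd : Odd n)
    (h : 2 ^ r * 3 ^ s + 1 = y ^ n) : 3 ∣ n := by
  have hyo : Odd y := by
    have : Odd (y ^ n) := h ▸ ((even_two.pow_of_ne_zero hr.ne').mul_right _).add_one
    exact (Nat.odd_pow_iff (by omega)).1 this
  have hy3 : (y : ZMod 3) = 1 := by
    have hc : (y : ZMod 3) ^ n = 1 := by
      have h3 : (3 : ZMod 3) = 0 := rfl
      have := congrArg (Nat.cast : ℕ → ZMod 3) h
      push_cast at this
      rw [← this, h3, zero_pow hs.ne']; ring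
    obtain ⟨m, rfl⟩ := hodd
    have hsq : (y : ZMod 3) ≠ 0 → (y : ZMod 3) ^ 2 = 1 := by
      generalize (y : ZMod 3) = x
      revert x
      decide
    have hy0 : (y : ZMod 3) ≠ 0 := by
      intro h0
      simp [h0] at hc
    rwa [pow_succ, pow_mul, hsq hy0, one_pow, one_mul] at hc
  have hgeom := geom_sum_mul_add (y - 1) n
  rw [Nat.sub_add_cancel hy.le, ← h, Nat.add_right_cancel_iff] at hgeom
  have hso : Odd (∑ i ∈ Finset.range n, y ^ i) := by
    rw [Finset.odd_sum_iff_odd_card_odd, Finset.filter_true_of_mem fun i _ => hyo.pow]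
    simpa using hodd
  obtain ⟨k, hk⟩ := eq_three_pow_of_odd_of_dvd hso (Dvd.intro _ hgeom)
  have hk0 : k ≠ 0 := by
    rintro rfl
    rw [pow_zero] at hk
    have hlt := Nat.pow_lt_pow_right hy hn
    rw [hk, one_mul] at hgeom
    rw [pow_one] at hlt
    omega
  have hcast := congrArg (Nat.cast : ℕ → ZMod 3) hk
  push_cast at hcast
  rw [hy3, show (3 : ZMod 3) = 0 from rfl, zero_pow hk0] at hcast
  simpa [ZMod.natCast_eq_zero_iff] using hcast

/-- The only solutions in positive integers `r, s, y, n` with `y > 1` and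
`n > 1` of `2^r · 3^s + 1 = y^n` are `(3,1,5,2)`, `(4,1,7,2)` and
`(5,2,17,2)`. -/
theorem stmt_4 (r s y n : ℕ) (hr : 0 < r) (hs : 0 < s) (hy : 1 < y)
    (hn : 1 < n) :
    2 ^ r * 3 ^ s + 1 = y ^ n ↔
      (r, s, y, n) = (3, 1, 5, 2) ∨ (r, s, y, n) = (4, 1, 7, 2) ∨
      (r, s, y, n) = (5, 2, 17, 2) := by
  simp only [Prod.mk.injEq]
  constructor
  · intro h
    rcases Nat.even_or_odd' n with ⟨m, rfl | hm⟩
    · have exponent_eq_one : ∀ {p : ℕ}, p.Prime → y ^ m = p → m = 1 := fun hp hpm =>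
        Nat.Prime.eq_one_of_pow (hpm ▸ hp)
      rw [mul_comm 2 m, pow_mul] at h
      rcases two_pow_mul_three_pow_add_one_eq_sq hr hs h with
        ⟨rfl, rfl, hz⟩ | ⟨rfl, rfl, hz⟩ | ⟨rfl, rfl, hz⟩ <;>
      · obtain rfl := exponent_eq_one (by norm_num) hz
        simpa using hz
    · obtain ⟨m, rfl⟩ :=
        three_dvd_of_two_pow_mul_three_pow_add_one_eq_pow hr hs hy hn ⟨_, hm⟩ h
      rw [mul_comm 3 m, pow_mul] at h
      exact absurd h (two_pow_mul_three_pow_add_one_ne_cube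
        (Nat.one_lt_pow (by omega) hy))
  · rintro (⟨rfl, rfl, rfl, rfl⟩ | ⟨rfl, rfl, rfl, rfl⟩ | ⟨rfl, rfl, rfl, rfl⟩) <;> norm_num
end
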